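/- The Hausdorff dimension of the set difference M ∖ L satisfies 0.531 < dimH(M ∖ L) < 0.987. -/

import Mathlib

open scoped ENNReal

/-- The distance from a real number to the nearest integer. -/
noncomputable def distNearestInt (x : ℝ) : ℝ := |x - round x|

/-- The best constant of Diophantine approximation of `α`,
`ℓ(α) = limsup_{q → ∞} 1 / (q ⬝ ‖q α‖) ∈ [0, ∞]`. -/
noncomputable def lagrangeVal (α : ℝ) : ℝ≥0∞ :=
  Filter.limsup (fun q : ℕ => ENNReal.ofReal (1 / (q * distNearestInt (q * α)))) Filter.atTop

/-- The Lagrange spectrum: the set of finite values `ℓ(α)` over irrational `α`. -/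
def LagrangeSpectrum : Set ℝ :=
  {t | ∃ α : ℝ, Irrational α ∧ lagrangeVal α ≠ ⊤ ∧ (lagrangeVal α).toReal = t}

/-- The best constant of Diophantine approximation of the binary quadratic form
`h(x,y) = a x² + b x y + c y²`, namely `m(h) = sup_{(p,q) ≠ (0,0)} √Δ(h) / |h(p,q)| ∈ (0, ∞]`. -/
noncomputable def markovVal (a b c : ℝ) : ℝ≥0∞ :=
  ⨆ (pq : ℤ × ℤ) (_ : pq ≠ (0, 0)),
    ENNReal.ofReal (Real.sqrt (b ^ 2 - 4 * a * c)) /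
      ENNReal.ofReal |a * (pq.1 : ℝ) ^ 2 + b * pq.1 * pq.2 + c * (pq.2 : ℝ) ^ 2|

/-- The Markov spectrum: the set of finite values `m(h)` over real indefinite binary
quadratic forms `h` with positive discriminant. -/
def MarkovSpectrum : Set ℝ :=
  {t | ∃ a b c : ℝ, 0 < b ^ 2 - 4 * a * c ∧ markovVal a b c ≠ ⊤ ∧ (markovVal a b c).toReal = t}

namespace MarkovLagrange

open Filter Topology

theorem abs_two_step_le {d e x y : ℝ} (hd : 1 ≤ d) (he : 1 ≤ e) (hx : 0 ≤ x) (hy : 0 ≤ y) :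
    |1 / (d + 1 / (e + x)) - 1 / (d + 1 / (e + y))| ≤ |x - y| / 4 := by
  have hx1 : 1 ≤ e + x := by linarith
  have hy1 : 1 ≤ e + y := by linarith
  have hX : 2 ≤ d * (e + x) + 1 := by nlinarith
  have hY : 2 ≤ d * (e + y) + 1 := by nlinarith
  have key : 1 / (d + 1 / (e + x)) - 1 / (d + 1 / (e + y)) =
      (x - y) / ((d * (e + x) + 1) * (d * (e + y) + 1)) := by
    have : e + x ≠ 0 := by positivity
    have : e + y ≠ 0 := by positivity
    field_simp
    ring
  rw [key, abs_div, abs_of_pos (by positivity : 0 < (d * (e + x) + 1) * (d * (e + y) + 1))]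
  apply div_le_div_of_nonneg_left (abs_nonneg _) (by norm_num)
  nlinarith

/-- The `n`-th truncation of the continued fraction `[0; a 0, a 1, …]`. -/
noncomputable def approx : ℕ → (ℕ → ℕ) → ℝ
  | 0, _ => 0
  | n + 1, a => 1 / (a 0 + approx n (fun k => a (k + 1)))

/-- The value of the infinite continued fraction `[0; a 0, a 1, …]`. -/
noncomputable def cfv (a : ℕ → ℕ) : ℝ := limUnder atTop (fun n => approx n a)

theorem one_div_add_mem {d x : ℝ} (hd : 1 ≤ d) (hx : x ∈ Set.Icc (0 : ℝ) 1) :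
    1 / (d + x) ∈ Set.Icc (0 : ℝ) 1 := by
  have h0 := hx.1
  refine ⟨by positivity, ?_⟩
  rw [div_le_one (by linarith)]
  linarith

theorem approx_mem (n : ℕ) (a : ℕ → ℕ) (ha : ∀ k, 1 ≤ a k) :
    approx n a ∈ Set.Icc (0 : ℝ) 1 := by
  induction n generalizing a with
  | zero => simp [approx]
  | succ n ih =>
    exact one_div_add_mem (by exact_mod_cast ha 0) (ih _ fun _ => ha _)

theorem abs_approx_sub_le (n j : ℕ) (a : ℕ → ℕ) (ha : ∀ k, 1 ≤ a k) :
    |approx (n + j) a - approx n a| ≤ 2 * (1 / 2) ^ n := by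
  induction n using Nat.twoStepInduction generalizing a with
  | zero =>
    have h1 := approx_mem (0 + j) a ha
    have h2 := approx_mem 0 a ha
    rw [abs_le]; constructor <;> [linarith [h1.1, h2.2]; linarith [h1.2, h2.1]]
  | one =>
    have h1 := approx_mem (1 + j) a ha
    have h2 := approx_mem 1 a ha
    rw [abs_le]; constructor <;> norm_num <;> [linarith [h1.1, h2.2]; linarith [h1.2, h2.1]]
  | more n ih _ =>
    have e : n + 2 + j = (n + j) + 2 := by ring
    rw [e]
    have h1 := approx_mem (n + j) (fun k => a (k + 1 + 1)) fun _ => ha _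
    have h2 := approx_mem n (fun k => a (k + 1 + 1)) fun _ => ha _
    have h := abs_two_step_le (d := a 0) (e := a (0 + 1)) (by exact_mod_cast ha 0)
      (by exact_mod_cast ha _) h1.1 h2.1
    refine h.trans ?_
    have := ih (fun k => a (k + 1 + 1)) fun _ => ha _
    rw [pow_add]; norm_num at this ⊢; linarith

theorem tendsto_two_mul_half_pow : Tendsto (fun n : ℕ => 2 * (1 / 2 : ℝ) ^ n) atTop (𝓝 0) := by
  have := (tendsto_pow_atTop_nhds_zero_of_lt_one (r := (1 / 2 : ℝ)) (by norm_num)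
    (by norm_num)).const_mul 2
  simpa using this

theorem tendsto_approx (a : ℕ → ℕ) (ha : ∀ k, 1 ≤ a k) :
    Tendsto (fun n => approx n a) atTop (𝓝 (cfv a)) := by
  have : CauchySeq (fun n => approx n a) := by
    refine cauchySeq_of_le_tendsto_0' (fun n : ℕ => 2 * (1 / 2 : ℝ) ^ n) ?_
      tendsto_two_mul_half_pow
    intro n m hnm
    obtain ⟨j, rfl⟩ := Nat.exists_eq_add_of_le hnm
    rw [dist_comm, Real.dist_eq]
    exact abs_approx_sub_le n j a ha
  exact this.tendsto_limUnder

theorem cfv_mem (a : ℕ → ℕ) (ha : ∀ k, 1 ≤ a k) : cfv a ∈ Set.Icc (0 : ℝ) 1 :=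
  isClosed_Icc.mem_of_tendsto (tendsto_approx a ha) (Eventually.of_forall fun n => approx_mem n a ha)

theorem cfv_rec (a : ℕ → ℕ) (ha : ∀ k, 1 ≤ a k) :
    cfv a = 1 / (a 0 + cfv (fun k => a (k + 1))) := by
  have h1 := (tendsto_approx a ha).comp (tendsto_add_atTop_nat 1)
  have h2 := tendsto_approx (fun k => a (k + 1)) fun _ => ha _
  have h3 := (cfv_mem (fun k => a (k + 1)) fun _ => ha _).1
  have h4 : (1 : ℝ) ≤ a 0 := by exact_mod_cast ha 0
  refine tendsto_nhds_unique h1 (Tendsto.div tendsto_const_nhds (h2.const_add _) ?_)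
  positivity

theorem cfv_pos (a : ℕ → ℕ) (ha : ∀ k, 1 ≤ a k) : 0 < cfv a := by
  rw [cfv_rec a ha]
  have h3 := (cfv_mem (fun k => a (k + 1)) fun _ => ha _).1
  have h4 : (1 : ℝ) ≤ a 0 := by exact_mod_cast ha 0
  positivity

theorem cfv_lt_one (a : ℕ → ℕ) (ha : ∀ k, 1 ≤ a k) : cfv a < 1 := by
  rw [cfv_rec a ha]
  have h3 := cfv_pos (fun k => a (k + 1)) fun _ => ha _
  have h4 : (1 : ℝ) ≤ a 0 := by exact_mod_cast ha 0
  rw [div_lt_one (by positivity)]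
  linarith

theorem abs_sub_le_of_rec (n : ℕ) (a : ℕ → ℕ) (x y : ℕ → ℝ) (ha : ∀ k < n, 1 ≤ a k)
    (hx : ∀ k, x k ∈ Set.Icc (0 : ℝ) 1) (hy : ∀ k, y k ∈ Set.Icc (0 : ℝ) 1)
    (hxr : ∀ k < n, x k = 1 / (a k + x (k + 1))) (hyr : ∀ k < n, y k = 1 / (a k + y (k + 1))) :
    |x 0 - y 0| ≤ 2 * (1 / 2) ^ n := by
  induction n using Nat.twoStepInduction generalizing a x y with
  | zero =>
    rw [abs_le]; constructor <;> norm_num <;> linarith [(hx 0).1, (hx 0).2, (hy 0).1, (hy 0).2]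
  | one =>
    rw [abs_le]; constructor <;> norm_num <;> linarith [(hx 0).1, (hx 0).2, (hy 0).1, (hy 0).2]
  | more n ih _ =>
    have h := ih (fun k => a (k + 2)) (fun k => x (k + 2)) (fun k => y (k + 2))
      (fun k hk => ha _ (by omega)) (fun k => hx _) (fun k => hy _)
      (fun k hk => hxr _ (by omega)) (fun k hk => hyr _ (by omega))
    rw [hxr 0 (by omega), hxr (0 + 1) (by omega), hyr 0 (by omega), hyr (0 + 1) (by omega)]
    refine (abs_two_step_le (by exact_mod_cast ha 0 (by omega))
      (by exact_mod_cast ha (0 + 1) (by omega)) (hx _).1 (hy _).1).trans ?_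
    rw [pow_add]; norm_num at h ⊢; linarith

theorem eq_cfv_of_rec (a : ℕ → ℕ) (x : ℕ → ℝ) (ha : ∀ k, 1 ≤ a k)
    (hx : ∀ k, x k ∈ Set.Icc (0 : ℝ) 1) (hxr : ∀ k, x k = 1 / (a k + x (k + 1))) :
    x 0 = cfv a := by
  have hn : ∀ n : ℕ, |x 0 - cfv a| ≤ 2 * (1 / 2) ^ n := fun n => by
    have := abs_sub_le_of_rec n a x (fun k => cfv (fun j => a (j + k))) (fun k _ => ha k) hx
      (fun k => cfv_mem _ fun j => ha _) (fun k _ => hxr k) (fun k _ => by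
        have := cfv_rec (fun j => a (j + k)) fun j => ha _
        simp only [zero_add] at this
        rw [this]
        congr 4
        ext j
        congr 1
        ring)
    simpa using this
  have := ge_of_tendsto' tendsto_two_mul_half_pow hn
  have := abs_nonneg (x 0 - cfv a)
  rw [← sub_eq_zero, ← abs_eq_zero]
  linarith

/-! ### Bi-infinite sequences -/

/-- `[0; a (i+1), a (i+2), …]`. -/
noncomputable def fwd (a : ℤ → ℕ) (i : ℤ) : ℝ := cfv (fun k : ℕ => a (i + 1 + k))

/-- `[0; a (i-1), a (i-2), …]`. -/
noncomputable def bwd (a : ℤ → ℕ) (i : ℤ) : ℝ := cfv (fun k : ℕ => a (i - 1 - k))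

/-- The height of the sequence `a` at position `i`. -/
noncomputable def lam (a : ℤ → ℕ) (i : ℤ) : ℝ := a i + fwd a i + bwd a i

/-- The sequence `a` has positive entries. -/
def BiPos (a : ℤ → ℕ) : Prop := ∀ i, 1 ≤ a i

/-- The reversed sequence. -/
def rev (a : ℤ → ℕ) : ℤ → ℕ := fun i => a (-i)

theorem BiPos.rev {a : ℤ → ℕ} (ha : BiPos a) : BiPos (rev a) := fun _ => ha _

theorem fwd_rev (a : ℤ → ℕ) (i : ℤ) : fwd (rev a) i = bwd a (-i) := by
  unfold fwd bwd rev
  congr 1; ext k; congr 1; ring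

theorem bwd_rev (a : ℤ → ℕ) (i : ℤ) : bwd (rev a) i = fwd a (-i) := by
  unfold fwd bwd rev
  congr 1; ext k; congr 1; ring

theorem lam_rev (a : ℤ → ℕ) (i : ℤ) : lam (rev a) i = lam a (-i) := by
  unfold lam
  rw [fwd_rev, bwd_rev]
  simp only [rev]; ring

theorem fwd_rec {a : ℤ → ℕ} (ha : BiPos a) (i : ℤ) :
    fwd a i = 1 / (a (i + 1) + fwd a (i + 1)) := by
  unfold fwd
  rw [cfv_rec _ fun _ => ha _]
  simp only [Nat.cast_zero, add_zero, Nat.cast_add, Nat.cast_one]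
  congr 4
  ext k; congr 1; ring

theorem bwd_rec {a : ℤ → ℕ} (ha : BiPos a) (i : ℤ) :
    bwd a i = 1 / (a (i - 1) + bwd a (i - 1)) := by
  have := fwd_rec ha.rev (-i)
  rw [fwd_rev, fwd_rev, rev] at this
  simpa [sub_eq_add_neg, add_comm] using this

theorem fwd_pos {a : ℤ → ℕ} (ha : BiPos a) (i : ℤ) : 0 < fwd a i := cfv_pos _ fun _ => ha _
theorem fwd_lt_one {a : ℤ → ℕ} (ha : BiPos a) (i : ℤ) : fwd a i < 1 := cfv_lt_one _ fun _ => ha _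
theorem bwd_pos {a : ℤ → ℕ} (ha : BiPos a) (i : ℤ) : 0 < bwd a i := cfv_pos _ fun _ => ha _
theorem bwd_lt_one {a : ℤ → ℕ} (ha : BiPos a) (i : ℤ) : bwd a i < 1 := cfv_lt_one _ fun _ => ha _

theorem abs_cfv_sub_le (n : ℕ) (a b : ℕ → ℕ) (ha : ∀ k, 1 ≤ a k) (hb : ∀ k, 1 ≤ b k)
    (h : ∀ k < n, a k = b k) : |cfv a - cfv b| ≤ 2 * (1 / 2) ^ n := by
  have hrec : ∀ (c : ℕ → ℕ), (∀ k, 1 ≤ c k) → ∀ k, cfv (fun j => c (j + k)) =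
      1 / (c k + cfv (fun j => c (j + (k + 1)))) := fun c hc k => by
    rw [cfv_rec _ fun j => hc _]
    simp only [zero_add]
    congr 4
    ext j; congr 1; ring
  have := abs_sub_le_of_rec n a (fun k => cfv (fun j => a (j + k)))
    (fun k => cfv (fun j => b (j + k))) (fun k _ => ha k) (fun k => cfv_mem _ fun j => ha _)
    (fun k => cfv_mem _ fun j => hb _) (fun k _ => hrec a ha k)
    (fun k hk => by rw [h k hk]; exact hrec b hb k)
  simpa using this

theorem abs_fwd_sub_le {a b : ℤ → ℕ} (ha : BiPos a) (hb : BiPos b) {i : ℤ} (n : ℕ)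
    (h : ∀ j, i < j → j ≤ i + n → a j = b j) : |fwd a i - fwd b i| ≤ 2 * (1 / 2) ^ n :=
  abs_cfv_sub_le n _ _ (fun _ => ha _) (fun _ => hb _) fun k hk => h _ (by omega) (by omega)

theorem abs_bwd_sub_le {a b : ℤ → ℕ} (ha : BiPos a) (hb : BiPos b) {i : ℤ} (n : ℕ)
    (h : ∀ j, j < i → i - n ≤ j → a j = b j) : |bwd a i - bwd b i| ≤ 2 * (1 / 2) ^ n :=
  abs_cfv_sub_le n _ _ (fun _ => ha _) (fun _ => hb _) fun k hk => h _ (by omega) (by omega)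

theorem fwd_congr {a b : ℤ → ℕ} {i : ℤ} (h : ∀ j, i < j → a j = b j) : fwd a i = fwd b i := by
  unfold fwd
  congr 1; ext k; exact h _ (by omega)

theorem bwd_congr {a b : ℤ → ℕ} {i : ℤ} (h : ∀ j, j < i → a j = b j) : bwd a i = bwd b i := by
  unfold bwd
  congr 1; ext k; exact h _ (by omega)

/-- `t` is the Markov value of `a`, attained at position `0`. -/
def Mark (a : ℤ → ℕ) (t : ℝ) : Prop := BiPos a ∧ (∀ i, lam a i ≤ t) ∧ lam a 0 = t

theorem Mark.rev {a : ℤ → ℕ} {t : ℝ} (h : Mark a t) : Mark (rev a) t :=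
  ⟨h.1.rev, fun i => by rw [lam_rev]; exact h.2.1 _, by rw [lam_rev]; simpa using h.2.2⟩

/-- The sequence shifted by `s`. -/
def shift (a : ℤ → ℕ) (s : ℤ) : ℤ → ℕ := fun i => a (i + s)

theorem fwd_shift (a : ℤ → ℕ) (s i : ℤ) : fwd (shift a s) i = fwd a (i + s) := by
  unfold fwd shift; congr 1; ext k; congr 1; ring
theorem bwd_shift (a : ℤ → ℕ) (s i : ℤ) : bwd (shift a s) i = bwd a (i + s) := by
  unfold bwd shift; congr 1; ext k; congr 1; ring
theorem lam_shift (a : ℤ → ℕ) (s i : ℤ) : lam (shift a s) i = lam a (i + s) := by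
  unfold lam; rw [fwd_shift, bwd_shift]; rfl

theorem exists_digits {x : ℝ} (hx : Irrational x) (h0 : 0 < x) (h1 : x < 1) :
    ∃ a : ℕ → ℕ, (∀ k, 1 ≤ a k) ∧ cfv a = x := by
  let X : ℕ → ℝ := fun n => Nat.rec x (fun _ y => Int.fract (1 / y)) n
  have hX : ∀ n, Irrational (X n) ∧ 0 < X n ∧ X n < 1 := by
    intro n
    induction n with
    | zero => exact ⟨hx, h0, h1⟩
    | succ n ih =>
      have hirr : Irrational (Int.fract (1 / X n)) := by
        have : Irrational (1 / X n) := by simpa using ih.1.inv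
        exact this.sub_intCast ⌊1 / X n⌋
      exact ⟨hirr, lt_of_le_of_ne (Int.fract_nonneg _) (hirr.ne_zero).symm, Int.fract_lt_one _⟩
  have hfl : ∀ n, 1 ≤ ⌊1 / X n⌋₊ := fun n => by
    apply Nat.le_floor
    rw [Nat.cast_one, le_div_iff₀ (hX n).2.1]
    linarith [(hX n).2.2]
  refine ⟨fun n => ⌊1 / X n⌋₊, hfl, ?_⟩
  refine (eq_cfv_of_rec _ X hfl (fun n => ⟨(hX n).2.1.le, (hX n).2.2.le⟩) fun n => ?_).symm
  have h2 : (⌊1 / X n⌋₊ : ℝ) + X (n + 1) = 1 / X n := by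
    have h3 : X (n + 1) = Int.fract (1 / X n) := rfl
    rw [h3, natCast_floor_eq_intCast_floor (by have := (hX n).2.1; positivity)]
    exact Int.floor_add_fract _
  rw [h2, one_div_one_div]

theorem cfv_ne_div (q : ℕ) : ∀ (a : ℕ → ℕ) (p : ℕ), (∀ k, 1 ≤ a k) → cfv a ≠ p / q := by
  induction q using Nat.strong_induction_on with
  | _ q ih =>
    intro a p ha h
    have h0 := cfv_pos a ha
    have h1 := cfv_lt_one a ha
    have hq : (0 : ℝ) < q := by
      rcases Nat.eq_zero_or_pos q with rfl | hq
      · simp [h] at h0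
      · exact_mod_cast hq
    have hp : (0 : ℝ) < p := by
      rw [h] at h0
      by_contra hp
      exact absurd h0 (not_lt.2 (div_nonpos_of_nonpos_of_nonneg (not_lt.1 hp) hq.le))
    have hpq : p < q := by
      rw [h, div_lt_one hq] at h1; exact_mod_cast h1
    have hs := cfv_rec a ha
    have hpos := cfv_pos (fun k => a (k + 1)) fun _ => ha _
    have ha0 : (1 : ℝ) ≤ a 0 := by exact_mod_cast ha 0
    have e : cfv (fun k => a (k + 1)) = (q - a 0 * p) / p := by
      rw [h] at hs
      have : (a 0 : ℝ) + cfv (fun k => a (k + 1)) ≠ 0 := by positivity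
      field_simp at hs ⊢
      linarith
    have hle : a 0 * p ≤ q := by
      rw [e] at hpos
      have : (0 : ℝ) < q - a 0 * p := by
        by_contra hc
        exact absurd hpos (not_lt.2 (div_nonpos_of_nonpos_of_nonneg (not_lt.1 hc) hp.le))
      have : (a 0 * p : ℝ) ≤ q := by linarith
      exact_mod_cast this
    refine ih p hpq (fun k => a (k + 1)) (q - a 0 * p) (fun _ => ha _) ?_
    rw [e, Nat.cast_sub hle, Nat.cast_mul]

theorem irrational_cfv (a : ℕ → ℕ) (ha : ∀ k, 1 ≤ a k) : Irrational (cfv a) := by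
  rintro ⟨r, hr⟩
  have h0 : 0 < r := by
    have := cfv_pos a ha
    rw [← hr] at this; exact_mod_cast this
  refine cfv_ne_div r.den a r.num.toNat ha ?_
  rw [← hr]
  have h1 : ((r.num.toNat : ℤ) : ℝ) = r.num := by
    rw [Int.toNat_of_nonneg (Rat.num_nonneg.2 h0.le)]
  have h2 : ((r.num.toNat : ℕ) : ℝ) = r.num := by exact_mod_cast h1
  rw [h2]
  exact Rat.cast_def r

/-- A bi-infinite sequence with prescribed two halves. -/
theorem exists_biinfinite (m : ℕ) (hm : 1 ≤ m) {x y : ℝ} (hx : Irrational x) (hx0 : 0 < x)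
    (hx1 : x < 1) (hy : Irrational y) (hy0 : 0 < y) (hy1 : y < 1) :
    ∃ a : ℤ → ℕ, BiPos a ∧ a 0 = m ∧ fwd a 0 = x ∧ bwd a 0 = y := by
  obtain ⟨b, hb, rfl⟩ := exists_digits hx hx0 hx1
  obtain ⟨c, hc, rfl⟩ := exists_digits hy hy0 hy1
  refine ⟨fun i => if i = 0 then m else if 0 < i then b (i - 1).toNat else c (-i - 1).toNat,
    fun i => ?_, by simp, ?_, ?_⟩
  · dsimp only
    split_ifs
    exacts [hm, hb _, hc _]
  · unfold fwd
    congr 1; ext k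
    have h1 : ¬ (0 + 1 + (k : ℤ) = 0) := by omega
    have h2 : (0 : ℤ) < 0 + 1 + k := by omega
    dsimp only
    rw [if_neg h1, if_pos h2]; congr 1; omega
  · unfold bwd
    congr 1; ext k
    have h1 : ¬ (0 - 1 - (k : ℤ) = 0) := by omega
    have h2 : ¬ (0 : ℤ) < 0 - 1 - k := by omega
    dsimp only
    rw [if_neg h1, if_neg h2]; congr 1; omega

theorem one_add_lt_of_ones {a : ℤ → ℕ} (ha : BiPos a) (i : ℤ) (h1 : a (i + 1) = 1) :
    1 / 2 < fwd a i := by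
  rw [fwd_rec ha, h1]
  have := fwd_lt_one ha (i + 1)
  have := fwd_pos ha (i + 1)
  apply one_div_lt_one_div_of_lt <;> norm_num <;> linarith

theorem exists_two_lt_lam {a : ℤ → ℕ} (ha : BiPos a) : ∃ i, 2 < lam a i := by
  by_contra! h
  have h1 : ∀ i, a i = 1 := fun i => by
    by_contra hne
    have h2 : 2 ≤ a i := by have := ha i; omega
    have h3 : (2 : ℝ) ≤ a i := by exact_mod_cast h2
    have := h i
    unfold lam at this
    linarith [fwd_pos ha i, bwd_pos ha i]
  have h2 := one_add_lt_of_ones ha 0 (h1 _)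
  have h3 := one_add_lt_of_ones ha.rev 0 (h1 _)
  rw [fwd_rev] at h3
  have := h 0
  unfold lam at this
  rw [h1] at this
  simp only [neg_zero] at h3
  norm_num at this
  linarith

theorem Mark.two_lt {a : ℤ → ℕ} {t : ℝ} (h : Mark a t) : 2 < t := by
  obtain ⟨i, hi⟩ := exists_two_lt_lam h.1
  exact hi.trans_le (h.2.1 i)

/-! ### From sequences to forms -/

/-- The larger root attached to position `i`. -/
noncomputable def rt (a : ℤ → ℕ) (i : ℤ) : ℝ := a i + fwd a i

theorem rt_pos {a : ℤ → ℕ} (ha : BiPos a) (i : ℤ) : 1 < rt a i := by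
  have : (1 : ℝ) ≤ a i := by exact_mod_cast ha i
  have := fwd_pos ha i
  unfold rt; linarith

theorem rt_rec {a : ℤ → ℕ} (ha : BiPos a) (i : ℤ) : rt a i = a i + 1 / rt a (i + 1) := by
  unfold rt; rw [fwd_rec ha]

theorem bwd_rec' {a : ℤ → ℕ} (ha : BiPos a) (i : ℤ) :
    bwd a i = 1 / bwd a (i + 1) - a i := by
  have := bwd_rec ha (i + 1)
  rw [this, add_sub_cancel_right, one_div_one_div]; ring

theorem form_step {a : ℤ → ℕ} (ha : BiPos a) (i : ℤ) (p q r : ℝ) (hr : r = p - a i * q) :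
    (p - rt a i * q) * (p + bwd a i * q) * (rt a (i + 1) * bwd a (i + 1)) =
      - ((q - rt a (i + 1) * r) * (q + bwd a (i + 1) * r)) := by
  have h1 := (rt_pos ha (i + 1))
  have h2 := bwd_pos ha (i + 1)
  have h3 : rt a (i + 1) ≠ 0 := by positivity
  rw [rt_rec ha, bwd_rec' ha, hr]
  field_simp
  ring

theorem lam_mul {a : ℤ → ℕ} (ha : BiPos a) (i : ℤ) :
    lam a i * (rt a (i + 1) * bwd a (i + 1)) = lam a (i + 1) := by
  have h1 := (rt_pos ha (i + 1))
  have h2 := bwd_pos ha (i + 1)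
  have h3 : rt a (i + 1) ≠ 0 := by positivity
  have e : ∀ j, lam a j = rt a j + bwd a j := fun j => rfl
  rw [e, e, rt_rec ha, bwd_rec' ha]
  field_simp
  ring

theorem lam_le_form_of_nonneg {t : ℝ} (ht : 2 < t) (n : ℕ) :
    ∀ {a : ℤ → ℕ}, BiPos a → (∀ i, lam a i ≤ t) → ∀ (i : ℤ) (p q : ℕ), p + q ≤ n →
      0 < p + q → lam a i ≤ t * |((p : ℝ) - rt a i * q) * (p + bwd a i * q)| := by
  induction n with
  | zero => intro a _ _ i p q h1 h2; omega
  | succ n ih =>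
    intro a ha hl i p q hpq h0
    have hb := bwd_pos ha i
    have hrt := rt_pos ha i
    have e : lam a i = rt a i + bwd a i := rfl
    rcases Nat.eq_zero_or_pos q with rfl | hq
    · have hp : (1 : ℝ) ≤ p := by exact_mod_cast (by omega : 1 ≤ p)
      simp only [Nat.cast_zero, mul_zero, sub_zero, add_zero]
      rw [abs_of_pos (by positivity)]
      have := hl i
      have : (1 : ℝ) ≤ p * p := by nlinarith
      nlinarith
    have hq' : (1 : ℝ) ≤ q := by exact_mod_cast hq
    rcases Nat.eq_zero_or_pos p with rfl | hp
    · have h1 := lam_mul ha (i - 1)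
      rw [sub_add_cancel] at h1
      have h2 := hl (i - 1)
      have h3 : |((0 : ℕ) - rt a i * q) * ((0 : ℕ) + bwd a i * q)| = rt a i * bwd a i * q ^ 2 := by
        rw [show ((0 : ℕ) - rt a i * q) * ((0 : ℕ) + bwd a i * q) = -(rt a i * bwd a i * q ^ 2) by
          push_cast; ring, abs_neg, abs_of_pos (by positivity)]
      rw [h3, ← h1]
      have h4 : 0 < rt a i * bwd a i := by positivity
      have h5 : lam a (i - 1) * (rt a i * bwd a i) ≤ t * (rt a i * bwd a i) := by gcongr
      have h6 : (1 : ℝ) ≤ q ^ 2 := by nlinarith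
      have h7 : t * (rt a i * bwd a i) * 1 ≤ t * (rt a i * bwd a i) * q ^ 2 := by gcongr
      linarith
    have hp' : (1 : ℝ) ≤ p := by exact_mod_cast hp
    rcases le_or_gt (a i * q) p with hle | hlt
    · have h1 : 0 < rt a (i + 1) * bwd a (i + 1) :=
        mul_pos (by linarith [rt_pos ha (i + 1)]) (bwd_pos ha _)
      have h2 := form_step ha i p q ((p - a i * q : ℕ) : ℝ) (by push_cast [hle]; ring)
      have hai := ha i
      have h3 := ih ha hl (i + 1) q (p - a i * q) (by
        have : 1 * q ≤ a i * q := Nat.mul_le_mul_right _ hai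
        omega) (by omega)
      have h4 := congrArg abs h2
      rw [abs_mul, abs_neg, abs_of_pos h1] at h4
      rw [← h4, ← lam_mul ha, ← mul_assoc t] at h3
      exact le_of_mul_le_mul_right h3 h1
    · have hlt' : (p : ℝ) + 1 ≤ a i * q := by exact_mod_cast hlt
      have hf := fwd_pos ha i
      set u := rt a i * q - p with hu
      set v := p + bwd a i * q with hv
      have hu1 : 1 ≤ u := by
        have : rt a i * q = a i * q + fwd a i * q := by unfold rt; ring
        have : 0 < fwd a i * q := by positivity
        linarith
      have hv1 : 1 ≤ v := by
        have : 0 < bwd a i * q := by positivity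
        linarith
      have huv : u + v = lam a i * q := by rw [hu, hv, e]; ring
      have habs : |(p - rt a i * q) * v| = u * v := by
        rw [show (p - rt a i * q) * v = -(u * v) by rw [hu]; ring, abs_neg,
          abs_of_pos (by positivity)]
      rw [habs]
      have h1 : u + v - 1 ≤ u * v := by nlinarith
      have hL := hl i
      have hlpos : 0 < lam a i := by rw [e]; positivity
      rcases le_or_gt 2 (lam a i) with h2 | h2
      · have : lam a i ≤ lam a i * q := by nlinarith
        nlinarith
      · have : 1 ≤ u * v := by nlinarith
        nlinarith

theorem lam_le_form {t : ℝ} (ht : 2 < t) {a : ℤ → ℕ} (ha : BiPos a) (hl : ∀ i, lam a i ≤ t)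
    (p q : ℤ) (h0 : (p, q) ≠ (0, 0)) :
    lam a 0 ≤ t * |((p : ℝ) - rt a 0 * q) * (p + bwd a 0 * q)| := by
  wlog hq : 0 ≤ q generalizing p q
  · have h := this (-p) (-q) (by simpa using h0) (by omega)
    rw [show ((p : ℝ) - rt a 0 * q) * (p + bwd a 0 * q) =
      (((-p : ℤ) : ℝ) - rt a 0 * (-q : ℤ)) * ((-p : ℤ) + bwd a 0 * (-q : ℤ)) by push_cast; ring]
    exact h
  have h0' : p ≠ 0 ∨ q ≠ 0 := by
    by_contra! h; exact h0 (by rw [h.1, h.2])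
  obtain ⟨q, rfl⟩ := Int.eq_ofNat_of_zero_le hq
  rcases le_or_gt 0 p with hp | hp
  · obtain ⟨p, rfl⟩ := Int.eq_ofNat_of_zero_le hp
    have := lam_le_form_of_nonneg ht (p + q) ha hl 0 p q le_rfl (by omega)
    exact_mod_cast this
  · have hr : (0 : ℤ) ≤ a 0 * q - p := by
      have : (0 : ℤ) ≤ a 0 * q := by positivity
      omega
    obtain ⟨r, hr'⟩ := Int.eq_ofNat_of_zero_le hr
    have := lam_le_form_of_nonneg ht (r + q) ha.rev (fun i => by rw [lam_rev]; exact hl _)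
      0 r q le_rfl (by have : (0 : ℤ) ≤ a 0 * q := by positivity
                       omega)
    rw [lam_rev, bwd_rev] at this
    unfold rt at this ⊢
    rw [fwd_rev] at this
    simp only [rev, neg_zero] at this
    have hr2 : (r : ℝ) = a 0 * q - p := by
      have : ((a 0 * q - p : ℤ) : ℝ) = ((r : ℤ) : ℝ) := by rw [hr']
      push_cast at this; exact this.symm
    rw [hr2] at this
    rw [show ((p : ℝ) - (a 0 + fwd a 0) * (q : ℤ)) * (p + bwd a 0 * (q : ℤ)) =
      (a 0 * q - p - (a 0 + bwd a 0) * q) * (a 0 * q - p + fwd a 0 * q) by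
      simp only [Int.cast_natCast]; ring]
    exact this

theorem markovSpectrum_of_mark {a : ℤ → ℕ} {t : ℝ} (h : Mark a t) : t ∈ MarkovSpectrum := by
  have ht := h.two_lt
  have h0 : rt a 0 + bwd a 0 = t := h.2.2
  have hdisc : (bwd a 0 - rt a 0) ^ 2 - 4 * 1 * (-(rt a 0 * bwd a 0)) = t ^ 2 := by
    rw [← h0]; ring
  have hval : markovVal 1 (bwd a 0 - rt a 0) (-(rt a 0 * bwd a 0)) = ENNReal.ofReal t := by
    unfold markovVal
    rw [hdisc, Real.sqrt_sq (by linarith)]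
    apply le_antisymm
    · refine iSup₂_le fun pq hpq => ?_
      have h1 := lam_le_form ht h.1 h.2.1 pq.1 pq.2 hpq
      rw [h.2.2] at h1
      have h2 : 1 ≤ |((pq.1 : ℝ) - rt a 0 * pq.2) * (pq.1 + bwd a 0 * pq.2)| := by
        by_contra! hc
        nlinarith
      refine ENNReal.div_le_of_le_mul ?_
      rw [← ENNReal.ofReal_mul (by linarith)]
      apply ENNReal.ofReal_le_ofReal
      rw [show 1 * (pq.1 : ℝ) ^ 2 + (bwd a 0 - rt a 0) * pq.1 * pq.2 +
        -(rt a 0 * bwd a 0) * (pq.2 : ℝ) ^ 2 =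
        ((pq.1 : ℝ) - rt a 0 * pq.2) * (pq.1 + bwd a 0 * pq.2) by ring]
      nlinarith
    · refine le_iSup₂_of_le (1, 0) (by simp) ?_
      simp
  refine ⟨1, bwd a 0 - rt a 0, -(rt a 0 * bwd a 0), ?_, ?_, ?_⟩
  · rw [hdisc]; positivity
  · rw [hval]; exact ENNReal.ofReal_ne_top
  · rw [hval]; exact ENNReal.toReal_ofReal (by linarith)

/-! ### From forms to sequences -/

/-- The inequality `|h| ≥ √Δ / t` for the form with roots `rt a i` and `-bwd a i`. -/
def FormBound (a : ℤ → ℕ) (t : ℝ) (i : ℤ) : Prop :=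
  ∀ p q : ℤ, (p, q) ≠ (0, 0) → lam a i ≤ t * |((p : ℝ) - rt a i * q) * (p + bwd a i * q)|

theorem FormBound.succ {a : ℤ → ℕ} (ha : BiPos a) {t : ℝ} {i : ℤ} (h : FormBound a t i) :
    FormBound a t (i + 1) := by
  intro q r hqr
  have h1 := h (r + a i * q) q (by
    simp only [ne_eq, Prod.mk.injEq, not_and] at hqr ⊢
    intro h1 h2
    subst h2
    simp only [mul_zero, add_zero] at h1
    exact hqr rfl h1)
  have h2 := form_step ha i ((r + a i * q : ℤ) : ℝ) q r (by push_cast; ring)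
  have h3 : 0 < rt a (i + 1) * bwd a (i + 1) :=
    mul_pos (by linarith [rt_pos ha (i + 1)]) (bwd_pos ha _)
  have h4 := congrArg abs h2
  rw [abs_mul, abs_neg, abs_of_pos h3] at h4
  rw [← h4, ← lam_mul ha, ← mul_assoc t]
  exact mul_le_mul_of_nonneg_right h1 h3.le

theorem FormBound.rev {a : ℤ → ℕ} {t : ℝ} (h : FormBound a t 0) : FormBound (rev a) t 0 := by
  intro p q hpq
  have h1 := h (a 0 * q - p) q (by
    simp only [ne_eq, Prod.mk.injEq, not_and] at hpq ⊢
    intro h1 h2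
    subst h2
    simp only [mul_zero, zero_sub, neg_eq_zero] at h1
    exact hpq h1 rfl)
  rw [lam_rev, bwd_rev]
  unfold rt at h1 ⊢
  rw [fwd_rev]
  simp only [MarkovLagrange.rev, neg_zero]
  convert h1 using 3
  push_cast
  ring

theorem FormBound.lam_le {a : ℤ → ℕ} (ha : BiPos a) {t : ℝ} (h : FormBound a t 0) (i : ℤ) :
    lam a i ≤ t := by
  have key : ∀ {a : ℤ → ℕ}, BiPos a → FormBound a t 0 → ∀ n : ℕ, lam a n ≤ t := by
    intro a ha h n
    have h1 : FormBound a t n := by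
      induction n with
      | zero => exact h
      | succ n ih => exact_mod_cast ih.succ ha
    simpa using h1 1 0 (by simp)
  obtain ⟨n, rfl | rfl⟩ := i.eq_nat_or_neg
  · exact key ha h n
  · rw [← lam_rev]; exact key ha.rev h.rev n

theorem exists_mark_of_roots {x y t : ℝ} (ht : 0 < t) (hxy : x + y = t) (hy0 : 0 ≤ y) (hy1 : y ≤ 1)
    (h : ∀ p q : ℤ, (p, q) ≠ (0, 0) → 1 ≤ |((p : ℝ) - x * q) * (p + y * q)|) :
    ∃ a, Mark a t := by
  have hirr : ∀ z : ℝ, (∀ p q : ℤ, (p, q) ≠ (0, 0) → (p : ℝ) - z * q ≠ 0) → Irrational z := by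
    rintro z hz ⟨r, rfl⟩
    refine hz r.num r.den (by simp) ?_
    have : (r.den : ℝ) ≠ 0 := by exact_mod_cast r.den_nz
    have h2 : (r : ℝ) = r.num / r.den := Rat.cast_def r
    rw [h2]; push_cast; field_simp; ring
  have hx : Irrational x := hirr x fun p q hpq h0 => by
    have := h p q hpq
    rw [h0] at this; norm_num at this
  have hy : Irrational y := hirr y fun p q hpq h0 => by
    have := h p (-q) (by simpa using hpq)
    have e : (p : ℝ) + y * (-q : ℤ) = 0 := by push_cast; linarith
    rw [e] at this; norm_num at this
  have hy0' : 0 < y := lt_of_le_of_ne hy0 hy.ne_zero.symm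
  have hy1' : y < 1 := lt_of_le_of_ne hy1 hy.ne_one
  have hx1 : 1 < x := by
    have := h 0 1 (by simp)
    rw [show (((0 : ℤ) : ℝ) - x * (1 : ℤ)) * ((0 : ℤ) + y * (1 : ℤ)) = -(x * y) by push_cast; ring,
      abs_neg, abs_mul, abs_of_pos hy0'] at this
    have h1 : 1 < |x| := by
      by_contra! hc
      nlinarith
    rcases lt_abs.1 h1 with h2 | h2 <;> linarith
  have hfx : Irrational (Int.fract x) := hx.sub_intCast ⌊x⌋
  have hfl : 1 ≤ ⌊x⌋₊ := Nat.le_floor (by simpa using hx1.le)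
  obtain ⟨a, ha, ha0, haf, hab⟩ := exists_biinfinite ⌊x⌋₊ hfl hfx
    (lt_of_le_of_ne (Int.fract_nonneg _) hfx.ne_zero.symm) (Int.fract_lt_one _) hy hy0' hy1'
  have hrt : rt a 0 = x := by
    unfold rt
    rw [ha0, haf, natCast_floor_eq_intCast_floor (by linarith)]
    exact Int.floor_add_fract x
  have hlam : lam a 0 = t := by
    rw [← hxy, ← hrt, ← hab]; rfl
  have hF : FormBound a t 0 := by
    intro p q hpq
    rw [hrt, hab, hlam]
    have := h p q hpq
    nlinarith
  exact ⟨a, ha, hF.lam_le ha, hlam⟩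

theorem exists_normalized_roots {a b c μ : ℝ} (hΔ : 0 < b ^ 2 - 4 * a * c) (hμ : 0 < μ)
    (hmin : ∀ p q : ℤ, (p, q) ≠ (0, 0) → μ ≤ |a * p ^ 2 + b * p * q + c * q ^ 2|)
    {p q : ℤ} (hpq : (p, q) ≠ (0, 0)) (hlt : |a * p ^ 2 + b * p * q + c * q ^ 2| < 4 * μ) :
    ∃ x y : ℝ, x + y = √(b ^ 2 - 4 * a * c) / |a * p ^ 2 + b * p * q + c * q ^ 2| ∧
      y ∈ Set.Icc (0 : ℝ) 1 ∧ ∀ m n : ℤ, (m, n) ≠ (0, 0) →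
        μ ≤ |a * p ^ 2 + b * p * q + c * q ^ 2| * |((m : ℝ) - x * n) * (m + y * n)| := by
  have hcop : IsCoprime p q := by
    rw [Int.isCoprime_iff_gcd_eq_one]
    obtain ⟨p', hp'⟩ := Int.gcd_dvd_left p q
    obtain ⟨q', hq'⟩ := Int.gcd_dvd_right p q
    set g : ℕ := Int.gcd p q
    have hne : (p', q') ≠ (0, 0) := by
      rintro h0
      simp only [Prod.mk.injEq] at h0
      rw [h0.1, mul_zero] at hp'
      rw [h0.2, mul_zero] at hq'
      exact hpq (by rw [hp', hq'])
    have h1 := hmin p' q' hne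
    have hg0 : g ≠ 0 := by
      intro h0
      rw [h0] at hp' hq'
      simp only [Nat.cast_zero, zero_mul] at hp' hq'
      exact hpq (by rw [hp', hq'])
    by_contra hg
    have hg2 : (2 : ℝ) ≤ g := by exact_mod_cast (by omega : 2 ≤ g)
    have h2 : a * p ^ 2 + b * p * q + c * q ^ 2 =
        (g : ℝ) ^ 2 * (a * p' ^ 2 + b * p' * q' + c * q' ^ 2) := by
      have e1 : (p : ℝ) = g * p' := by exact_mod_cast hp'
      have e2 : (q : ℝ) = g * q' := by exact_mod_cast hq'
      rw [e1, e2]; ring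
    rw [h2, abs_mul, abs_of_nonneg (by positivity)] at hlt
    have h3 : (4 : ℝ) ≤ (g : ℝ) ^ 2 := by nlinarith
    have := mul_le_mul h3 h1 hμ.le (by positivity)
    linarith
  obtain ⟨s, r', hsr⟩ := hcop
  have hdet : (p : ℝ) * s + q * r' = 1 := by
    have : ((s * p + r' * q : ℤ) : ℝ) = 1 := by rw [hsr]; simp
    push_cast at this; linarith
  set C : ℝ := a * p ^ 2 + b * p * q + c * q ^ 2 with hC
  set B : ℝ := 2 * a * p * (-r') + b * (p * s + q * (-r')) + 2 * c * q * s with hB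
  set A : ℝ := a * r' ^ 2 - b * r' * s + c * s ^ 2 with hA
  have hCpos : 0 < |C| := hμ.trans_le (hmin p q hpq)
  have hC0 : C ≠ 0 := abs_pos.1 hCpos
  set Δ : ℝ := b ^ 2 - 4 * a * c with hΔdef
  have hdisc : B ^ 2 - 4 * C * A = Δ := by
    have : B ^ 2 - 4 * C * A = Δ * ((p : ℝ) * s + q * r') ^ 2 := by
      rw [hB, hC, hA, hΔdef]; ring
    rw [this, hdet]; ring
  set x0 : ℝ := (-B / C + √Δ / |C|) / 2 with hx0
  set y0 : ℝ := (B / C + √Δ / |C|) / 2 with hy0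
  set k : ℤ := ⌊y0⌋ with hk
  have hprod : x0 * y0 = -A / C := by
    have h1 : x0 * y0 = ((√Δ) ^ 2 / |C| ^ 2 - B ^ 2 / C ^ 2) / 4 := by rw [hx0, hy0]; ring
    rw [h1, Real.sq_sqrt hΔ.le, sq_abs, ← hdisc]
    field_simp; ring
  have hsum : x0 - y0 = -B / C := by rw [hx0, hy0]; ring
  refine ⟨x0 + k, y0 - k, ?_, ⟨?_, ?_⟩, ?_⟩
  · rw [hx0, hy0]; ring
  · rw [hk]; linarith [Int.floor_le y0]
  · rw [hk]; linarith [Int.lt_floor_add_one y0]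
  intro m n hmn
  rw [← abs_mul]
  have h1 := hmin (p * (m - k * n) - r' * n) (q * (m - k * n) + s * n) (by
    intro h0
    simp only [Prod.mk.injEq] at h0
    have h2 : n = 0 := by
      have : n * (s * p + r' * q) = 0 := by
        linear_combination p * h0.2 - q * h0.1
      rw [hsr, mul_one] at this; exact this
    have h3 : m = 0 := by
      have : (m - k * n) * (s * p + r' * q) = 0 := by
        linear_combination s * h0.1 + r' * h0.2
      rw [hsr, h2] at this; linarith
    exact hmn (by rw [h2, h3]))
  refine h1.trans (le_of_eq ?_)
  congr 1
  have hB' : B = -C * (x0 - y0) := by rw [hsum]; field_simp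
  have hA' : A = -C * (x0 * y0) := by rw [hprod]; field_simp
  have e : C * ((m - (x0 + k) * n) * (m + (y0 - k) * n)) =
      C * (m - k * n) ^ 2 + B * (m - k * n) * n + A * n ^ 2 := by
    rw [hB', hA']; ring
  rw [e, hC, hB, hA]
  push_cast
  ring

theorem exists_mark_of_mem {t : ℝ} (h : t ∈ MarkovSpectrum) : ∃ a, Mark a t := by
  obtain ⟨a, b, c, hΔ, hfin, ht⟩ := h
  set Δ : ℝ := b ^ 2 - 4 * a * c with hΔdef
  set f : ℤ → ℤ → ℝ := fun p q => a * (p : ℝ) ^ 2 + b * p * q + c * (q : ℝ) ^ 2 with hf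
  have hsq : 0 < √Δ := Real.sqrt_pos.2 hΔ
  have hval : markovVal a b c = ENNReal.ofReal t := by rw [← ht, ENNReal.ofReal_toReal hfin]
  have hle : ∀ p q : ℤ, (p, q) ≠ (0, 0) →
      ENNReal.ofReal √Δ / ENNReal.ofReal |f p q| ≤ ENNReal.ofReal t := by
    intro p q hpq
    rw [← hval]
    exact le_iSup₂_of_le (f := fun (pq : ℤ × ℤ) (_ : pq ≠ (0, 0)) => ENNReal.ofReal √Δ /
      ENNReal.ofReal |f pq.1 pq.2|) (p, q) hpq le_rfl
  have hpos : ∀ p q : ℤ, (p, q) ≠ (0, 0) → 0 < |f p q| := by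
    intro p q hpq
    by_contra h0
    have := hle p q hpq
    rw [ENNReal.ofReal_eq_zero.2 (not_lt.1 h0), ENNReal.div_zero (by simpa using hsq)] at this
    exact absurd this (by simp)
  have ht0 : 0 < t := by
    by_contra h0
    have := hle 1 0 (by simp)
    rw [ENNReal.ofReal_eq_zero.2 (not_lt.1 h0), nonpos_iff_eq_zero, ENNReal.div_eq_zero_iff] at this
    rcases this with h1 | h1
    · exact absurd hsq (not_lt.2 (ENNReal.ofReal_eq_zero.1 h1))
    · exact absurd h1 (by simp)
  set μ : ℝ := √Δ / t with hμ
  have hμ0 : 0 < μ := by positivity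
  have hmin : ∀ p q : ℤ, (p, q) ≠ (0, 0) → μ ≤ |f p q| := by
    intro p q hpq
    have h1 := hle p q hpq
    have h2 := hpos p q hpq
    rw [← ENNReal.ofReal_div_of_pos h2, ENNReal.ofReal_le_ofReal_iff ht0.le,
      div_le_iff₀ h2] at h1
    rw [hμ, div_le_iff₀ ht0]; linarith
  have hex : ∀ n : ℕ, ∃ p q : ℤ, (p, q) ≠ (0, 0) ∧ |f p q| < μ * (1 + 1 / ((n : ℝ) + 1)) := by
    intro n
    by_contra! hc
    have hn : (0 : ℝ) < 1 + 1 / ((n : ℝ) + 1) := by positivity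
    have : markovVal a b c ≤ ENNReal.ofReal (t / (1 + 1 / ((n : ℝ) + 1))) := by
      refine iSup₂_le fun pq hpq => ?_
      change ENNReal.ofReal √Δ / ENNReal.ofReal |f pq.1 pq.2| ≤ _
      rw [← ENNReal.ofReal_div_of_pos (hpos _ _ hpq)]
      apply ENNReal.ofReal_le_ofReal
      have h1 := hc pq.1 pq.2 hpq
      rw [div_le_div_iff₀ (hpos _ _ hpq) hn]
      rw [hμ, div_mul_eq_mul_div, div_le_iff₀ ht0] at h1
      linarith
    rw [hval, ENNReal.ofReal_le_ofReal_iff (by positivity), le_div_iff₀ hn] at this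
    have : 0 < t * (1 / ((n : ℝ) + 1)) := by positivity
    nlinarith
  choose p q hpq hpqlt using hex
  have hlt4 : ∀ n, |f (p n) (q n)| < 4 * μ := fun n => by
    refine (hpqlt n).trans ?_
    have : 1 / ((n : ℝ) + 1) ≤ 1 := by
      rw [div_le_one (by positivity)]; linarith [(Nat.cast_nonneg n : (0 : ℝ) ≤ n)]
    nlinarith
  choose x y hxy hy hform using fun n => exists_normalized_roots hΔ hμ0 hmin (hpq n) (hlt4 n)
  have hlim : Tendsto (fun n => |f (p n) (q n)|) atTop (𝓝 μ) := by
    refine tendsto_of_tendsto_of_tendsto_of_le_of_le tendsto_const_nhds ?_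
      (fun n => hmin _ _ (hpq n)) (fun n => (hpqlt n).le)
    have := ((tendsto_one_div_add_atTop_nhds_zero_nat (𝕜 := ℝ)).const_add 1).const_mul μ
    simpa using this
  obtain ⟨y', hy', φ, hφ, hyφ⟩ := isCompact_Icc.tendsto_subseq hy
  have hlimφ := hlim.comp hφ.tendsto_atTop
  have hsum : Tendsto (fun n => x (φ n) + y (φ n)) atTop (𝓝 t) := by
    have h1 : Tendsto (fun n => √Δ / |f (p (φ n)) (q (φ n))|) atTop (𝓝 (√Δ / μ)) :=
      tendsto_const_nhds.div hlimφ hμ0.ne'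
    have h2 : √Δ / μ = t := by rw [hμ]; field_simp
    rw [h2] at h1
    exact h1.congr fun n => (hxy (φ n)).symm
  have hxφ : Tendsto (fun n => x (φ n)) atTop (𝓝 (t - y')) := by
    have := hsum.sub hyφ
    refine this.congr fun n => ?_
    simp
  refine exists_mark_of_roots (x := t - y') (y := y') ht0 (by ring) hy'.1 hy'.2 fun m n hmn => ?_
  have h1 : Tendsto (fun k => |f (p (φ k)) (q (φ k))| *
      |((m : ℝ) - x (φ k) * n) * (m + y (φ k) * n)|) atTop
      (𝓝 (μ * |((m : ℝ) - (t - y') * n) * (m + y' * n)|)) :=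
    hlimφ.mul (((tendsto_const_nhds.sub (hxφ.mul_const _)).mul
      (tendsto_const_nhds.add (hyφ.mul_const _))).abs)
  have h2 := ge_of_tendsto' h1 fun k => hform (φ k) m n hmn
  exact le_of_mul_le_mul_left (by simpa using h2) hμ0

/-! ### Continuants and the Lagrange value -/

/-- Consecutive denominators of convergents. -/
def denPair (a : ℕ → ℕ) : ℕ → ℕ × ℕ
  | 0 => (1, 0)
  | n + 1 => (a n * (denPair a n).1 + (denPair a n).2, (denPair a n).1)

/-- Consecutive numerators of convergents. -/
def numPair (a : ℕ → ℕ) : ℕ → ℕ × ℕ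
  | 0 => (0, 1)
  | n + 1 => (a n * (numPair a n).1 + (numPair a n).2, (numPair a n).1)

/-- The continued fraction `[0; a 0, …, a (n-1) + x]`. -/
noncomputable def approxTail : ℕ → (ℕ → ℕ) → ℝ → ℝ
  | 0, _, x => x
  | n + 1, a, x => 1 / (a 0 + approxTail n (fun k => a (k + 1)) x)

theorem approxTail_succ (n : ℕ) (a : ℕ → ℕ) (x : ℝ) :
    approxTail (n + 1) a x = approxTail n a (1 / (a n + x)) := by
  induction n generalizing a with
  | zero => rfl
  | succ n ih =>
    rw [approxTail, ih]
    rfl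

theorem one_le_denPair (a : ℕ → ℕ) (ha : ∀ k, 1 ≤ a k) (n : ℕ) : 1 ≤ (denPair a n).1 := by
  induction n with
  | zero => rfl
  | succ n ih =>
    have := Nat.mul_le_mul (ha n) ih
    simp only [denPair]; omega

theorem le_denPair (a : ℕ → ℕ) (ha : ∀ k, 1 ≤ a k) (n : ℕ) :
    n ≤ (denPair a n).1 ∧ n + 1 ≤ (denPair a (n + 1)).1 := by
  induction n with
  | zero => exact ⟨Nat.zero_le _, one_le_denPair a ha _⟩
  | succ n ih =>
    refine ⟨ih.2, ?_⟩
    have h1 : (denPair a (n + 1 + 1)).1 = a (n + 1) * (denPair a (n + 1)).1 + (denPair a n).1 := rfl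
    have := Nat.mul_le_mul (ha (n + 1)) ih.2
    have := one_le_denPair a ha n
    omega

theorem det_pair (a : ℕ → ℕ) (n : ℕ) :
    ((numPair a n).1 * (denPair a n).2 - (numPair a n).2 * (denPair a n).1 : ℤ) =
      (-1) ^ (n + 1) := by
  induction n with
  | zero => simp [numPair, denPair]
  | succ n ih =>
    rw [pow_succ, ← ih]
    simp only [numPair, denPair]
    push_cast; ring

theorem approxTail_eq (a : ℕ → ℕ) (ha : ∀ k, 1 ≤ a k) (n : ℕ) {x : ℝ} (hx : 0 ≤ x) :
    approxTail n a x =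
      ((numPair a n).1 + (numPair a n).2 * x) / ((denPair a n).1 + (denPair a n).2 * x) := by
  induction n generalizing x with
  | zero => simp [approxTail, numPair, denPair]
  | succ n ih =>
    have h1 : (1 : ℝ) ≤ a n := by exact_mod_cast ha n
    have h2 : (1 : ℝ) ≤ (denPair a n).1 := by exact_mod_cast one_le_denPair a ha n
    rw [approxTail_succ, ih (by positivity)]
    simp only [numPair, denPair]
    push_cast
    have h3 : (a n : ℝ) + x ≠ 0 := by positivity
    have h4 : ((denPair a n).1 : ℝ) + (denPair a n).2 * (1 / (a n + x)) ≠ 0 := by positivity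
    have h5 : (a n * (denPair a n).1 + (denPair a n).2 : ℝ) + (denPair a n).1 * x ≠ 0 := by
      positivity
    rw [div_eq_div_iff h4 h5]
    field_simp
    ring

theorem cfv_eq_approxTail (n : ℕ) (a : ℕ → ℕ) (ha : ∀ k, 1 ≤ a k) :
    cfv a = approxTail n a (cfv fun k => a (k + n)) := by
  induction n generalizing a with
  | zero => rfl
  | succ n ih =>
    rw [cfv_rec a ha, ih (fun k => a (k + 1)) fun _ => ha _]
    rw [approxTail]
    congr 4

theorem convergent_cfv (n : ℕ) (a : ℕ → ℕ) (ha : ∀ k, 1 ≤ a k) :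
    (((cfv a).convergent n : ℚ) : ℝ) = approxTail n a 0 := by
  have hconv : ∀ (n : ℕ) (d : ℕ) (x : ℝ), ((d : ℝ) + x).convergent n = d + x.convergent n := by
    intro n d x
    cases n with
    | zero => simp
    | succ n => simp [Real.convergent_succ, add_assoc]
  induction n generalizing a with
  | zero =>
    have : ⌊cfv a⌋ = 0 := Int.floor_eq_zero_iff.2 ⟨(cfv_pos a ha).le, cfv_lt_one a ha⟩
    simp [approxTail, this]
  | succ n ih =>
    have h0 : ⌊cfv a⌋ = 0 := Int.floor_eq_zero_iff.2 ⟨(cfv_pos a ha).le, cfv_lt_one a ha⟩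
    have h1 : Int.fract (cfv a) = cfv a := Int.fract_eq_self.2 ⟨(cfv_pos a ha).le, cfv_lt_one a ha⟩
    rw [Real.convergent_succ, h0, h1]
    have h2 : (cfv a)⁻¹ = a 0 + cfv fun k => a (k + 1) := by
      rw [cfv_rec a ha, one_div, inv_inv]
    rw [h2, hconv]
    push_cast
    rw [ih (fun k => a (k + 1)) fun _ => ha _]
    simp [approxTail]

/-- `q² |α - p/q|` for a convergent `p/q`. -/
theorem denPair_sq_mul_abs_sub (a : ℕ → ℕ) (ha : ∀ k, 1 ≤ a k) (n : ℕ) :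
    ((denPair a n).1 : ℝ) ^ 2 * |cfv a - (numPair a n).1 / (denPair a n).1| =
      1 / (1 / cfv (fun k => a (k + n)) + (denPair a n).2 / (denPair a n).1) := by
  have hx := cfv_pos (fun k => a (k + n)) fun _ => ha _
  rw [cfv_eq_approxTail n a ha, approxTail_eq a ha n hx.le]
  set x := cfv (fun k => a (k + n))
  have hq : (1 : ℝ) ≤ (denPair a n).1 := by exact_mod_cast one_le_denPair a ha n
  have hd := det_pair a n
  have hd' : ((numPair a n).1 * (denPair a n).2 - (numPair a n).2 * (denPair a n).1 : ℝ) =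
      (-1) ^ (n + 1) := by exact_mod_cast hd
  set p : ℝ := ((numPair a n).1 : ℝ)
  set p' : ℝ := ((numPair a n).2 : ℝ)
  set q : ℝ := ((denPair a n).1 : ℝ)
  set q' : ℝ := ((denPair a n).2 : ℝ) with hq'
  have hq'0 : 0 ≤ q' := by positivity
  have h1 : 0 < q + q' * x := by positivity
  have e : (p + p' * x) / (q + q' * x) - p / q = -((-1) ^ (n + 1) * x) / ((q + q' * x) * q) := by
    rw [← hd']; field_simp; ring
  rw [e, abs_div, abs_neg, abs_mul, abs_pow, abs_neg, abs_one, one_pow, one_mul, abs_of_pos hx,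
    abs_of_pos (by positivity)]
  field_simp

theorem abs_den_ratio_sub_bwd_le {b : ℤ → ℕ} (hb : BiPos b) (n : ℕ) :
    |((denPair (fun k => b k) n).2 / (denPair (fun k => b k) n).1 : ℝ) - bwd b n| ≤
      2 * (1 / 2) ^ n := by
  have hrec : ∀ n, ((denPair (fun k => b k) (n + 1)).2 / (denPair (fun k => b k) (n + 1)).1 : ℝ) =
      1 / (b n + (denPair (fun k => b k) n).2 / (denPair (fun k => b k) n).1) := by
    intro n
    have h2 : (1 : ℝ) ≤ (denPair (fun k => b k) n).1 := by
      exact_mod_cast one_le_denPair (fun k => b k) (fun _ => hb _) n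
    have h1 : (1 : ℝ) ≤ b n := by exact_mod_cast hb n
    simp only [denPair]
    push_cast
    field_simp
  have hrec2 : ∀ n : ℕ, bwd b ((n + 1 : ℕ) : ℤ) = 1 / (b n + bwd b n) := by
    intro n
    rw [bwd_rec hb]; push_cast; rw [add_sub_cancel_right]
  have hmem : ∀ n, (0 : ℝ) ≤ (denPair (fun k => b k) n).2 / (denPair (fun k => b k) n).1 :=
    fun n => by positivity
  have hle : ∀ n, ((denPair (fun k => b k) n).2 / (denPair (fun k => b k) n).1 : ℝ) ≤ 1 := by
    intro n
    cases n with
    | zero => simp [denPair]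
    | succ n =>
      rw [hrec]
      exact (one_div_add_mem (by exact_mod_cast hb n) (x := _ / _) ⟨hmem n, by
        induction n with
        | zero => simp [denPair]
        | succ n ih =>
          rw [hrec]
          exact (one_div_add_mem (by exact_mod_cast hb n) ⟨hmem n, ih⟩).2⟩).2
  induction n using Nat.twoStepInduction with
  | zero =>
    rw [abs_le]; constructor <;> norm_num <;>
      linarith [hmem 0, hle 0, bwd_pos hb 0, bwd_lt_one hb 0]
  | one =>
    rw [abs_le]; constructor <;> norm_num <;>
      linarith [hmem 1, hle 1, bwd_pos hb 1, bwd_lt_one hb 1]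
  | more n ih _ =>
    rw [hrec, hrec, hrec2, hrec2]
    refine (abs_two_step_le (by exact_mod_cast hb _) (by exact_mod_cast hb _) (hmem n)
      (bwd_pos hb _).le).trans ?_
    rw [pow_add]; norm_num at ih ⊢; linarith

theorem abs_finite_lam_sub_le {b : ℤ → ℕ} (hb : BiPos b) (n : ℕ) :
    |1 / cfv (fun k : ℕ => b ((k + n : ℕ) : ℤ)) +
      ((denPair (fun k => b k) n).2 / (denPair (fun k => b k) n).1 : ℝ) - lam b n| ≤
      2 * (1 / 2) ^ n := by
  have h1 : cfv (fun k : ℕ => b ((k + n : ℕ) : ℤ)) = fwd b (n - 1) := by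
    unfold fwd; congr 1; ext k; congr 1; push_cast; ring
  rw [h1, fwd_rec hb, one_div_one_div, sub_add_cancel]
  have := abs_den_ratio_sub_bwd_le hb n
  unfold lam
  convert this using 2
  ring

theorem distNearestInt_le (x : ℝ) (m : ℤ) : distNearestInt x ≤ |x - m| := round_le x m

theorem le_lagrangeVal {b : ℤ → ℕ} (hb : BiPos b) {τ : ℝ} (h : ∃ᶠ n : ℕ in atTop, τ ≤ lam b n) :
    ENNReal.ofReal τ ≤ lagrangeVal (cfv fun k => b k) := by
  set α := cfv (fun k : ℕ => b k) with hα
  have hirr : Irrational α := irrational_cfv _ fun _ => hb _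
  refine le_of_forall_lt fun c hc => ?_
  obtain ⟨c', hc', hc''⟩ := ENNReal.lt_iff_exists_real_btwn.1 hc
  obtain ⟨hc0, hcτ⟩ := hc''
  have hc3 : c' < τ := (ENNReal.ofReal_lt_ofReal_iff_of_nonneg hc').1 hcτ
  refine hc0.trans_le ?_
  refine le_limsup_of_frequently_le' ?_
  have h1 : ∀ᶠ n : ℕ in atTop, 2 * (1 / 2 : ℝ) ^ n < τ - c' :=
    (tendsto_order.1 tendsto_two_mul_half_pow).2 _ (by linarith)
  rw [frequently_atTop] at h ⊢
  intro N
  obtain ⟨N1, hN1⟩ := eventually_atTop.1 h1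
  obtain ⟨n, hn, hlam⟩ := h (max N N1)
  have ha : ∀ k : ℕ, 1 ≤ b k := fun _ => hb _
  refine ⟨(denPair (fun k => b k) n).1, ((le_max_left _ _).trans hn).trans (le_denPair _ ha n).1,
    ENNReal.ofReal_le_ofReal ?_⟩
  have e := denPair_sq_mul_abs_sub (fun k => b k) ha n
  have e2 := abs_le.1 (abs_finite_lam_sub_le hb n)
  have e3 := hN1 n ((le_max_right _ _).trans hn)
  have hq : (1 : ℝ) ≤ (denPair (fun k => b k) n).1 := by exact_mod_cast one_le_denPair _ ha n
  set q : ℝ := ((denPair (fun k : ℕ => b k) n).1 : ℝ) with hqdef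
  set p : ℕ := (numPair (fun k : ℕ => b k) n).1
  have hd : distNearestInt (q * α) ≤ q * |α - p / q| := by
    refine (distNearestInt_le _ p).trans (le_of_eq ?_)
    rw [← abs_of_pos (show 0 < q by linarith), ← abs_mul, abs_of_pos (show 0 < q by linarith)]
    congr 1; push_cast; field_simp
  have hd0 : 0 < distNearestInt (q * α) := by
    have hne := (hirr.natCast_mul (m := (denPair (fun k : ℕ => b k) n).1)
      (by intro h0; rw [hqdef, h0] at hq; norm_num at hq)).ne_int (round (q * α))
    exact abs_pos.2 (sub_ne_zero.2 hne)
  set ℓ : ℝ := 1 / cfv (fun k : ℕ => b ((k + n : ℕ) : ℤ)) +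
      ((denPair (fun k => b k) n).2 / q : ℝ) with hℓ
  have hqd : q * distNearestInt (q * α) ≤ 1 / ℓ := by
    rw [hℓ, ← e, pow_two, mul_assoc]
    exact mul_le_mul_of_nonneg_left hd (by linarith)
  have hℓc : c' ≤ ℓ := by linarith
  rcases hc'.eq_or_lt with h0 | h0
  · rw [← h0]; positivity
  rw [le_div_iff₀ (by positivity)]
  have hℓ0 : 0 < ℓ := h0.trans_le hℓc
  calc c' * (q * distNearestInt (q * α)) ≤ ℓ * (1 / ℓ) := by gcongr
    _ = 1 := by field_simp

theorem lagrangeVal_le {b : ℤ → ℕ} (hb : BiPos b) {τ : ℝ} (hτ : 2 ≤ τ)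
    (h : ∀ᶠ n : ℕ in atTop, lam b n ≤ τ) :
    lagrangeVal (cfv fun k => b k) ≤ ENNReal.ofReal τ := by
  set α := cfv (fun k : ℕ => b k) with hα
  have ha : ∀ k : ℕ, 1 ≤ b k := fun _ => hb _
  have hirr : Irrational α := irrational_cfv _ fun _ => hb _
  refine le_of_forall_gt fun c hc => ?_
  obtain ⟨c', hc', hc0, hcτ⟩ := ENNReal.lt_iff_exists_real_btwn.1 hc
  have hc3 : τ < c' := (ENNReal.ofReal_lt_ofReal_iff_of_nonneg (by linarith)).1 hc0
  refine lt_of_le_of_lt ?_ hcτ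
  refine limsup_le_of_le (by isBoundedDefault) ?_
  have h1 : ∀ᶠ n : ℕ in atTop, 2 * (1 / 2 : ℝ) ^ n < c' - τ :=
    (tendsto_order.1 tendsto_two_mul_half_pow).2 _ (by linarith)
  obtain ⟨N, hN⟩ := eventually_atTop.1 (h.and h1)
  have h2 : ∀ n ∈ Finset.range N, ∀ᶠ q : ℕ in atTop,
      1 / (2 * (q : ℝ) ^ 2) < |α - (numPair (fun k => b k) n).1 / (denPair (fun k => b k) n).1| := by
    intro n _
    have hpos : 0 < |α - (numPair (fun k => b k) n).1 / (denPair (fun k => b k) n).1| := by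
      refine abs_pos.2 (sub_ne_zero.2 ?_)
      have := hirr.ne_rat (((numPair (fun k : ℕ => b k) n).1 : ℚ) / (denPair (fun k : ℕ => b k) n).1)
      push_cast at this
      exact this
    have : Tendsto (fun q : ℕ => 1 / (2 * (q : ℝ) ^ 2)) atTop (𝓝 0) := by
      refine tendsto_const_nhds.div_atTop ?_
      exact ((tendsto_pow_atTop (by norm_num)).comp tendsto_natCast_atTop_atTop).const_mul_atTop
        (by norm_num)
    exact (tendsto_order.1 this).2 _ hpos
  filter_upwards [(Finset.eventually_all (Finset.range N)).2 h2, eventually_ge_atTop 1] with q hq hq1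
  apply ENNReal.ofReal_le_ofReal
  by_contra! hlt
  have hq1' : (1 : ℝ) ≤ q := by exact_mod_cast hq1
  set m : ℤ := round (q * α) with hm
  set D : ℝ := distNearestInt (q * α) with hD
  have hD' : D = q * |α - m / q| := by
    rw [hD, distNearestInt, ← abs_of_pos (show (0 : ℝ) < q by linarith), ← abs_mul,
      abs_of_pos (show (0 : ℝ) < q by linarith)]
    congr 1; field_simp; rw [hm]
  have hD0 : 0 < D := by
    have hne := (hirr.natCast_mul (m := q) (by omega)).ne_int (round (q * α))
    exact abs_pos.2 (sub_ne_zero.2 hne)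
  have hlt2 : |α - m / q| < 1 / (2 * (q : ℝ) ^ 2) := by
    have h3 : 2 < 1 / (q * D) := by linarith
    rw [lt_div_iff₀ (by positivity)] at h3
    rw [lt_div_iff₀ (by positivity)]
    rw [hD'] at h3
    nlinarith
  set r : ℚ := m / (q : ℕ) with hr
  have hrR : (r : ℝ) = m / q := by rw [hr]; push_cast; rfl
  have hden : (r.den : ℝ) ≤ q := by
    have h4 : (r.den : ℤ) ∣ (q : ℤ) := by
      rw [hr]; exact_mod_cast Rat.den_dvd m q
    have := Int.le_of_dvd (by exact_mod_cast hq1) h4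
    exact_mod_cast this
  have hden0 : (0 : ℝ) < r.den := by exact_mod_cast r.den_pos
  obtain ⟨n, hn⟩ := Real.exists_rat_eq_convergent (ξ := α) (q := r) (by
    rw [hrR]
    refine hlt2.trans_le ?_
    gcongr)
  have hn' : (m : ℝ) / q = (numPair (fun k => b k) n).1 / (denPair (fun k => b k) n).1 := by
    rw [← hrR, hn, convergent_cfv n _ ha, approxTail_eq _ ha n le_rfl]; simp
  have hnN : N ≤ n := by
    by_contra! hc
    have := hq n (Finset.mem_range.2 hc)
    rw [← hn'] at this
    linarith
  have hQ : (1 : ℝ) ≤ (denPair (fun k => b k) n).1 := by exact_mod_cast one_le_denPair _ ha n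
  have hdvd : (denPair (fun k : ℕ => b k) n).1 ≤ q := by
    rw [div_eq_div_iff (by positivity) (by positivity)] at hn'
    have h5 : (m : ℤ) * (denPair (fun k : ℕ => b k) n).1 = (numPair (fun k : ℕ => b k) n).1 * q := by
      exact_mod_cast hn'
    have hdet := det_pair (fun k : ℕ => b k) n
    have hcop : IsCoprime (((denPair (fun k : ℕ => b k) n).1 : ℤ))
        ((numPair (fun k : ℕ => b k) n).1 : ℤ) := by
      refine ⟨-(-1) ^ (n + 1) * (numPair (fun k : ℕ => b k) n).2,
        (-1) ^ (n + 1) * (denPair (fun k : ℕ => b k) n).2, ?_⟩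
      have : ((-1 : ℤ) ^ (n + 1)) * (-1) ^ (n + 1) = 1 := by
        rw [← mul_pow]; simp
      linear_combination (-1) ^ (n + 1) * hdet + this
    have h6 : ((denPair (fun k : ℕ => b k) n).1 : ℤ) ∣ q :=
      hcop.dvd_of_dvd_mul_left ⟨m, by rw [← h5]; ring⟩
    exact Nat.le_of_dvd hq1 (by exact_mod_cast h6)
  have hdvd' : ((denPair (fun k : ℕ => b k) n).1 : ℝ) ≤ q := by exact_mod_cast hdvd
  have e := denPair_sq_mul_abs_sub (fun k => b k) ha n
  have e2 := abs_le.1 (abs_finite_lam_sub_le hb n)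
  have e3 := hN n hnN
  set ℓ : ℝ := 1 / cfv (fun k : ℕ => b ((k + n : ℕ) : ℤ)) +
      ((denPair (fun k => b k) n).2 / (denPair (fun k => b k) n).1 : ℝ) with hℓ
  have hℓ0 : 0 < ℓ := by
    have := cfv_pos (fun k : ℕ => b ((k + n : ℕ) : ℤ)) fun _ => hb _
    positivity
  have h7 : 1 / ℓ ≤ q * D := by
    rw [hℓ, ← e, hD', hn', ← mul_assoc, ← pow_two]
    gcongr
  rw [div_le_iff₀ hℓ0] at h7
  rw [lt_div_iff₀ (by positivity)] at hlt
  have : 0 < q * D := by positivity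
  nlinarith

theorem lagrangeVal_fract (α : ℝ) : lagrangeVal (Int.fract α) = lagrangeVal α := by
  unfold lagrangeVal
  congr 1
  ext q
  have : distNearestInt (q * Int.fract α) = distNearestInt (q * α) := by
    unfold distNearestInt
    have : (q : ℝ) * Int.fract α = q * α - ((q * ⌊α⌋ : ℤ) : ℝ) := by
      rw [Int.fract]; push_cast; ring
    rw [this, round_sub_intCast]
    push_cast
    congr 1; ring
  rw [this]

theorem exists_seq_of_mem_lagrange {t : ℝ} (h : t ∈ LagrangeSpectrum) :
    ∃ b, BiPos b ∧ lagrangeVal (cfv fun k : ℕ => b k) = ENNReal.ofReal t := by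
  obtain ⟨α, hα, hfin, ht⟩ := h
  have hf : Irrational (Int.fract α) := hα.sub_intCast ⌊α⌋
  have h0 : 0 < Int.fract α := lt_of_le_of_ne (Int.fract_nonneg _) hf.ne_zero.symm
  obtain ⟨a, ha, hax⟩ := exists_digits hf h0 (Int.fract_lt_one _)
  refine ⟨fun i => a i.toNat, fun _ => ha _, ?_⟩
  simp only [Int.toNat_natCast]
  rw [hax, lagrangeVal_fract, ← ht, ENNReal.ofReal_toReal hfin]

theorem eventually_lam_lt_of_lagrangeVal {b : ℤ → ℕ} (hb : BiPos b) {t τ : ℝ}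
    (h : lagrangeVal (cfv fun k => b k) = ENNReal.ofReal t) (hτ : t < τ) (hτ0 : 0 < τ) :
    ∀ᶠ n : ℕ in atTop, lam b n < τ := by
  by_contra hc
  have h1 : ∃ᶠ n : ℕ in atTop, τ ≤ lam b n := by
    refine fun h2 => hc (h2.mono fun n hn => not_le.1 hn)
  have := le_lagrangeVal hb h1
  rw [h] at this
  exact absurd this (not_le.2 ((ENNReal.ofReal_lt_ofReal_iff hτ0).2 hτ))

theorem frequently_lt_lam_of_lagrangeVal {b : ℤ → ℕ} (hb : BiPos b) {t τ : ℝ}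
    (h : lagrangeVal (cfv fun k => b k) = ENNReal.ofReal t) (hτ : τ < t) (hτ2 : 2 ≤ τ) :
    ∃ᶠ n : ℕ in atTop, τ < lam b n := by
  intro hc
  have := lagrangeVal_le hb hτ2 (hc.mono fun n hn => not_lt.1 hn)
  rw [h] at this
  exact absurd this (not_le.2 ((ENNReal.ofReal_lt_ofReal_iff (by linarith)).2 hτ))

theorem abs_lam_sub_le {a b : ℤ → ℕ} (ha : BiPos a) (hb : BiPos b) {i : ℤ} (n : ℕ)
    (h : ∀ j, i - n ≤ j → j ≤ i + n → a j = b j) : |lam a i - lam b i| ≤ 4 * (1 / 2) ^ n := by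
  have h1 := abs_le.1 (abs_fwd_sub_le ha hb (i := i) n fun j _ _ => h j (by omega) (by omega))
  have h2 := abs_le.1 (abs_bwd_sub_le ha hb (i := i) n fun j _ _ => h j (by omega) (by omega))
  unfold lam
  rw [h i (by omega) (by omega), abs_le]
  constructor <;> linarith

/-- Values approximated by heights of sequences that are eventually `1` on both sides lie in the
Lagrange spectrum. -/
theorem mem_lagrange_of_approx {t : ℝ} (ht : 2 < t)
    (h : ∀ ε > 0, ∃ c : ℤ → ℕ, BiPos c ∧ (∃ r : ℕ, ∀ i : ℤ, (r : ℤ) ≤ |i| → c i = 1) ∧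
      (∀ i, lam c i ≤ t + ε) ∧ t - ε ≤ lam c 0) : t ∈ LagrangeSpectrum := by
  choose c hc hr hlam hlam0 using fun k : ℕ => h (1 / ((k : ℝ) + 1)) (by positivity)
  choose r hr using hr
  let n : ℕ → ℕ := fun k => r k + k + 1
  let S : ℕ → ℕ := fun k => ∑ j ∈ Finset.range k, (2 * n j + 1)
  have hS : ∀ k, S (k + 1) = S k + 2 * n k + 1 := fun k => by
    simp only [S, Finset.sum_range_succ]; ring
  have hSmono : StrictMono S := strictMono_nat_of_lt_succ fun k => by rw [hS]; omega
  have hex : ∀ i : ℕ, ∃ k, i < S (k + 1) := fun i => ⟨i, by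
    have := hSmono.id_le (i + 1)
    simp only [id] at this; omega⟩
  let z : ℕ → ℤ := fun k => (S k : ℤ) + (n k : ℤ)
  let b : ℤ → ℕ := fun i => if i < 0 then 1 else
    c (Nat.find (hex i.toNat)) (i - z (Nat.find (hex i.toNat)))
  have hb : BiPos b := fun i => by
    dsimp only [b]; split_ifs
    exacts [le_rfl, hc _ _]
  have hblock : ∀ (k : ℕ) (j : ℤ), -(n k : ℤ) ≤ j → j ≤ n k → b (z k + j) = c k j := by
    intro k j h1 h2
    have h0 : ¬ z k + j < 0 := by simp only [z]; omega
    have hfind : Nat.find (hex (z k + j).toNat) = k := by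
      rw [Nat.find_eq_iff]
      refine ⟨?_, fun m hm => ?_⟩
      · rw [hS]; simp only [z] at h0 ⊢; omega
      · have : S (m + 1) ≤ S k := hSmono.monotone hm
        simp only [z] at h0 ⊢; omega
    dsimp only [b]
    rw [if_neg h0, hfind]
    congr 1; ring
  have hnk : ∀ k, n k = r k + k + 1 := fun k => rfl
  have hzk : ∀ k, z k = S k + n k := fun k => rfl
  have hwin : ∀ (k : ℕ) (j : ℤ), -(n k + k : ℤ) ≤ j → j ≤ n k + k → b (z k + j) = c k j := by
    intro k j h1 h2
    rcases le_or_gt j (n k) with h3 | h3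
    · rcases le_or_gt (-(n k : ℤ)) j with h4 | h4
      · exact hblock k j h4 h3
      · have hcj : c k j = 1 := hr k j (by rw [abs_of_neg (by omega)]; have := hnk k; omega)
        rw [hcj]
        cases k with
        | zero =>
          have : z 0 + j < 0 := by rw [hzk]; have : S 0 = 0 := rfl; omega
          dsimp only [b]; rw [if_pos this]
        | succ k =>
          have e : z (k + 1) + j = z k + (n k + 1 + (n (k + 1) + j)) := by
            rw [hzk, hzk, hS]; push_cast; ring
          have := hnk k
          push_cast at h1 h2 h4
          rw [e, hblock k _ (by omega) (by omega)]
          exact hr k _ (by rw [abs_of_nonneg (by omega)]; omega)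
    · have hcj : c k j = 1 := hr k j (by rw [abs_of_pos (by omega)]; have := hnk k; omega)
      rw [hcj]
      have e : z k + j = z (k + 1) + (j - n k - 1 - n (k + 1)) := by
        rw [hzk, hzk, hS]; push_cast; ring
      have := hnk (k + 1)
      rw [e, hblock (k + 1) _ (by omega) (by omega)]
      exact hr (k + 1) _ (by rw [abs_of_nonpos (by omega)]; omega)
  have hclose : ∀ (k : ℕ) (j : ℤ), -(n k : ℤ) ≤ j → j ≤ n k →
      |lam b (z k + j) - lam (c k) j| ≤ 4 * (1 / 2) ^ k := by
    intro k j h1 h2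
    have e : lam b (z k + j) = lam (shift b (z k)) j := by rw [lam_shift]; congr 1; ring
    rw [e]
    refine abs_lam_sub_le (fun _ => hb _) (hc k) k fun l h3 h4 => ?_
    rw [add_comm, hwin k l (by omega) (by omega)]
  have herr : ∀ δ > 0, ∀ᶠ k : ℕ in atTop, 1 / ((k : ℝ) + 1) + 4 * (1 / 2) ^ k < δ := by
    intro δ hδ
    have := (tendsto_one_div_add_atTop_nhds_zero_nat (𝕜 := ℝ)).add
      (tendsto_two_mul_half_pow.const_mul 2)
    simp only [mul_zero, add_zero, ← mul_assoc] at this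
    have h4 : (2 : ℝ) * 2 = 4 := by norm_num
    rw [h4] at this
    exact (tendsto_order.1 this).2 _ hδ
  have hval : lagrangeVal (cfv fun k => b k) = ENNReal.ofReal t := by
    apply le_antisymm
    · refine le_of_forall_gt fun x hx => ?_
      obtain ⟨τ, hτ, hτ0, hτx⟩ := ENNReal.lt_iff_exists_real_btwn.1 hx
      have hτt : t < τ := (ENNReal.ofReal_lt_ofReal_iff_of_nonneg (by linarith)).1 hτ0
      refine lt_of_le_of_lt (lagrangeVal_le hb (by linarith) ?_) hτx
      obtain ⟨K, hK⟩ := eventually_atTop.1 (herr (τ - t) (by linarith))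
      filter_upwards [eventually_ge_atTop (S K)] with i hi
      set k := Nat.find (hex i) with hk
      have h1 : i < S (k + 1) := Nat.find_spec (hex i)
      have hkK : K ≤ k := by
        by_contra! hlt
        have : S (k + 1) ≤ S K := hSmono.monotone hlt
        omega
      have h2 : S k ≤ i := by
        rcases Nat.eq_zero_or_pos k with h0 | h0
        · rw [h0]; exact Nat.zero_le _
        · have := Nat.find_min (hex i) (m := k - 1) (by omega)
          rw [Nat.sub_add_cancel h0] at this
          omega
      have hSk := hS k
      have hz := hzk k
      have h3 := abs_le.1 (hclose k (i - z k) (by omega) (by omega))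
      rw [add_sub_cancel] at h3
      have h4 := hlam k (i - z k)
      have h5 := hK k hkK
      linarith
    · refine le_of_forall_lt fun x hx => ?_
      obtain ⟨τ, hτ, hτ0, hτx⟩ := ENNReal.lt_iff_exists_real_btwn.1 hx
      have hτt : τ < t := (ENNReal.ofReal_lt_ofReal_iff_of_nonneg hτ).1 hτx
      refine hτ0.trans_le (le_lagrangeVal hb ?_)
      obtain ⟨K, hK⟩ := eventually_atTop.1 (herr (t - τ) (by linarith))
      rw [frequently_atTop]
      intro N
      set k := max N K
      refine ⟨S k + n k, ?_, ?_⟩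
      · have := hSmono.id_le k
        simp only [id] at this
        have : N ≤ k := le_max_left _ _
        omega
      · have h3 := abs_le.1 (hclose k 0 (by omega) (by omega))
        have h4 := hlam0 k
        have h5 := hK k (le_max_right _ _)
        rw [add_zero] at h3
        have e : ((S k + n k : ℕ) : ℤ) = z k := by rw [hzk]; push_cast; rfl
        rw [e]
        linarith
  refine ⟨cfv fun k : ℕ => b k, irrational_cfv _ fun _ => hb _, ?_, ?_⟩
  · rw [hval]; exact ENNReal.ofReal_ne_top
  · rw [hval]; exact ENNReal.toReal_ofReal (by linarith)

/-- `b` agrees with `a` up to position `N` and is eventually `1`. -/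
def RightExt (a : ℤ → ℕ) (N : ℕ) (b : ℤ → ℕ) : Prop :=
  BiPos b ∧ (∀ i : ℤ, i ≤ N → b i = a i) ∧ ∃ r : ℕ, ∀ i : ℤ, (r : ℤ) ≤ i → b i = 1

/-- No eventually-one continuation of `a` beyond `N` keeps all heights below `s`. -/
def NoExt (a : ℤ → ℕ) (s : ℝ) (N : ℕ) : Prop := ∀ b, RightExt a N b → ∃ i, s < lam b i

theorem exists_noExt_of_not_mem_lagrange {a : ℤ → ℕ} {t : ℝ} (h : Mark a t)
    (ht : t ∉ LagrangeSpectrum) :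
    ∃ ε > 0, ∃ N₀ : ℕ, ∀ N ≥ N₀, NoExt a (t + ε) N ∨ NoExt (rev a) (t + ε) N := by
  by_contra! hc
  refine ht (mem_lagrange_of_approx h.two_lt fun ε hε => ?_)
  obtain ⟨N₀, hN₀⟩ := eventually_atTop.1 <| (tendsto_order.1
    (tendsto_two_mul_half_pow.const_mul 2)).2 (ε / 2) (by rw [mul_zero]; linarith)
  obtain ⟨N, hN, h1, h2⟩ := hc (ε / 2) (by linarith) N₀
  have herr : 4 * (1 / 2 : ℝ) ^ N < ε / 2 := by have := hN₀ N hN; linarith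
  unfold NoExt at h1 h2
  push Not at h1 h2
  obtain ⟨b1, ⟨hb1, hb1a, r1, hr1⟩, hl1⟩ := h1
  obtain ⟨b2, ⟨hb2, hb2a, r2, hr2⟩, hl2⟩ := h2
  let c : ℤ → ℕ := fun i => if 0 ≤ i then b1 i else rev b2 i
  have hcb1 : ∀ i : ℤ, -(N : ℤ) ≤ i → c i = b1 i := fun i hi => by
    dsimp only [c]; split_ifs with h0
    · rfl
    · rw [hb1a i (by omega), rev, hb2a _ (by omega), rev, neg_neg]
  have hcb2 : ∀ i : ℤ, i ≤ N → c i = rev b2 i := fun i hi => by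
    dsimp only [c]; split_ifs with h0
    · rw [hb1a i (by omega), rev, hb2a _ (by omega), rev, neg_neg]
    · rfl
  have hcpos : BiPos c := fun i => by
    dsimp only [c]; split_ifs
    exacts [hb1 _, hb2 _]
  refine ⟨c, hcpos, ⟨r1 + r2 + N, fun i hi => ?_⟩, fun i => ?_, ?_⟩
  · rcases le_total 0 i with h0 | h0
    · rw [abs_of_nonneg h0] at hi
      rw [hcb1 i (by omega)]; exact hr1 i (by push_cast at hi; omega)
    · rw [abs_of_nonpos h0] at hi
      rw [hcb2 i (by omega)]; exact hr2 _ (by push_cast at hi; omega)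
  · rcases le_total 0 i with h0 | h0
    · have := abs_le.1 (abs_lam_sub_le hcpos hb1 (i := i) N fun j _ _ => hcb1 j (by omega))
      linarith [hl1 i]
    · have := abs_le.1 (abs_lam_sub_le hcpos hb2.rev (i := i) N fun j _ _ => hcb2 j (by omega))
      rw [lam_rev] at this
      linarith [hl2 (-i)]
  · have := abs_le.1 (abs_lam_sub_le hcpos h.1 (i := 0) N fun j _ _ => by
      rw [hcb1 j (by omega), hb1a j (by omega)])
    rw [h.2.2] at this
    linarith

/-- `E` has upper box dimension at most `s`, in a quantitative form. -/
def CovBound (E : Set ℝ) (s : ℝ) : Prop :=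
  ∃ C : ℝ, 0 ≤ C ∧ ∀ r : ℝ, 0 < r → r ≤ 1 →
    ∃ P : List ℝ, (P.length : ℝ) ≤ C * r ^ (-s) ∧ ∀ x ∈ E, ∃ p ∈ P, |x - p| ≤ r

theorem CovBound.mono {E F : Set ℝ} {s : ℝ} (h : CovBound F s) (hEF : E ⊆ F) : CovBound E s := by
  obtain ⟨C, hC, h⟩ := h
  refine ⟨C, hC, fun r hr hr1 => ?_⟩
  obtain ⟨P, hP, hc⟩ := h r hr hr1
  exact ⟨P, hP, fun x hx => hc x (hEF hx)⟩

theorem CovBound.add {E F : Set ℝ} {s u k : ℝ} (hE : CovBound E s) (hF : CovBound F u)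
    (hs : 0 ≤ s) (hu : 0 ≤ u) : CovBound {t | ∃ x ∈ E, ∃ y ∈ F, t = k + x + y} (s + u) := by
  obtain ⟨C, hC, h1⟩ := hE
  obtain ⟨D, hD, h2⟩ := hF
  refine ⟨C * D * (1 / 2) ^ (-s - u), by positivity, fun r hr hr1 => ?_⟩
  obtain ⟨P, hP, hPc⟩ := h1 (r / 2) (by linarith) (by linarith)
  obtain ⟨Q, hQ, hQc⟩ := h2 (r / 2) (by linarith) (by linarith)
  refine ⟨(P ×ˢ Q).map fun p => k + p.1 + p.2, ?_, ?_⟩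
  · rw [List.length_map, List.length_product]
    push_cast
    calc (P.length : ℝ) * Q.length ≤ (C * (r / 2) ^ (-s)) * (D * (r / 2) ^ (-u)) :=
          mul_le_mul hP hQ (by positivity) (by positivity)
      _ = C * D * (1 / 2) ^ (-s - u) * r ^ (-(s + u)) := by
          have e : r / 2 = 1 / 2 * r := by ring
          rw [e, Real.mul_rpow (by norm_num) hr.le, Real.mul_rpow (by norm_num) hr.le, sub_eq_add_neg,
            Real.rpow_add (by norm_num), neg_add, Real.rpow_add hr]
          ring
  · rintro t ⟨x, hx, y, hy, rfl⟩
    obtain ⟨p, hp, hp'⟩ := hPc x hx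
    obtain ⟨q, hq, hq'⟩ := hQc y hy
    refine ⟨k + p + q, List.mem_map.2 ⟨(p, q), List.mem_product.2 ⟨hp, hq⟩, rfl⟩, ?_⟩
    rw [abs_le] at *
    constructor <;> linarith [hp'.1, hp'.2, hq'.1, hq'.2]

theorem CovBound.dimH_le {E : Set ℝ} {s : ℝ} (h : CovBound E s) (hs : 0 < s) :
    dimH E ≤ ENNReal.ofReal s := by
  obtain ⟨C, hC, h⟩ := h
  have hpos : ∀ n : ℕ, (0 : ℝ) < 1 / ((n : ℝ) + 1) := fun n => by positivity
  have hle : ∀ n : ℕ, 1 / ((n : ℝ) + 1) ≤ 1 := fun n => by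
    rw [div_le_one (by positivity)]; linarith [(Nat.cast_nonneg n : (0 : ℝ) ≤ n)]
  choose P hP hc using fun n : ℕ => h _ (hpos n) (hle n)
  have key : MeasureTheory.Measure.hausdorffMeasure s E ≤ ENNReal.ofReal (C * 2 ^ s) := by
    refine (MeasureTheory.Measure.hausdorffMeasure_le_liminf_sum (l := atTop)
      (ι := fun n : ℕ => Fin (P n).length) s E
      (fun n => ENNReal.ofReal (2 * (1 / ((n : ℝ) + 1)))) ?_
      (fun n i => Metric.closedBall ((P n).get i) (1 / ((n : ℝ) + 1))) ?_ ?_).trans ?_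
    · have := (tendsto_one_div_add_atTop_nhds_zero_nat (𝕜 := ℝ)).const_mul 2
      rw [mul_zero] at this
      simpa using ENNReal.tendsto_ofReal this
    · refine Eventually.of_forall fun n i => ?_
      rw [Real.closedBall_eq_Icc, Real.ediam_Icc]
      exact ENNReal.ofReal_le_ofReal (by linarith)
    · refine Eventually.of_forall fun n x hx => ?_
      obtain ⟨p, hp, hx⟩ := hc n x hx
      obtain ⟨i, rfl⟩ := List.get_of_mem hp
      exact Set.mem_iUnion.2 ⟨i, by rwa [Metric.mem_closedBall, Real.dist_eq]⟩
    · refine liminf_le_of_le (by isBoundedDefault) fun b hb => ?_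
      obtain ⟨n, hn⟩ := hb.exists
      refine hn.trans ?_
      have e : ∀ i : Fin (P n).length,
          Metric.ediam (Metric.closedBall ((P n).get i) (1 / ((n : ℝ) + 1))) ^ s =
          ENNReal.ofReal ((2 * (1 / ((n : ℝ) + 1))) ^ s) := fun i => by
        rw [Real.closedBall_eq_Icc, Real.ediam_Icc, ENNReal.ofReal_rpow_of_pos]
        · congr 2; ring
        · have := hpos n; linarith
      simp_rw [e]
      rw [Finset.sum_const, Finset.card_univ, Fintype.card_fin, nsmul_eq_mul,
        ← ENNReal.ofReal_natCast, ← ENNReal.ofReal_mul (by positivity)]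
      apply ENNReal.ofReal_le_ofReal
      have h1 := hpos n
      calc ((P n).length : ℝ) * (2 * (1 / ((n : ℝ) + 1))) ^ s
          ≤ (C * (1 / ((n : ℝ) + 1)) ^ (-s)) * (2 * (1 / ((n : ℝ) + 1))) ^ s :=
            mul_le_mul_of_nonneg_right (hP n) (by positivity)
        _ = C * 2 ^ s := by
          rw [Real.mul_rpow (by norm_num) h1.le, Real.rpow_neg h1.le]
          have := (Real.rpow_pos_of_pos h1 s).ne'
          field_simp
  have := dimH_le_of_hausdorffMeasure_ne_top (d := s.toNNReal) (s := E) (by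
    rw [Real.coe_toNNReal _ hs.le]
    exact ne_top_of_le_ne_top ENNReal.ofReal_ne_top key)
  exact this

/-- The sequence `x` starts with the word `w`. -/
def Pre : List ℕ → (ℕ → ℕ) → Prop
  | [], _ => True
  | d :: w, x => x 0 = d ∧ Pre w fun k => x (k + 1)

theorem pre_append {w v : List ℕ} {x : ℕ → ℕ} :
    Pre (w ++ v) x ↔ Pre w x ∧ Pre v fun k => x (k + w.length) := by
  induction w generalizing x with
  | nil => simp [Pre]
  | cons d w ih =>
    simp only [List.cons_append, Pre, ih, List.length_cons, and_assoc]
    simp only [add_assoc, add_comm w.length]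

theorem pre_ofFn (x : ℕ → ℕ) (n : ℕ) : Pre (List.ofFn fun i : Fin n => x i) x := by
  induction n generalizing x with
  | zero => simp [Pre]
  | succ n ih =>
    rw [List.ofFn_succ]
    exact ⟨rfl, ih fun k => x (k + 1)⟩

theorem Pre.get {w : List ℕ} {x : ℕ → ℕ} (h : Pre w x) (k : ℕ) (hk : k < w.length) :
    x k = w[k] := by
  induction w generalizing x k with
  | nil => simp at hk
  | cons d w ih =>
    cases k with
    | zero => exact h.1
    | succ k => exact ih h.2 k (by simpa using hk)

theorem Pre.forall_mem {w : List ℕ} {x : ℕ → ℕ} (h : Pre w x) {p : ℕ → Prop} (hp : ∀ k, p (x k)) :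
    ∀ d ∈ w, p d := by
  intro d hd
  obtain ⟨k, hk, rfl⟩ := List.getElem_of_mem hd
  rw [← h.get k hk]
  exact hp k

/-- The inverse branch `x ↦ [0; w₁, …, wₙ + x]`. -/
noncomputable def mob : List ℕ → ℝ → ℝ
  | [], x => x
  | d :: w, x => 1 / (d + mob w x)

theorem mob_append (w v : List ℕ) (x : ℝ) : mob (w ++ v) x = mob w (mob v x) := by
  induction w with
  | nil => rfl
  | cons d w ih => simp only [List.cons_append, mob, ih]

theorem cfv_eq_mob {w : List ℕ} {x : ℕ → ℕ} (hx : ∀ k, 1 ≤ x k) (h : Pre w x) :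
    cfv x = mob w (cfv fun k => x (k + w.length)) := by
  induction w generalizing x with
  | nil => rfl
  | cons d w ih =>
    rw [cfv_rec x hx, h.1, ih (fun _ => hx _) h.2]
    simp only [mob, List.length_cons, add_assoc, add_comm 1]

/-- Denominator recursion, started at `(1, m)`. -/
noncomputable def den (m : ℝ) (w : List ℕ) : ℝ × ℝ :=
  w.foldl (fun (p : ℝ × ℝ) (d : ℕ) => ((d : ℝ) * p.1 + p.2, p.1)) (1, m)

theorem den_snoc (m : ℝ) (w : List ℕ) (d : ℕ) :
    den m (w ++ [d]) = (d * (den m w).1 + (den m w).2, (den m w).1) := by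
  simp [den, List.foldl_append]

theorem den_mem {m : ℝ} (hm : 0 ≤ m) (hm1 : m ≤ 1) (w : List ℕ) (hw : ∀ d ∈ w, 1 ≤ d) :
    1 ≤ (den m w).1 ∧ 0 ≤ (den m w).2 ∧ (den m w).2 ≤ (den m w).1 ∧
      (w ≠ [] → 1 ≤ (den m w).2) := by
  induction w using List.reverseRecOn with
  | nil => simp [den, hm, hm1]
  | append_singleton w d ih =>
    obtain ⟨h1, h2, h3, -⟩ := ih fun e he => hw e (by simp [he])
    have hd : (1 : ℝ) ≤ d := by exact_mod_cast hw d (by simp)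
    rw [den_snoc]
    refine ⟨?_, ?_, ?_, fun _ => h1⟩
    · nlinarith
    · linarith
    · nlinarith

theorem den_append_ge {m : ℝ} (hm : 0 ≤ m) (hm1 : m ≤ 1) (w v : List ℕ) (hw : ∀ d ∈ w, 1 ≤ d)
    (hv : ∀ d ∈ v, 1 ≤ d) (hw0 : w ≠ []) (hv0 : v ≠ []) :
    (den m w).1 + 1 ≤ (den m (w ++ v)).1 := by
  induction v using List.reverseRecOn with
  | nil => simp at hv0
  | append_singleton v d ih =>
    have hd : (1 : ℝ) ≤ d := by exact_mod_cast hv d (by simp)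
    have hv' : ∀ d ∈ v, 1 ≤ d := fun e he => hv e (by simp [he])
    rw [← List.append_assoc, den_snoc]
    obtain ⟨h1, h2, h3, h4⟩ := den_mem hm hm1 (w ++ v) (fun e he => by
      rcases List.mem_append.1 he with h | h
      exacts [hw e h, hv' e h])
    have h5 := h4 (by simp [hw0])
    have h6 : (den m w).1 ≤ (den m (w ++ v)).1 := by
      by_cases h : v = []
      · rw [h, List.append_nil]
      · linarith [ih hv' h]
    simp only
    nlinarith

theorem den_append_le {m : ℝ} (hm : 0 ≤ m) (hm1 : m ≤ 1) (M : ℕ) (w v : List ℕ)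
    (hw : ∀ d ∈ w, 1 ≤ d) (hv : ∀ d ∈ v, 1 ≤ d ∧ d ≤ M) :
    (den m (w ++ v)).1 ≤ ((M : ℝ) + 1) ^ v.length * (den m w).1 := by
  induction v using List.reverseRecOn with
  | nil => simp
  | append_singleton v d ih =>
    have hd : (d : ℝ) ≤ M := by exact_mod_cast (hv d (by simp)).2
    have hv' : ∀ d ∈ v, 1 ≤ d ∧ d ≤ M := fun e he => hv e (by simp [he])
    rw [← List.append_assoc, den_snoc]
    obtain ⟨h1, h2, h3, h4⟩ := den_mem hm hm1 (w ++ v) (fun e he => by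
      rcases List.mem_append.1 he with h | h
      exacts [hw e h, (hv' e h).1])
    have := ih hv'
    rw [List.length_append, List.length_singleton, pow_succ]
    simp only
    calc (d : ℝ) * (den m (w ++ v)).1 + (den m (w ++ v)).2 ≤ (M + 1) * (den m (w ++ v)).1 := by
          nlinarith
      _ ≤ (M + 1) * (((M : ℝ) + 1) ^ v.length * (den m w).1) := by gcongr
      _ = _ := by ring

theorem abs_mob_sub_le {m : ℝ} (hm : 0 ≤ m) (hm1 : m ≤ 1) (w : List ℕ) (hw : ∀ d ∈ w, 1 ≤ d)
    {x y : ℝ} (hx : x ∈ Set.Icc (0 : ℝ) 1) (hy : y ∈ Set.Icc (0 : ℝ) 1) :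
    |mob w x - mob w y| ≤ 4 * |x - y| /
      (((den m w).1 + (den m w).2 * x) * ((den m w).1 + (den m w).2 * y)) := by
  induction w using List.reverseRecOn generalizing x y with
  | nil =>
    obtain ⟨hx0, hx1⟩ := hx
    obtain ⟨hy0, hy1⟩ := hy
    simp only [mob, den, List.foldl_nil]
    rw [le_div_iff₀ (by positivity)]
    have h1 : 1 + m * x ≤ 2 := by nlinarith
    have h2 : 1 + m * y ≤ 2 := by nlinarith
    have h3 : (1 + m * x) * (1 + m * y) ≤ 4 := by
      have : 0 ≤ m * x := by positivity
      have : 0 ≤ m * y := by positivity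
      nlinarith
    nlinarith [abs_nonneg (x - y)]
  | append_singleton w d ih =>
    have hd : (1 : ℝ) ≤ d := by exact_mod_cast hw d (by simp)
    have hw' : ∀ d ∈ w, 1 ≤ d := fun e he => hw e (by simp [he])
    have := ih hw' (one_div_add_mem hd hx) (one_div_add_mem hd hy)
    obtain ⟨h1, h2, h3, h4⟩ := den_mem hm hm1 w hw'
    rw [mob_append, mob_append, den_snoc]
    simp only [mob]
    refine this.trans (le_of_eq ?_)
    obtain ⟨hx0, hx1⟩ := hx
    obtain ⟨hy0, hy1⟩ := hy
    have e1 : 0 < (d : ℝ) + x := by linarith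
    have e2 : 0 < (d : ℝ) + y := by linarith
    have e : |1 / ((d : ℝ) + x) - 1 / (d + y)| = |x - y| / ((d + x) * (d + y)) := by
      rw [div_sub_div _ _ e1.ne' e2.ne', abs_div, abs_of_pos (mul_pos e1 e2), abs_sub_comm]
      congr 2; ring
    rw [e]
    have p1 : 0 < (den m w).1 * (d + x) + (den m w).2 := by nlinarith
    have p2 : 0 < (den m w).1 * (d + y) + (den m w).2 := by nlinarith
    have q1 : (den m w).1 + (den m w).2 * (1 / (d + x)) =
        ((den m w).1 * (d + x) + (den m w).2) / (d + x) := by field_simp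
    have q2 : (den m w).1 + (den m w).2 * (1 / (d + y)) =
        ((den m w).1 * (d + y) + (den m w).2) / (d + y) := by field_simp
    have r1 : (d * (den m w).1 + (den m w).2 + (den m w).1 * x) =
      (den m w).1 * (d + x) + (den m w).2 := by ring
    have r2 : (d * (den m w).1 + (den m w).2 + (den m w).1 * y) =
      (den m w).1 * (d + y) + (den m w).2 := by ring
    rw [q1, q2, r1, r2]
    field_simp

theorem abs_mob_sub_le_of_le {m : ℝ} (hm : 0 ≤ m) (hm1 : m ≤ 1) (w : List ℕ) (hw : ∀ d ∈ w, 1 ≤ d)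
    {x y : ℝ} (hx : x ∈ Set.Icc (0 : ℝ) 1) (hy : y ∈ Set.Icc (0 : ℝ) 1) :
    |mob w x - mob w y| ≤ 4 / (den m w).1 ^ 2 := by
  obtain ⟨h1, h2, h3, h4⟩ := den_mem hm hm1 w hw
  refine (abs_mob_sub_le hm hm1 w hw hx hy).trans ?_
  have : |x - y| ≤ 1 := by rw [abs_le]; constructor <;> linarith [hx.1, hx.2, hy.1, hy.2]
  have a1 : 0 ≤ (den m w).2 * x := mul_nonneg h2 hx.1
  have a2 : 0 ≤ (den m w).2 * y := mul_nonneg h2 hy.1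
  apply div_le_div₀ (by norm_num) (by linarith) (by positivity)
  rw [sq]
  apply mul_le_mul <;> linarith

/-- Weight of a word. -/
noncomputable def wt (m σ : ℝ) (h : ℕ → ℝ) (w : List ℕ) : ℝ :=
  h (w.getLastD 0) * ((den m w).1 + (den m w).2 / 2) ^ (-σ)

theorem exists_cover_list {ι : Type*} (V : List ι) (f : ι → ℝ) (E : ι → Set ℝ) (r : ℝ)
    (h : ∀ v ∈ V, ∃ P : List ℝ, (P.length : ℝ) ≤ f v ∧ ∀ x ∈ E v, ∃ p ∈ P, |x - p| ≤ r) :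
    ∃ P : List ℝ, (P.length : ℝ) ≤ (V.map f).sum ∧ ∀ v ∈ V, ∀ x ∈ E v, ∃ p ∈ P, |x - p| ≤ r := by
  induction V with
  | nil => exact ⟨[], by simp, by simp⟩
  | cons v V ih =>
    obtain ⟨P, hP, hP'⟩ := h v (by simp)
    obtain ⟨Q, hQ, hQ'⟩ := ih fun u hu => h u (by simp [hu])
    refine ⟨P ++ Q, ?_, ?_⟩
    · rw [List.length_append, List.map_cons, List.sum_cons]; push_cast; linarith
    · intro u hu x hx
      rcases List.mem_cons.1 hu with rfl | hu
      · obtain ⟨p, hp, h⟩ := hP' x hx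
        exact ⟨p, by simp [hp], h⟩
      · obtain ⟨p, hp, h⟩ := hQ' u hu x hx
        exact ⟨p, by simp [hp], h⟩

theorem covBound_of_tree {S : Set (ℕ → ℕ)} {M L : ℕ} {m s η : ℝ} {h : ℕ → ℝ} {w₀ : List ℕ}
    (hS : ∀ x ∈ S, ∀ k, 1 ≤ x k) (hm : 0 ≤ m) (hm1 : m ≤ 1) (hs : 0 ≤ s)
    (hη : 0 < η) (hh : ∀ d, η ≤ h d) (hw₀ : w₀ ≠ []) (hw₀' : ∀ d ∈ w₀, 1 ≤ d)
    (H : ∀ u, (∀ d ∈ u, 1 ≤ d) → (∃ x ∈ S, Pre (w₀ ++ u) x) → ∃ V : List (List ℕ),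
      (∀ v ∈ V, v ≠ [] ∧ v.length ≤ L ∧ ∀ d ∈ v, 1 ≤ d ∧ d ≤ M) ∧
      (∀ x ∈ S, Pre (w₀ ++ u) x → ∃ v ∈ V, Pre (w₀ ++ u ++ v) x) ∧
      (V.map fun v => wt m (2 * s) h (w₀ ++ u ++ v)).sum ≤ wt m (2 * s) h (w₀ ++ u)) :
    CovBound (cfv '' {x | x ∈ S ∧ Pre w₀ x}) s := by
  obtain ⟨hA0, -, -, -⟩ := den_mem hm hm1 w₀ hw₀'
  set κ : ℝ := ((M : ℝ) + 1) ^ L * (den m w₀).1 with hκ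
  have hpow : (1 : ℝ) ≤ ((M : ℝ) + 1) ^ L := one_le_pow₀ (by linarith [(Nat.cast_nonneg M : (0:ℝ) ≤ M)])
  have hκ1 : (den m w₀).1 ≤ κ := by nlinarith
  have hκ2 : ((M : ℝ) + 1) ^ L ≤ κ := by nlinarith
  have hκ0 : 0 < κ := by linarith
  have hwt0 : 0 < wt m (2 * s) h w₀ := by
    obtain ⟨h1, h2, -, -⟩ := den_mem hm hm1 w₀ hw₀'
    exact mul_pos (lt_of_lt_of_le hη (hh _)) (Real.rpow_pos_of_pos (by linarith) _)
  refine ⟨wt m (2 * s) h w₀ / (η * (3 / 2 * κ * 2) ^ (-(2 * s))), by positivity, fun r hr hr1 => ?_⟩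
  set R : ℝ := 2 * r ^ (-(1 / 2 : ℝ)) with hR
  have hr2 : 1 ≤ r ^ (-(1 / 2 : ℝ)) := Real.one_le_rpow_of_pos_of_le_one_of_nonpos hr hr1 (by norm_num)
  have hR2 : 2 ≤ R := by linarith
  have hRsq : 4 / R ^ 2 = r := by
    rw [hR, mul_pow, ← Real.rpow_natCast (r ^ _), ← Real.rpow_mul hr.le]
    norm_num
    rw [Real.rpow_neg_one]
    field_simp
  set W : ℝ := η * (3 / 2 * κ * R) ^ (-(2 * s)) with hW
  have hWpos : 0 < W := by positivity
  have hWr : W = η * (3 / 2 * κ * 2) ^ (-(2 * s)) * r ^ s := by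
    rw [hW, hR, ← mul_assoc (3 / 2 * κ), Real.mul_rpow (by positivity) (by positivity),
      ← Real.rpow_mul hr.le, ← mul_assoc]
    congr 2; ring
  have claim : ∀ n : ℕ, ∀ u : List ℕ, (∀ d ∈ u, 1 ≤ d) → R ≤ (den m (w₀ ++ u)).1 + n →
      (den m (w₀ ++ u)).1 ≤ κ * R → ∃ P : List ℝ,
        (P.length : ℝ) ≤ wt m (2 * s) h (w₀ ++ u) / W ∧
        ∀ x ∈ cfv '' {x | x ∈ S ∧ Pre (w₀ ++ u) x}, ∃ p ∈ P, |x - p| ≤ r := by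
    have hmem : ∀ u : List ℕ, (∀ d ∈ u, 1 ≤ d) → ∀ d ∈ w₀ ++ u, 1 ≤ d := fun u hu d hd => by
      rcases List.mem_append.1 hd with h | h
      exacts [hw₀' d h, hu d h]
    have leaf : ∀ u : List ℕ, (∀ d ∈ u, 1 ≤ d) → R ≤ (den m (w₀ ++ u)).1 →
      (den m (w₀ ++ u)).1 ≤ κ * R → ∃ P : List ℝ,
        (P.length : ℝ) ≤ wt m (2 * s) h (w₀ ++ u) / W ∧
        ∀ x ∈ cfv '' {x | x ∈ S ∧ Pre (w₀ ++ u) x}, ∃ p ∈ P, |x - p| ≤ r := by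
      intro u hu h1 h2
      obtain ⟨g1, g2, g3, -⟩ := den_mem hm hm1 (w₀ ++ u) (hmem u hu)
      have hWle : W ≤ wt m (2 * s) h (w₀ ++ u) := by
        refine mul_le_mul (hh _) ?_ (by positivity) (hη.le.trans (hh _))
        exact Real.rpow_le_rpow_of_nonpos (by linarith) (by linarith) (by linarith)
      by_cases hex : ∃ x ∈ S, Pre (w₀ ++ u) x
      · obtain ⟨y, hy, hyp⟩ := hex
        refine ⟨[cfv y], ?_, ?_⟩
        · rw [List.length_singleton, le_div_iff₀ hWpos]; push_cast; linarith
        · rintro _ ⟨x, ⟨hx, hxp⟩, rfl⟩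
          refine ⟨cfv y, by simp, ?_⟩
          rw [cfv_eq_mob (hS x hx) hxp, cfv_eq_mob (hS y hy) hyp]
          refine (abs_mob_sub_le_of_le hm hm1 _ (hmem u hu) (cfv_mem _ fun _ => hS x hx _)
            (cfv_mem _ fun _ => hS y hy _)).trans ?_
          rw [← hRsq]
          gcongr
      · refine ⟨[], ?_, ?_⟩
        · simp only [List.length_nil, Nat.cast_zero]
          exact div_nonneg (hWpos.le.trans hWle) hWpos.le
        · rintro _ ⟨x, hx, rfl⟩
          exact absurd ⟨x, hx⟩ hex
    intro n
    induction n with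
    | zero =>
      intro u hu h1 h2
      exact leaf u hu (by simpa using h1) h2
    | succ n ih =>
      intro u hu h1 h2
      rcases le_or_gt R (den m (w₀ ++ u)).1 with hRA | hRA
      · exact leaf u hu hRA h2
      by_cases hex : ∃ x ∈ S, Pre (w₀ ++ u) x
      · obtain ⟨V, hV1, hV2, hV3⟩ := H u hu hex
        obtain ⟨P, hP, hPc⟩ := exists_cover_list V (fun v => wt m (2 * s) h (w₀ ++ u ++ v) / W)
          (fun v => cfv '' {x | x ∈ S ∧ Pre (w₀ ++ u ++ v) x}) r (fun v hv => by
            obtain ⟨hv0, hvL, hvd⟩ := hV1 v hv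
            have hd1 : ∀ d ∈ v, 1 ≤ d := fun d hd => (hvd d hd).1
            have := ih (u ++ v) (fun d hd => by
              rcases List.mem_append.1 hd with h | h
              exacts [hu d h, hd1 d h])
            rw [← List.append_assoc] at this
            refine this ?_ ?_
            · have := den_append_ge hm hm1 (w₀ ++ u) v (hmem u hu) hd1 (by simp [hw₀]) hv0
              push_cast at h1; linarith
            · have h3 := den_append_le hm hm1 M (w₀ ++ u) v (hmem u hu) hvd
              obtain ⟨g1, -⟩ := den_mem hm hm1 (w₀ ++ u) (hmem u hu)
              refine h3.trans (mul_le_mul ?_ hRA.le (by linarith) hκ0.le)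
              refine le_trans ?_ hκ2
              exact pow_le_pow_right₀ (by linarith [(Nat.cast_nonneg M : (0:ℝ) ≤ M)]) hvL)
        refine ⟨P, hP.trans ?_, ?_⟩
        · have e : (V.map fun v => wt m (2 * s) h (w₀ ++ u ++ v) / W).sum =
              (V.map fun v => wt m (2 * s) h (w₀ ++ u ++ v)).sum / W := by
            simp only [div_eq_mul_inv, List.sum_map_mul_right]
          rw [e]
          gcongr
        · rintro _ ⟨x, ⟨hx, hxp⟩, rfl⟩
          obtain ⟨v, hv, hxv⟩ := hV2 x hx hxp
          exact hPc v hv _ ⟨x, ⟨hx, hxv⟩, rfl⟩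
      · refine ⟨[], ?_, ?_⟩
        · obtain ⟨g1, g2, -⟩ := den_mem hm hm1 (w₀ ++ u) (hmem u hu)
          simp only [List.length_nil, Nat.cast_zero]
          refine div_nonneg (mul_nonneg (hη.le.trans (hh _)) ?_) hWpos.le
          exact Real.rpow_nonneg (by linarith) _
        · rintro _ ⟨x, hx, rfl⟩
          exact absurd ⟨x, hx⟩ hex
  obtain ⟨n, hn⟩ := exists_nat_ge R
  have := claim n [] (by simp) (by rw [List.append_nil]; linarith)
    (by rw [List.append_nil]; nlinarith)
  rw [List.append_nil] at this
  obtain ⟨P, hP, hPc⟩ := this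
  refine ⟨P, hP.trans (le_of_eq ?_), hPc⟩
  rw [hWr, Real.rpow_neg hr.le, ← div_div, div_eq_mul_inv _ (r ^ s)]

/-- The real value of a fraction given by numerator and denominator. -/
noncomputable def frac (p : ℕ × ℕ) : ℝ := (p.1 : ℝ) / p.2

/-- The fraction `1 / (d + p)`. -/
def fracInv (d : ℕ) (p : ℕ × ℕ) : ℕ × ℕ := (p.2, d * p.2 + p.1)

theorem frac_nonneg (p : ℕ × ℕ) : 0 ≤ frac p := by unfold frac; positivity

theorem frac_fracInv (d : ℕ) {p : ℕ × ℕ} (hp : 0 < p.2) :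
    frac (fracInv d p) = 1 / (d + frac p) := by
  have : (p.2 : ℝ) ≠ 0 := by positivity
  unfold frac fracInv
  push_cast
  rw [show (d : ℝ) + p.1 / p.2 = (d * p.2 + p.1) / p.2 by field_simp, one_div_div]

/-- Image of an interval of fractions under `mob w`. -/
def mobI (b : (ℕ × ℕ) × (ℕ × ℕ)) : List ℕ → (ℕ × ℕ) × (ℕ × ℕ)
  | [] => b
  | d :: w => let I := mobI b w; (fracInv d I.2, fracInv d I.1)

theorem mobI_spec {b : (ℕ × ℕ) × (ℕ × ℕ)} (h1 : 0 < b.1.2) (h2 : 0 < b.2.2) {w : List ℕ}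
    (hw : ∀ d ∈ w, 1 ≤ d) {x : ℝ} (hx : x ∈ Set.Icc (frac b.1) (frac b.2)) :
    0 < (mobI b w).1.2 ∧ 0 < (mobI b w).2.2 ∧
      mob w x ∈ Set.Icc (frac (mobI b w).1) (frac (mobI b w).2) := by
  induction w with
  | nil => exact ⟨h1, h2, hx⟩
  | cons d w ih =>
    obtain ⟨g1, g2, g3, g4⟩ := ih fun e he => hw e (by simp [he])
    have hd := hw d (by simp)
    have hd' : (1 : ℝ) ≤ d := by exact_mod_cast hd
    have q1 := frac_nonneg (mobI b w).1
    have q2 := frac_nonneg (mobI b w).2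
    refine ⟨?_, ?_, ?_, ?_⟩
    · simp only [mobI, fracInv]; positivity
    · simp only [mobI, fracInv]; positivity
    · simp only [mobI, mob, frac_fracInv d g2]
      exact one_div_le_one_div_of_le (by linarith) (by linarith)
    · simp only [mobI, mob, frac_fracInv d g1]
      exact one_div_le_one_div_of_le (by linarith) (by linarith)

/-- `b` is an interval containing all continued fractions with digits in `1, …, M`. -/
structure IsBase (M : ℕ) (b : (ℕ × ℕ) × (ℕ × ℕ)) : Prop where
  pos₁ : 0 < b.1.2
  pos₂ : 0 < b.2.2
  lo_le : frac b.1 ≤ 1 / (M + frac b.2)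
  le_hi : 1 / (1 + frac b.1) ≤ frac b.2
  le : frac b.1 ≤ frac b.2
  hi_le : frac b.2 ≤ 1

theorem den_ge_length {m : ℝ} (hm : 0 ≤ m) (hm1 : m ≤ 1) (w : List ℕ) (hw : ∀ d ∈ w, 1 ≤ d) :
    (w.length : ℝ) ≤ (den m w).1 := by
  induction w using List.reverseRecOn with
  | nil => simp [den]
  | append_singleton w d ih =>
    have hd : (1 : ℝ) ≤ d := by exact_mod_cast hw d (by simp)
    have hw' : ∀ d ∈ w, 1 ≤ d := fun e he => hw e (by simp [he])
    obtain ⟨h1, h2, h3, h4⟩ := den_mem hm hm1 w hw'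
    rw [den_snoc, List.length_append, List.length_singleton]
    push_cast
    by_cases h : w = []
    · subst h; simp; nlinarith
    · have := h4 h; have := ih hw'; nlinarith

theorem IsBase.mob_mem {M : ℕ} {b : (ℕ × ℕ) × (ℕ × ℕ)} (hb : IsBase M b) {w : List ℕ}
    (hw : ∀ d ∈ w, 1 ≤ d ∧ d ≤ M) {x : ℝ} (hx : x ∈ Set.Icc (frac b.1) (frac b.2)) :
    mob w x ∈ Set.Icc (frac b.1) (frac b.2) := by
  induction w with
  | nil => exact hx
  | cons d w ih =>
    obtain ⟨g3, g4⟩ := ih fun e he => hw e (by simp [he])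
    have hd : (1 : ℝ) ≤ d ∧ (d : ℝ) ≤ M := by exact_mod_cast hw d (by simp)
    have q1 := frac_nonneg b.1
    refine ⟨hb.lo_le.trans ?_, le_trans ?_ hb.le_hi⟩
    · exact one_div_le_one_div_of_le (by linarith) (by linarith)
    · exact one_div_le_one_div_of_le (by linarith) (by linarith)

theorem IsBase.cfv_mem {M : ℕ} {b : (ℕ × ℕ) × (ℕ × ℕ)} (hb : IsBase M b) {x : ℕ → ℕ}
    (hx : ∀ k, 1 ≤ x k ∧ x k ≤ M) : cfv x ∈ Set.Icc (frac b.1) (frac b.2) := by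
  have hx1 : ∀ k, 1 ≤ x k := fun k => (hx k).1
  have key : ∀ n : ℕ, ∃ y ∈ Set.Icc (frac b.1) (frac b.2), |cfv x - y| ≤ 4 / ((n : ℝ) + 1) := by
    intro n
    set w := List.ofFn fun i : Fin (n + 1) => x i with hw
    have hlen : w.length = n + 1 := by simp [hw]
    have hp : Pre w x := pre_ofFn x (n + 1)
    have hw1 := hp.forall_mem hx1
    have h0 : frac b.1 ∈ Set.Icc (0 : ℝ) 1 := ⟨frac_nonneg _, hb.le.trans hb.hi_le⟩
    refine ⟨mob w (frac b.1), hb.mob_mem (hp.forall_mem hx) ⟨le_rfl, hb.le⟩, ?_⟩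
    rw [cfv_eq_mob hx1 hp]
    refine (abs_mob_sub_le_of_le le_rfl zero_le_one w hw1 (MarkovLagrange.cfv_mem _ fun _ => hx1 _)
      h0).trans ?_
    have h1 := den_ge_length le_rfl zero_le_one w hw1
    rw [hlen] at h1; push_cast at h1
    have : (0 : ℝ) ≤ n := Nat.cast_nonneg n
    gcongr
    nlinarith
  have hlim : Tendsto (fun n : ℕ => 4 / ((n : ℝ) + 1)) atTop (𝓝 0) := by
    have := (tendsto_one_div_add_atTop_nhds_zero_nat (𝕜 := ℝ)).const_mul 4
    simpa [div_eq_mul_inv] using this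
  constructor
  · refine ge_of_tendsto' (by simpa using hlim.const_add (cfv x)) fun n : ℕ => ?_
    obtain ⟨y, hy, h⟩ := key n
    linarith [(abs_le.1 h).1, (abs_le.1 h).2, hy.1]
  · refine le_of_tendsto' (by simpa using hlim.const_sub (cfv x)) fun n : ℕ => ?_
    obtain ⟨y, hy, h⟩ := key n
    linarith [(abs_le.1 h).1, (abs_le.1 h).2, hy.2]

/-- Around position `i`, the sequence `a` reads `l` to the left (outwards) and `r` from `i` on. -/
def At (a : ℤ → ℕ) (i : ℤ) (l r : List ℕ) : Prop :=
  (Pre l fun k : ℕ => a (i - 1 - k)) ∧ Pre r fun k : ℕ => a (i + k)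

theorem At.head {a : ℤ → ℕ} {i : ℤ} {l r : List ℕ} {d : ℕ} (h : At a i l (d :: r)) : a i = d := by
  have := h.2.1; simpa using this

theorem At.tail {a : ℤ → ℕ} {i : ℤ} {l r : List ℕ} {d : ℕ} (h : At a i l (d :: r)) :
    Pre r fun k : ℕ => a (i + 1 + k) := by
  have := h.2.2
  push_cast at this
  convert this using 3
  ring

theorem At.step {a : ℤ → ℕ} {i : ℤ} {l r : List ℕ} {d : ℕ} (h : At a i l (d :: r)) :
    At a (i + 1) (d :: l) r := by
  refine ⟨⟨?_, ?_⟩, h.tail⟩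
  · simpa using h.head
  · convert h.1 using 3
    push_cast; ring

/-- The bi-infinite sequence has all digits in `1, …, M`. -/
def Bdd (M : ℕ) (a : ℤ → ℕ) : Prop := ∀ i, 1 ≤ a i ∧ a i ≤ M

theorem Bdd.biPos {M : ℕ} {a : ℤ → ℕ} (h : Bdd M a) : BiPos a := fun i => (h i).1

theorem cfv_mem_mobI {b' : (ℕ × ℕ) × (ℕ × ℕ)} {x : ℕ → ℕ} {w : List ℕ}
    (h1 : 0 < b'.1.2) (h2 : 0 < b'.2.2) (hx : ∀ k, 1 ≤ x k) (hp : Pre w x)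
    (ht : cfv (fun k => x (k + w.length)) ∈ Set.Icc (frac b'.1) (frac b'.2)) :
    0 < (mobI b' w).1.2 ∧ 0 < (mobI b' w).2.2 ∧
      cfv x ∈ Set.Icc (frac (mobI b' w).1) (frac (mobI b' w).2) := by
  rw [cfv_eq_mob hx hp]
  exact mobI_spec h1 h2 (hp.forall_mem hx) ht

theorem IsBase.cfv_mem_mobI {M : ℕ} {b : (ℕ × ℕ) × (ℕ × ℕ)} (hb : IsBase M b) {x : ℕ → ℕ}
    {w : List ℕ} (hx : ∀ k, 1 ≤ x k ∧ x k ≤ M) (hp : Pre w x) :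
    0 < (mobI b w).1.2 ∧ 0 < (mobI b w).2.2 ∧
      cfv x ∈ Set.Icc (frac (mobI b w).1) (frac (mobI b w).2) := by
  rw [cfv_eq_mob (fun k => (hx k).1) hp]
  exact mobI_spec hb.pos₁ hb.pos₂ (hp.forall_mem fun k => (hx k).1) (hb.cfv_mem fun k => hx _)

/-- Decides `t < d + p + q`. -/
def sumGT (d : ℕ) (p q t : ℕ × ℕ) : Bool :=
  Nat.blt (t.1 * (p.2 * q.2)) ((d * (p.2 * q.2) + (p.1 * q.2 + q.1 * p.2)) * t.2)

/-- Decides `d + p + q ≤ t`. -/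
def sumLE (d : ℕ) (p q t : ℕ × ℕ) : Bool :=
  Nat.ble ((d * (p.2 * q.2) + (p.1 * q.2 + q.1 * p.2)) * t.2) (t.1 * (p.2 * q.2))

theorem sum_frac (d : ℕ) {p q : ℕ × ℕ} (hp : 0 < p.2) (hq : 0 < q.2) :
    (d : ℝ) + frac p + frac q =
      ((d * (p.2 * q.2) + (p.1 * q.2 + q.1 * p.2) : ℕ) : ℝ) / ((p.2 * q.2 : ℕ) : ℝ) := by
  have h1 : (p.2 : ℝ) ≠ 0 := by positivity
  have h2 : (q.2 : ℝ) ≠ 0 := by positivity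
  unfold frac
  push_cast
  field_simp
  ring

theorem lt_of_sumGT {d : ℕ} {p q t : ℕ × ℕ} (hp : 0 < p.2) (hq : 0 < q.2) (ht : 0 < t.2)
    (h : sumGT d p q t = true) : frac t < d + frac p + frac q := by
  rw [sum_frac d hp hq, frac, div_lt_div_iff₀ (by positivity) (by positivity)]
  rw [sumGT, Nat.blt_eq] at h
  exact_mod_cast h

theorem le_of_sumLE {d : ℕ} {p q t : ℕ × ℕ} (hp : 0 < p.2) (hq : 0 < q.2) (ht : 0 < t.2)
    (h : sumLE d p q t = true) : d + frac p + frac q ≤ frac t := by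
  rw [sum_frac d hp hq, frac, div_le_div_iff₀ (by positivity) (by positivity)]
  rw [sumLE, Nat.ble_eq] at h
  exact_mod_cast h

/-- The word `r` with left context `l` contains a position of height provably above `t`. -/
def badZ (b : (ℕ × ℕ) × (ℕ × ℕ)) (t : ℕ × ℕ) : List ℕ → List ℕ → Bool
  | _, [] => false
  | l, d :: r => sumGT d (mobI b r).1 (mobI b l).1 t || badZ b t (d :: l) r

theorem exists_lt_lam_of_badZ {M : ℕ} {b : (ℕ × ℕ) × (ℕ × ℕ)} (hb : IsBase M b) {t : ℕ × ℕ}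
    (ht : 0 < t.2) {a : ℤ → ℕ} (ha : Bdd M a) {i : ℤ} {l r : List ℕ} (h : At a i l r)
    (hbad : badZ b t l r = true) : ∃ j, frac t < lam a j := by
  induction r generalizing l i with
  | nil => simp [badZ] at hbad
  | cons d r ih =>
    rw [badZ, Bool.or_eq_true] at hbad
    rcases hbad with hbad | hbad
    · have h1 := hb.cfv_mem_mobI (fun k => ha _) h.tail
      have h2 := hb.cfv_mem_mobI (fun k => ha _) h.1
      have h3 := lt_of_sumGT h1.1 h2.1 ht hbad
      refine ⟨i, ?_⟩
      unfold lam fwd bwd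
      rw [h.head]
      linarith [h1.2.2.1, h2.2.2.1]
    · exact ih h.step hbad

/-- An interval containing the golden tail `[0; 1, 1, 1, …]`. -/
def onesI : (ℕ × ℕ) × (ℕ × ℕ) := ((618, 1000), (6181, 10000))

theorem cfv_ones_mem {x : ℕ → ℕ} (hx : ∀ k, x k = 1) :
    cfv x ∈ Set.Icc (frac onesI.1) (frac onesI.2) := by
  have hx' : x = fun _ => 1 := funext hx
  subst hx'
  have h := cfv_rec (fun _ => 1) fun _ => le_rfl
  have h0 := cfv_pos (fun _ => 1) fun _ => le_rfl
  set y := cfv fun _ => 1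
  rw [eq_div_iff (by positivity)] at h
  push_cast at h
  simp only [frac, onesI]
  constructor <;> norm_num <;> nlinarith

/-- Verifies that the word `g`, continued by ones, has heights at most `t` or at most those of the
reference word `w` read so far, and that it lies on the prescribed side of `w`. -/
def exclZ (b : (ℕ × ℕ) × (ℕ × ℕ)) (t : ℕ × ℕ) : List ℕ → Bool → Bool → List ℕ → List ℕ → Bool
  | [], ag, _, _, _ => !ag
  | d :: g, ag, s, l, w =>
    bif ag then
      match w with
      | [] => false
      | e :: w' =>
        bif Nat.beq d e then
          (s || sumLE d (mobI onesI g).2 (mobI b l).2 t) && exclZ b t g true (!s) (d :: l) w'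
        else
          (bif s then Nat.blt d e else Nat.blt e d) &&
            (sumLE d (mobI onesI g).2 (mobI b l).2 t && exclZ b t g false s (d :: l) [])
    else sumLE d (mobI onesI g).2 (mobI b l).2 t && exclZ b t g false s (d :: l) []

theorem pre_add {g : List ℕ} {a : ℤ → ℕ} {i : ℤ} (h : ∀ k ≥ i + g.length, a k = 1) :
    ∀ k : ℕ, a (i + ((k + g.length : ℕ) : ℤ)) = 1 := fun k => h _ (by push_cast; omega)

theorem At.fwd_le {g : List ℕ} {a : ℤ → ℕ} {i : ℤ} {l : List ℕ} {d : ℕ} (ha : BiPos a)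
    (h : At a i l (d :: g)) (h1 : ∀ k ≥ i + (d :: g).length, a k = 1) :
    0 < (mobI onesI g).2.2 ∧ fwd a i ≤ frac (mobI onesI g).2 := by
  have := cfv_mem_mobI (b' := onesI) (by norm_num [onesI]) (by norm_num [onesI]) (fun k => ha _)
    h.tail (cfv_ones_mem (pre_add (i := i + 1) fun k hk => h1 k (by
      rw [List.length_cons]; push_cast; omega)))
  exact ⟨this.2.1, this.2.2.2⟩

theorem At.lam_le {M : ℕ} {b : (ℕ × ℕ) × (ℕ × ℕ)} (hb : IsBase M b) {t : ℕ × ℕ} (ht : 0 < t.2)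
    {g : List ℕ} {a : ℤ → ℕ} {i : ℤ} {l : List ℕ} {d : ℕ} (ha : Bdd M a) (h : At a i l (d :: g))
    (h1 : ∀ k ≥ i + (d :: g).length, a k = 1)
    (hle : sumLE d (mobI onesI g).2 (mobI b l).2 t = true) : lam a i ≤ frac t := by
  obtain ⟨g1, g2⟩ := h.fwd_le ha.biPos h1
  have h2 := hb.cfv_mem_mobI (fun k => ha _) h.1
  have := le_of_sumLE g1 h2.2.1 ht hle
  have h3 := h2.2.2.2
  unfold lam
  rw [h.head]
  change bwd a i ≤ _ at h3
  linarith

theorem lam_le_of_ones {M : ℕ} {b : (ℕ × ℕ) × (ℕ × ℕ)} (hb : IsBase M b) {a : ℤ → ℕ} (ha : Bdd M a)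
    {j : ℤ} (h : ∀ k ≥ j, a k = 1) : lam a j ≤ 1 + frac onesI.2 + frac b.2 := by
  have h1 : fwd a j ≤ frac onesI.2 := (cfv_ones_mem fun k => h _ (by omega)).2
  have h2 : bwd a j ≤ frac b.2 := (hb.cfv_mem fun k => ha _).2
  unfold lam
  rw [h j le_rfl]
  push_cast; linarith

theorem exclZ_spec {M : ℕ} {b : (ℕ × ℕ) × (ℕ × ℕ)} (hb : IsBase M b) {t : ℕ × ℕ} (ht : 0 < t.2)
    (hone : 1 + frac onesI.2 + frac b.2 ≤ frac t) {a c : ℤ → ℕ} (ha : Bdd M a) (hc : Bdd M c)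
    {T : ℝ} (htT : frac t ≤ T) (haT : ∀ i, lam a i ≤ T) (g : List ℕ) :
    ∀ (ag s : Bool) (l w : List ℕ) (j : ℤ), exclZ b t g ag s l w = true → At c j l g →
      (∀ k ≥ j + g.length, c k = 1) → (ag = true → At a j l w ∧ ∀ k < j, c k = a k) →
      (∀ i ≥ j, lam c i ≤ T) ∧ (ag = true → (s = true → fwd a (j - 1) ≤ fwd c (j - 1)) ∧
        (s = false → fwd c (j - 1) ≤ fwd a (j - 1))) := by
  induction g with
  | nil =>
    intro ag s l w j h _ h1 _
    have : ag = false := by simpa [exclZ] using h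
    subst this
    refine ⟨fun i hi => ?_, by simp⟩
    refine (lam_le_of_ones hb hc fun k hk => h1 k ?_).trans (hone.trans htT)
    simp only [List.length_nil, Nat.cast_zero, add_zero]; omega
  | cons d g ih =>
    intro ag s l w j h hA h1 hag
    have h1' : ∀ k ≥ j + 1 + g.length, c k = 1 := fun k hk => h1 k (by
      rw [List.length_cons]; push_cast; omega)
    have step : ∀ i ≥ j, (lam c j ≤ T) → (∀ i ≥ j + 1, lam c i ≤ T) → lam c i ≤ T := by
      intro i hi g1 g2
      rcases eq_or_lt_of_le hi with rfl | hi
      · exact g1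
      · exact g2 i (by omega)
    have fc := fwd_rec hc.biPos (j - 1)
    have fa := fwd_rec ha.biPos (j - 1)
    rw [sub_add_cancel, hA.head] at fc
    rw [sub_add_cancel] at fa
    have c0 := fwd_pos hc.biPos j
    have a0 := fwd_pos ha.biPos j
    have c1 := fwd_lt_one hc.biPos j
    have a1 := fwd_lt_one ha.biPos j
    have hd0 : (1 : ℝ) ≤ d := by rw [← hA.head]; exact_mod_cast hc.biPos j
    cases ag with
    | false =>
      simp only [exclZ, cond_false, Bool.and_eq_true] at h
      have g1 := hA.lam_le hb ht hc h1 h.1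
      have g2 := ih false s (d :: l) [] (j + 1) h.2 hA.step h1' (by simp)
      exact ⟨fun i hi => step i hi (g1.trans htT) g2.1, by simp⟩
    | true =>
      obtain ⟨hAa, hca⟩ := hag rfl
      cases w with
      | nil => simp [exclZ] at h
      | cons e w =>
        rw [hAa.head] at fa
        have he0 : (1 : ℝ) ≤ e := by rw [← hAa.head]; exact_mod_cast ha.biPos j
        simp only [exclZ, cond_true] at h
        cases hde : Nat.beq d e with
        | true =>
          have hde' : d = e := Nat.eq_of_beq_eq_true hde
          subst hde'
          rw [hde, cond_true, Bool.and_eq_true, Bool.or_eq_true] at h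
          have g2 := ih true (!s) (d :: l) w (j + 1) h.2 hA.step h1' fun _ => ⟨hAa.step, fun k hk => by
            rcases eq_or_lt_of_le (Int.le_of_lt_add_one hk) with rfl | hk
            · rw [hA.head, hAa.head]
            · exact hca k hk⟩
          obtain ⟨g2, g3⟩ := g2
          have g3 := g3 rfl
          rw [add_sub_cancel_right] at g3
          refine ⟨fun i hi => step i hi ?_ g2, fun _ => ⟨fun hs => ?_, fun hs => ?_⟩⟩
          · rcases h.1 with hs | hle
            · have g4 := g3.2 (by simp [hs])
              have g5 := haT j
              have g6 : bwd c j = bwd a j := bwd_congr hca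
              unfold lam at g5 ⊢
              rw [hAa.head] at g5
              rw [hA.head, g6]
              linarith
            · exact (hA.lam_le hb ht hc h1 hle).trans htT
          · have := g3.2 (by simp [hs])
            rw [fa, fc]
            exact one_div_le_one_div_of_le (by linarith) (by linarith)
          · have := g3.1 (by simp [hs])
            rw [fa, fc]
            exact one_div_le_one_div_of_le (by linarith) (by linarith)
        | false =>
          rw [hde, cond_false, Bool.and_eq_true, Bool.and_eq_true] at h
          have g1 := hA.lam_le hb ht hc h1 h.2.1
          have g2 := ih false s (d :: l) [] (j + 1) h.2.2 hA.step h1' (by simp)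
          refine ⟨fun i hi => step i hi (g1.trans htT) g2.1, fun _ => ⟨fun hs => ?_, fun hs => ?_⟩⟩
          · rw [hs, cond_true, Nat.blt_eq] at h
            have : (d : ℝ) + 1 ≤ e := by exact_mod_cast h.1
            rw [fa, fc]
            exact one_div_le_one_div_of_le (by linarith) (by linarith)
          · rw [hs, cond_false, Nat.blt_eq] at h
            have : (e : ℝ) + 1 ≤ d := by exact_mod_cast h.1
            rw [fa, fc]
            exact one_div_le_one_div_of_le (by linarith) (by linarith)

theorem one_div_mem_uIcc {d x y z : ℝ} (hd : 1 ≤ d) (hx : 0 < x) (hy : 0 < y) (hz : 0 < z)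
    (h : z ∈ Set.uIcc x y) : 1 / (d + z) ∈ Set.uIcc (1 / (d + x)) (1 / (d + y)) := by
  rw [Set.mem_uIcc] at *
  rcases h with h | h
  · right
    constructor <;> exact one_div_le_one_div_of_le (by linarith) (by linarith)
  · left
    constructor <;> exact one_div_le_one_div_of_le (by linarith) (by linarith)

/-- Replacing the future of `a` beyond `n` by one lying between those of `a` and `a'` raises heights
up to position `n` by a negligible amount. -/
theorem lam_le_of_between {a a' c : ℤ → ℕ} (ha : BiPos a) (ha' : BiPos a') (hc : BiPos c) {N : ℕ}
    {n : ℤ} (hn : (N : ℤ) ≤ n) (hag : ∀ i : ℤ, -(N : ℤ) ≤ i → i ≤ n → a' i = a i)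
    (hca : ∀ i ≤ n, c i = a i) (hbtw : fwd c n ∈ Set.uIcc (fwd a n) (fwd a' n)) {T : ℝ}
    (h1 : ∀ i, lam a i ≤ T) (h2 : ∀ i, lam a' i ≤ T) {i : ℤ} (hi : i ≤ n) :
    lam c i ≤ T + 4 * (1 / 2) ^ N := by
  have hpos : (0 : ℝ) < (1 / 2) ^ N := by positivity
  have hb : bwd c i = bwd a i := bwd_congr fun j hj => hca j (by omega)
  rcases lt_or_ge i 0 with h0 | h0
  · have := abs_le.1 (abs_fwd_sub_le hc ha (i := i) N fun j _ _ => hca j (by omega))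
    have h3 := h1 i
    unfold lam at h3 ⊢
    rw [hb, hca i hi]
    linarith
  · have key : ∀ k : ℕ, -(N : ℤ) ≤ n - k → fwd c (n - k) ∈ Set.uIcc (fwd a (n - k)) (fwd a' (n - k)) := by
      intro k
      induction k with
      | zero => intro _; simpa using hbtw
      | succ k ih =>
        intro hk
        push_cast at hk
        have e : n - ((k + 1 : ℕ) : ℤ) + 1 = n - k := by push_cast; ring
        rw [fwd_rec hc, fwd_rec ha, fwd_rec ha', e, hca _ (by omega), hag _ (by omega) (by omega)]
        exact one_div_mem_uIcc (by exact_mod_cast ha _) (fwd_pos ha _) (fwd_pos ha' _) (fwd_pos hc _)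
          (ih (by omega))
    have hk := key (n - i).toNat (by omega)
    rw [show n - ((n - i).toNat : ℤ) = i by omega] at hk
    have h3 := h1 i
    have h4 := h2 i
    have h5 := abs_le.1 (abs_bwd_sub_le ha' ha (i := i) N fun j _ _ => hag j (by omega) (by omega))
    unfold lam at h3 h4 ⊢
    rw [hb, hca i hi]
    rw [hag i (by omega) hi] at h4
    rcases Set.mem_uIcc.1 hk with h6 | h6 <;> linarith [h6.1, h6.2]

/-- A family of sequences with a common past, heights at most `T`, and no admissible right
continuation. -/
structure Mem (M : ℕ) (t₂ : ℕ × ℕ) (T : ℝ) (N : ℕ) (p : ℕ → ℕ) (a : ℤ → ℕ) : Prop where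
  bdd : Bdd M a
  le : ∀ i, lam a i ≤ T
  le₂ : ∀ i, lam a i ≤ frac t₂
  noExt : NoExt a (T + 4 * (1 / 2) ^ N) N
  past : ∀ k : ℕ, k ≤ N → a (-k) = p k

/-- The sequence `a` up to `n`, continued by `g` and then by ones. -/
def extOnes (a : ℤ → ℕ) (n : ℤ) (g : List ℕ) : ℤ → ℕ := fun i =>
  if i ≤ n then a i else g.getD (i - n - 1).toNat 1

theorem extOnes_le {a : ℤ → ℕ} {n : ℤ} {g : List ℕ} {i : ℤ} (h : i ≤ n) :
    extOnes a n g i = a i := if_pos h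

theorem extOnes_ge {a : ℤ → ℕ} {n : ℤ} {g : List ℕ} {i : ℤ} (h : n + 1 + g.length ≤ i) :
    extOnes a n g i = 1 := by
  unfold extOnes
  rw [if_neg (by omega), List.getD_eq_default _ _ (by omega)]

theorem pre_of_getD {g : List ℕ} {x : ℕ → ℕ} (h : ∀ k < g.length, x k = g.getD k 1) : Pre g x := by
  induction g generalizing x with
  | nil => trivial
  | cons d g ih =>
    refine ⟨by simpa using h 0 (by simp), ih fun k hk => ?_⟩
    simpa using h (k + 1) (by simpa using hk)

theorem pre_extOnes {a : ℤ → ℕ} {n : ℤ} {g : List ℕ} :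
    Pre g fun k : ℕ => extOnes a n g (n + 1 + k) := by
  refine pre_of_getD fun k _ => ?_
  unfold extOnes
  rw [if_neg (by omega)]
  congr 1; omega

theorem bdd_extOnes {M : ℕ} {a : ℤ → ℕ} (ha : Bdd M a) {n : ℤ} {g : List ℕ}
    (hg : ∀ d ∈ g, 1 ≤ d ∧ d ≤ M) : Bdd M (extOnes a n g) := by
  intro i
  unfold extOnes
  split_ifs
  · exact ha i
  · rcases lt_or_ge (i - n - 1).toNat g.length with h | h
    · rw [List.getD_eq_getElem _ _ h]; exact hg _ (List.getElem_mem _)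
    · rw [List.getD_eq_default _ _ h]; exact ⟨le_rfl, (ha 0).1.trans (ha 0).2⟩

section

variable {M : ℕ} {b : (ℕ × ℕ) × (ℕ × ℕ)} {t₁ t₂ : ℕ × ℕ} {T : ℝ} {N : ℕ} {p : ℕ → ℕ}

theorem Mem.agree {a a' : ℤ → ℕ} (h : Mem M t₂ T N p a) (h' : Mem M t₂ T N p a') {n : ℤ}
    (hn : ∀ i : ℤ, 0 < i → i ≤ n → a' i = a i) : ∀ i : ℤ, -(N : ℤ) ≤ i → i ≤ n → a' i = a i := by
  intro i h1 h2
  rcases lt_or_ge 0 i with h0 | h0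
  · exact hn i h0 h2
  · obtain ⟨k, rfl⟩ : ∃ k : ℕ, i = -(k : ℤ) := ⟨(-i).toNat, by omega⟩
    rw [h.past k (by omega), h'.past k (by omega)]

theorem Mem.false_of_ext {a a' : ℤ → ℕ} (h : Mem M t₂ T N p a) (h' : Mem M t₂ T N p a') {n : ℤ}
    (hNn : (N : ℤ) ≤ n) (hn : ∀ i : ℤ, 0 < i → i ≤ n → a' i = a i) {g : List ℕ}
    (hg : ∀ d ∈ g, 1 ≤ d ∧ d ≤ M)
    (hbtw : fwd (extOnes a n g) n ∈ Set.uIcc (fwd a n) (fwd a' n))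
    (hlam : ∀ i > n, lam (extOnes a n g) i ≤ T) : False := by
  have hc := bdd_extOnes (n := n) h.bdd hg
  obtain ⟨i, hi⟩ := h.noExt (extOnes a n g) ⟨hc.biPos, fun i hi => extOnes_le (by omega),
    (n + 1 + g.length).toNat, fun i hi => extOnes_ge (by omega)⟩
  have hpos : (0 : ℝ) < (1 / 2) ^ N := by positivity
  rcases le_or_gt i n with h0 | h0
  · exact hi.not_ge (lam_le_of_between h.bdd.biPos h'.bdd.biPos hc.biPos hNn (h.agree h' hn)
      (fun i hi => extOnes_le hi) hbtw h.le h'.le h0)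
  · linarith [hlam i h0]

theorem at_extOnes {a : ℤ → ℕ} {n : ℤ} {g : List ℕ} :
    At (extOnes a n g) (n + 1) [a n] g := by
  refine ⟨⟨?_, trivial⟩, pre_extOnes⟩
  change extOnes a n g (n + 1 - 1 - ((0 : ℕ) : ℤ)) = a n
  rw [extOnes_le (by omega)]
  congr 1; omega

theorem fwd_lt_of_digit_lt {a c : ℤ → ℕ} (ha : BiPos a) (hc : BiPos c) {n : ℤ}
    (h : a (n + 1) < c (n + 1)) : fwd c n ≤ fwd a n := by
  rw [fwd_rec ha, fwd_rec hc]
  have h1 : (1 : ℝ) ≤ a (n + 1) := by exact_mod_cast ha _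
  have h2 : (a (n + 1) : ℝ) + 1 ≤ c (n + 1) := by exact_mod_cast h
  have h3 := fwd_lt_one ha (n + 1)
  have h4 := fwd_pos hc (n + 1)
  have h5 := fwd_pos ha (n + 1)
  exact one_div_le_one_div_of_le (by linarith) (by linarith)

/-- Parameters for which the verification procedures are sound. -/
structure Params (M : ℕ) (b : (ℕ × ℕ) × (ℕ × ℕ)) (t₁ t₂ : ℕ × ℕ) : Prop where
  base : IsBase M b
  pos₁ : 0 < t₁.2
  pos₂ : 0 < t₂.2
  one : 1 + frac onesI.2 + frac b.2 ≤ frac t₁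

theorem Mem.false_of_exclZ (P : Params M b t₁ t₂) (hT : frac t₁ ≤ T) {a a' : ℤ → ℕ}
    (h : Mem M t₂ T N p a) (h' : Mem M t₂ T N p a') {n : ℤ}
    (hNn : (N : ℤ) ≤ n) (hn : ∀ i : ℤ, 0 < i → i ≤ n → a' i = a i) {d : ℕ} {g w : List ℕ} {s : Bool}
    (hg : ∀ e ∈ d :: g, 1 ≤ e ∧ e ≤ M) (hd : a (n + 1) = d)
    (hs : bif s then a' (n + 1) < d else d < a' (n + 1)) (hw : At a (n + 1) [a n] w)
    (hex : exclZ b t₁ (d :: g) true s [a n] w = true) : False := by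
  have hc := bdd_extOnes (n := n) h.bdd hg
  obtain ⟨h1, h2⟩ := exclZ_spec P.base P.pos₁ P.one h.bdd hc hT h.le (d :: g) true s [a n] w (n + 1)
    hex at_extOnes (fun k hk => extOnes_ge hk) fun _ => ⟨hw, fun k hk => extOnes_le (by omega)⟩
  have h2 := h2 rfl
  rw [add_sub_cancel_right] at h2
  have hcd : extOnes a n (d :: g) (n + 1) = d := (at_extOnes (a := a) (n := n) (g := d :: g)).head
  refine h.false_of_ext h' hNn hn hg ?_ fun i hi => h1 i (by omega)
  rw [Set.mem_uIcc]
  cases s with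
  | true =>
    left
    exact ⟨h2.1 rfl, fwd_lt_of_digit_lt h'.bdd.biPos hc.biPos (by rw [hcd]; exact hs)⟩
  | false =>
    right
    exact ⟨fwd_lt_of_digit_lt hc.biPos h'.bdd.biPos (by rw [hcd]; exact hs), h2.2 rfl⟩

theorem Mem.false_of_mid (P : Params M b t₁ t₂) (hT : frac t₁ ≤ T) {a a' : ℤ → ℕ}
    (h : Mem M t₂ T N p a) (h' : Mem M t₂ T N p a') {n : ℤ}
    (hNn : (N : ℤ) ≤ n) (hn : ∀ i : ℤ, 0 < i → i ≤ n → a' i = a i) {f : ℕ} {g : List ℕ}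
    (hg : ∀ e ∈ f :: g, 1 ≤ e ∧ e ≤ M) (hd : f < a (n + 1)) (hd' : a' (n + 1) < f)
    (hex : exclZ b t₁ (f :: g) false true [a n] [] = true) : False := by
  have hc := bdd_extOnes (n := n) h.bdd hg
  obtain ⟨h1, h2⟩ := exclZ_spec P.base P.pos₁ P.one h.bdd hc hT h.le (f :: g) false true [a n] []
    (n + 1) hex at_extOnes (fun k hk => extOnes_ge hk) (by simp)
  have hcd : extOnes a n (f :: g) (n + 1) = f := (at_extOnes (a := a) (n := n) (g := f :: g)).head
  refine h.false_of_ext h' hNn hn hg ?_ fun i hi => h1 i (by omega)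
  rw [Set.mem_uIcc]
  left
  exact ⟨fwd_lt_of_digit_lt hc.biPos h.bdd.biPos (by rwa [hcd]),
    fwd_lt_of_digit_lt h'.bdd.biPos hc.biPos (by rwa [hcd])⟩

/-- `v` is a prefix of `w`. -/
def isPfx : List ℕ → List ℕ → Bool
  | [], _ => true
  | d :: v, w =>
    match w with
    | [] => false
    | e :: w => Nat.beq d e && isPfx v w

theorem Pre.of_isPfx {v w : List ℕ} (h : isPfx v w = true) {x : ℕ → ℕ} (hx : Pre w x) : Pre v x := by
  induction v generalizing w x with
  | nil => trivial
  | cons d v ih =>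
    cases w with
    | nil => simp [isPfx] at h
    | cons e w =>
      rw [isPfx, Bool.and_eq_true] at h
      exact ⟨hx.1.trans (Nat.eq_of_beq_eq_true h.1).symm, ih h.2 hx.2⟩

/-- The digits `1, …, M`. -/
def digs (M : ℕ) : List ℕ := List.range' 1 M

theorem mem_digs {M d : ℕ} : d ∈ digs M ↔ 1 ≤ d ∧ d ≤ M := by
  rw [digs, List.mem_range'_1]; omega

/-- Verifies that every admissible continuation of `w` in context `c` has a prefix in `V`. -/
def coverZ (M : ℕ) (b : (ℕ × ℕ) × (ℕ × ℕ)) (t₁ t₂ : ℕ × ℕ) (s : Bool) (c : ℕ)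
    (V G : List (List ℕ)) : ℕ → List ℕ → Bool
  | 0, w => V.any (isPfx · w) || badZ b t₂ [] (c :: w) || G.any fun g => exclZ b t₁ g true s [c] w
  | k + 1, w => V.any (isPfx · w) || badZ b t₂ [] (c :: w) ||
      (G.any fun g => exclZ b t₁ g true s [c] w) ||
      (digs M).all fun f => coverZ M b t₁ t₂ s c V G k (w ++ [f])

/-- The words in `G` start with `d` and have digits in `1, …, M`. -/
def headsOK (M d : ℕ) (G : List (List ℕ)) : Bool :=
  G.all fun g => match g with
    | [] => false
    | e :: g => Nat.beq e d && (e :: g).all fun f => Nat.ble 1 f && Nat.ble f M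

theorem headsOK_spec {M d : ℕ} {G : List (List ℕ)} (h : headsOK M d G = true) {g : List ℕ}
    (hg : g ∈ G) : ∃ g', g = d :: g' ∧ ∀ e ∈ d :: g', 1 ≤ e ∧ e ≤ M := by
  rw [headsOK, List.all_eq_true] at h
  have := h g hg
  cases g with
  | nil => simp at this
  | cons e g =>
    simp only [Bool.and_eq_true] at this
    have he := Nat.eq_of_beq_eq_true this.1
    subst he
    refine ⟨g, rfl, fun f hf => ?_⟩
    have := List.all_eq_true.1 this.2 f hf
    simpa [Nat.ble_eq] using this

theorem coverZ_spec (P : Params M b t₁ t₂) (hT : frac t₁ ≤ T) {a a' : ℤ → ℕ}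
    (h : Mem M t₂ T N p a) (h' : Mem M t₂ T N p a') {n : ℤ}
    (hNn : (N : ℤ) ≤ n) (hn : ∀ i : ℤ, 0 < i → i ≤ n → a' i = a i) {d : ℕ} {s : Bool}
    (hd : a (n + 1) = d) (hs : bif s then a' (n + 1) < d else d < a' (n + 1))
    {V G : List (List ℕ)} (hG : headsOK M d G = true) (k : ℕ) :
    ∀ w : List ℕ, coverZ M b t₁ t₂ s (a n) V G k w = true → (Pre w fun k : ℕ => a (n + 1 + k)) →
      ∃ v ∈ V, Pre v fun k : ℕ => a (n + 1 + k) := by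
  have hat : ∀ w, (Pre w fun k : ℕ => a (n + 1 + k)) → At a (n + 1) [a n] w := fun w hw =>
    ⟨⟨by
      change a (n + 1 - 1 - ((0 : ℕ) : ℤ)) = a n
      congr 1; omega, trivial⟩, hw⟩
  have leaf : ∀ w : List ℕ, (Pre w fun k : ℕ => a (n + 1 + k)) →
      (V.any (isPfx · w) || badZ b t₂ [] (a n :: w) ||
        G.any fun g => exclZ b t₁ g true s [a n] w) = true →
      ∃ v ∈ V, Pre v fun k : ℕ => a (n + 1 + k) := by
    intro w hw hl
    rw [Bool.or_eq_true, Bool.or_eq_true] at hl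
    rcases hl with (hl | hl) | hl
    · obtain ⟨v, hv, hvw⟩ := List.any_eq_true.1 hl
      exact ⟨v, hv, hw.of_isPfx hvw⟩
    · have : At a n [] (a n :: w) := ⟨trivial, by simp, by
        convert hw using 3; push_cast; ring⟩
      obtain ⟨j, hj⟩ := exists_lt_lam_of_badZ P.base P.pos₂ h.bdd this hl
      exact absurd (h.le₂ j) hj.not_ge
    · obtain ⟨g, hg, hex⟩ := List.any_eq_true.1 hl
      obtain ⟨g, rfl, hgM⟩ := headsOK_spec hG hg
      exact (h.false_of_exclZ P hT h' hNn hn hgM hd hs (hat w hw) hex).elim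
  induction k with
  | zero => intro w hc hw; exact leaf w hw (by simpa [coverZ] using hc)
  | succ k ih =>
    intro w hc hw
    rw [coverZ, Bool.or_eq_true] at hc
    rcases hc with hc | hc
    · exact leaf w hw hc
    · refine ih (w ++ [a (n + 1 + w.length)])
        (List.all_eq_true.1 hc _ (mem_digs.2 (h.bdd _))) ?_
      rw [pre_append]
      exact ⟨hw, by simp, trivial⟩

end

/-- Coefficients `(u₀, u₁)` with `2 A' + B' = u₀ A + u₁ B`, where `(A', B')` is obtained from `(A, B)`
by appending `v`. -/
def numW (v : List ℕ) : ℕ × ℕ := v.foldr (fun d p => (p.1 * d + p.2, p.1)) (2, 1)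

theorem numW_spec (v : List ℕ) (P : ℝ × ℝ) :
    2 * (v.foldl (fun (p : ℝ × ℝ) (d : ℕ) => ((d : ℝ) * p.1 + p.2, p.1)) P).1 +
      (v.foldl (fun (p : ℝ × ℝ) (d : ℕ) => ((d : ℝ) * p.1 + p.2, p.1)) P).2 =
    (numW v).1 * P.1 + (numW v).2 * P.2 := by
  induction v generalizing P with
  | nil => simp [numW]
  | cons d v ih =>
    rw [List.foldl_cons, ih]
    simp only [numW, List.foldr_cons]
    push_cast
    ring

theorem two_mul_den_append (m : ℝ) (w v : List ℕ) :
    2 * (den m (w ++ v)).1 + (den m (w ++ v)).2 =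
      (numW v).1 * (den m w).1 + (numW v).2 * (den m w).2 := by
  rw [← numW_spec]
  simp [den, List.foldl_append]

theorem IsBase.den_ratio {M : ℕ} {b : (ℕ × ℕ) × (ℕ × ℕ)} (hb : IsBase M b) {w : List ℕ}
    (hw : ∀ d ∈ w, 1 ≤ d ∧ d ≤ M) :
    frac b.1 * (den (frac b.1) w).1 ≤ (den (frac b.1) w).2 ∧
      (den (frac b.1) w).2 ≤ frac b.2 * (den (frac b.1) w).1 := by
  induction w using List.reverseRecOn with
  | nil => simp [den, hb.le]
  | append_singleton w d ih =>
    have hw' : ∀ d ∈ w, 1 ≤ d ∧ d ≤ M := fun e he => hw e (by simp [he])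
    obtain ⟨h1, h2⟩ := ih hw'
    have hd : (1 : ℝ) ≤ d ∧ (d : ℝ) ≤ M := by exact_mod_cast hw d (by simp)
    have q1 := frac_nonneg b.1
    have q2 := frac_nonneg b.2
    obtain ⟨a1, -, -, -⟩ := den_mem q1 (hb.le.trans hb.hi_le) w fun d hd => (hw' d hd).1
    have g1 := hb.lo_le
    have g2 := hb.le_hi
    rw [le_div_iff₀ (by linarith)] at g1
    rw [div_le_iff₀ (by linarith)] at g2
    rw [den_snoc]
    simp only
    constructor
    · calc frac b.1 * (d * (den (frac b.1) w).1 + (den (frac b.1) w).2)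
          ≤ frac b.1 * (M * (den (frac b.1) w).1 + frac b.2 * (den (frac b.1) w).1) := by
            gcongr; exact_mod_cast hd.2
        _ = (frac b.1 * (M + frac b.2)) * (den (frac b.1) w).1 := by ring
        _ ≤ 1 * (den (frac b.1) w).1 := by gcongr
        _ = _ := one_mul _
    · calc (den (frac b.1) w).1 = 1 * (den (frac b.1) w).1 := (one_mul _).symm
        _ ≤ (frac b.2 * (1 + frac b.1)) * (den (frac b.1) w).1 := by gcongr
        _ = frac b.2 * (1 * (den (frac b.1) w).1 + frac b.1 * (den (frac b.1) w).1) := by ring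
        _ ≤ _ := by gcongr; exact hd.1

/-- Verifies that appending `v` after the digit `c` multiplies the weight of exponent `J / K` by at
most `n / D`. -/
def wtOK (b : (ℕ × ℕ) × (ℕ × ℕ)) (J K D c : ℕ) (v : List ℕ) (n : ℕ) : Bool :=
  let u := numW v
  let f := fun p : ℕ × ℕ => Nat.ble (D ^ K * (2 * (c * p.2 + p.1) + p.2) ^ J)
    (n ^ K * (u.1 * (c * p.2 + p.1) + u.2 * p.2) ^ J)
  f b.1 && f b.2

theorem rpow_le_of_pow_le {J K : ℕ} (hJ : 0 < J) {x y z w : ℝ} (hx : 0 ≤ x) (hy : 0 ≤ y)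
    (hz : 0 ≤ z) (hw : 0 ≤ w) (h : x ^ K * y ^ J ≤ z ^ K * w ^ J) :
    x ^ ((K : ℝ) / J) * y ≤ z ^ ((K : ℝ) / J) * w := by
  have hJ' : (J : ℝ) ≠ 0 := by positivity
  have h1 := Real.rpow_le_rpow (by positivity) h (by positivity : (0 : ℝ) ≤ 1 / J)
  have e : ∀ p q : ℝ, 0 ≤ p → 0 ≤ q →
      (p ^ K * q ^ J) ^ ((1 : ℝ) / J) = p ^ ((K : ℝ) / J) * q := by
    intro p q hp hq
    rw [Real.mul_rpow (by positivity) (by positivity), ← Real.rpow_natCast, ← Real.rpow_natCast,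
      ← Real.rpow_mul hp, ← Real.rpow_mul hq, mul_one_div, mul_one_div, div_self hJ',
      Real.rpow_one]
  rwa [e _ _ hx hy, e _ _ hz hw] at h1

theorem wtOK_spec {M : ℕ} {b : (ℕ × ℕ) × (ℕ × ℕ)} (hb : IsBase M b) {J K D c : ℕ} (hJ : 0 < J)
    (hK : 0 < K) {v : List ℕ} {n : ℕ} (h : wtOK b J K D c v n = true) {w : List ℕ}
    (hw : ∀ d ∈ w ++ [c], 1 ≤ d ∧ d ≤ M) (hv : ∀ d ∈ v, 1 ≤ d ∧ d ≤ M) :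
    (D : ℝ) * ((den (frac b.1) (w ++ [c] ++ v)).1 + (den (frac b.1) (w ++ [c] ++ v)).2 / 2) ^
        (-((J : ℝ) / K)) ≤
      n * ((den (frac b.1) (w ++ [c])).1 + (den (frac b.1) (w ++ [c])).2 / 2) ^
        (-((J : ℝ) / K)) := by
  simp only [wtOK, Bool.and_eq_true, Nat.ble_eq] at h
  have hw' : ∀ d ∈ w, 1 ≤ d ∧ d ≤ M := fun e he => hw e (by simp at he ⊢; tauto)
  obtain ⟨r1, r2⟩ := hb.den_ratio hw'
  have q1 := frac_nonneg b.1
  have hm1 := hb.le.trans hb.hi_le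
  obtain ⟨a1, -, -, -⟩ := den_mem q1 hm1 w fun d hd => (hw' d hd).1
  obtain ⟨a2, a3, -, -⟩ := den_mem q1 hm1 (w ++ [c]) fun d hd => (hw d hd).1
  obtain ⟨a4, a5, -, -⟩ := den_mem q1 hm1 (w ++ [c] ++ v) fun d hd => by
    rcases List.mem_append.1 hd with h | h
    exacts [(hw d h).1, (hv d h).1]
  have hX := two_mul_den_append (frac b.1) (w ++ [c]) v
  set X := (numW v).1 * (den (frac b.1) (w ++ [c])).1 + (numW v).2 * (den (frac b.1) (w ++ [c])).2
    with hXd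
  set Y := 2 * (den (frac b.1) (w ++ [c])).1 + (den (frac b.1) (w ++ [c])).2 with hYd
  have hX0 : 0 < X := by rw [← hX]; linarith
  have hY0 : 0 < Y := by linarith
  have e1 : (den (frac b.1) (w ++ [c] ++ v)).1 + (den (frac b.1) (w ++ [c] ++ v)).2 / 2 = X / 2 := by
    rw [← hX]; ring
  have e2 : (den (frac b.1) (w ++ [c])).1 + (den (frac b.1) (w ++ [c])).2 / 2 = Y / 2 := by
    rw [hYd]; ring
  have hJ' : (0 : ℝ) < J := by exact_mod_cast hJ
  have hK' : (0 : ℝ) < K := by exact_mod_cast hK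
  have lin : ∀ p : ℕ × ℕ, 0 < p.2 →
      D ^ K * (2 * (c * p.2 + p.1) + p.2) ^ J ≤
        n ^ K * ((numW v).1 * (c * p.2 + p.1) + (numW v).2 * p.2) ^ J →
      (D : ℝ) ^ ((K : ℝ) / J) * (2 * (c + frac p) + 1) ≤
        (n : ℝ) ^ ((K : ℝ) / J) * ((numW v).1 * (c + frac p) + (numW v).2) := by
    intro p hp hc
    have hc' : (D : ℝ) ^ K * (2 * (c * p.2 + p.1) + p.2) ^ J ≤
        (n : ℝ) ^ K * ((numW v).1 * (c * p.2 + p.1) + (numW v).2 * p.2) ^ J := by exact_mod_cast hc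
    have := rpow_le_of_pow_le hJ (by positivity) (by positivity) (by positivity) (by positivity) hc'
    have hp' : (0 : ℝ) < p.2 := by exact_mod_cast hp
    have e3 : (c : ℝ) * p.2 + p.1 = p.2 * (c + frac p) := by unfold frac; field_simp
    rw [e3] at this
    refine le_of_mul_le_mul_left ?_ hp'
    linarith
  have l1 := lin _ hb.pos₁ h.1
  have l2 := lin _ hb.pos₂ h.2
  set δ := (D : ℝ) ^ ((K : ℝ) / J) with hδ
  set ν := (n : ℝ) ^ ((K : ℝ) / J) with hν
  have hXY : δ * Y ≤ ν * X := by
    rw [hXd, hYd, den_snoc]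
    simp only
    set A := (den (frac b.1) w).1
    set B := (den (frac b.1) w).2
    set u := ((numW v).1 : ℝ)
    set u' := ((numW v).2 : ℝ)
    set x := frac b.1
    set y := frac b.2
    rcases le_total (2 * δ) (ν * u) with hle | hle
    · have k1 : 0 ≤ (ν * u - 2 * δ) * (B - x * A) := mul_nonneg (by linarith) (by linarith)
      have k2 : 0 ≤ A * (ν * (u * (c + x) + u') - δ * (2 * (c + x) + 1)) :=
        mul_nonneg (by linarith) (by linarith)
      linarith
    · have k1 : 0 ≤ (2 * δ - ν * u) * (y * A - B) := mul_nonneg (by linarith) (by linarith)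
      have k2 : 0 ≤ A * (ν * (u * (c + y) + u') - δ * (2 * (c + y) + 1)) :=
        mul_nonneg (by linarith) (by linarith)
      linarith
  have hXY2 : δ * (Y / 2) ≤ ν * (X / 2) := by linarith
  have fin := Real.rpow_le_rpow (by positivity) hXY2 (by positivity : (0 : ℝ) ≤ (J : ℝ) / K)
  have e5 : (K : ℝ) / J * (J / K) = 1 := by field_simp
  rw [Real.mul_rpow (by positivity) (by positivity), Real.mul_rpow (by positivity) (by positivity),
    hδ, hν, ← Real.rpow_mul (by positivity), ← Real.rpow_mul (by positivity), e5, Real.rpow_one,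
    Real.rpow_one] at fin
  rw [e1, e2, Real.rpow_neg (by positivity), Real.rpow_neg (by positivity), ← div_eq_mul_inv,
    ← div_eq_mul_inv, div_le_div_iff₀ (by positivity) (by positivity)]
  exact fin

/-- The total of the numerators in `V`, weighted by `H` of the last digit. -/
def sumH (H : ℕ → ℕ) (V : List (List ℕ × ℕ)) : ℕ := (V.map fun v => v.2 * H (v.1.getLastD 0)).sum

theorem sum_wt_le {M : ℕ} {b : (ℕ × ℕ) × (ℕ × ℕ)} (hb : IsBase M b) {J K D c : ℕ} (hJ : 0 < J)
    (hK : 0 < K) (hD : 0 < D) {H : ℕ → ℕ} {V : List (List ℕ × ℕ)}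
    (hV : ∀ v ∈ V, v.1 ≠ [] ∧ (∀ d ∈ v.1, 1 ≤ d ∧ d ≤ M) ∧ wtOK b J K D c v.1 v.2 = true)
    (hsum : sumH H V ≤ D * H c) {w : List ℕ} (hw : ∀ d ∈ w ++ [c], 1 ≤ d ∧ d ≤ M) :
    ((V.map Prod.fst).map fun v => wt (frac b.1) ((J : ℝ) / K) (fun d => H d) (w ++ [c] ++ v)).sum ≤
      wt (frac b.1) ((J : ℝ) / K) (fun d => H d) (w ++ [c]) := by
  obtain ⟨a2, a3, -, -⟩ := den_mem (frac_nonneg b.1) (hb.le.trans hb.hi_le) (w ++ [c])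
    fun d hd => (hw d hd).1
  set Q := ((den (frac b.1) (w ++ [c])).1 + (den (frac b.1) (w ++ [c])).2 / 2) ^
    (-((J : ℝ) / K)) with hQ
  have hQ0 : 0 ≤ Q := by positivity
  have key : (D : ℝ) * ((V.map Prod.fst).map fun v =>
      wt (frac b.1) ((J : ℝ) / K) (fun d => H d) (w ++ [c] ++ v)).sum ≤ sumH H V * Q := by
    clear hsum
    induction V with
    | nil => simp [sumH]
    | cons v V ih =>
      have h1 := ih fun v hv => hV v (by simp [hv])
      obtain ⟨h2, h3, h4⟩ := hV v (by simp)
      have h5 := wtOK_spec hb hJ hK h4 hw h3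
      have h6 : (w ++ [c] ++ v.1).getLastD 0 = v.1.getLastD 0 := by
        rw [List.getLastD_eq_getLast?, List.getLastD_eq_getLast?,
          List.getLast?_append_of_ne_nil _ h2]
      have h7 : (D : ℝ) * wt (frac b.1) ((J : ℝ) / K) (fun d => H d) (w ++ [c] ++ v.1) ≤
          v.2 * H (v.1.getLastD 0) * Q := by
        unfold wt
        rw [h6]
        have : (0 : ℝ) ≤ H (v.1.getLastD 0) := Nat.cast_nonneg _
        calc _ = (H (v.1.getLastD 0) : ℝ) * (D * _) := mul_left_comm _ _ _
          _ ≤ (H (v.1.getLastD 0) : ℝ) * (v.2 * Q) := by gcongr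
          _ = _ := by ring
      simp only [List.map_cons, List.sum_cons, sumH] at h1 ⊢
      push_cast at h1 ⊢
      linarith
  have h8 : wt (frac b.1) ((J : ℝ) / K) (fun d => H d) (w ++ [c]) = H c * Q := by
    unfold wt
    simp [hQ]
  rw [h8]
  have hD' : (0 : ℝ) < D := by exact_mod_cast hD
  refine le_of_mul_le_mul_left (key.trans ?_) hD'
  have : (sumH H V : ℝ) ≤ D * H c := by exact_mod_cast hsum
  calc _ ≤ (D * H c : ℝ) * Q := by gcongr
    _ = _ := by ring

/-- The digits in `V` are admissible, its weights are verified, and its words are nonempty of length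
at most `L`. -/
def listOK (M L : ℕ) (b : (ℕ × ℕ) × (ℕ × ℕ)) (J K D c : ℕ) (V : List (List ℕ × ℕ)) : Bool :=
  V.all fun v => Nat.ble 1 v.1.length && Nat.ble v.1.length L &&
    (v.1.all fun d => Nat.ble 1 d && Nat.ble d M) && wtOK b J K D c v.1 v.2

theorem listOK_spec {M L : ℕ} {b : (ℕ × ℕ) × (ℕ × ℕ)} {J K D c : ℕ} {V : List (List ℕ × ℕ)}
    (h : listOK M L b J K D c V = true) : ∀ v ∈ V, v.1 ≠ [] ∧ v.1.length ≤ L ∧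
      (∀ d ∈ v.1, 1 ≤ d ∧ d ≤ M) ∧ wtOK b J K D c v.1 v.2 = true := by
  intro v hv
  have := List.all_eq_true.1 h v hv
  simp only [Bool.and_eq_true, Nat.ble_eq, List.all_eq_true] at this
  obtain ⟨⟨⟨h1, h2⟩, h3⟩, h4⟩ := this
  exact ⟨by rintro h; simp [h] at h1, h2, h3, h4⟩

/-- Data for a context `c` and a pair `e < d` of extremal next digits: words `mid` witnessing that the
pair does not occur, or lists of continuations with the words used to exclude all others. -/
structure Cert where
  c : ℕ
  d : ℕ
  e : ℕ
  mid : List (List ℕ)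
  VD : List (List ℕ × ℕ)
  GD : List (List ℕ)
  VE : List (List ℕ × ℕ)
  GE : List (List ℕ)

/-- Verification of a certificate. -/
def certOK (M L : ℕ) (b : (ℕ × ℕ) × (ℕ × ℕ)) (t₁ t₂ : ℕ × ℕ) (J K D : ℕ) (k : Cert) : Bool :=
  (k.mid.any fun g => exclZ b t₁ g false true [k.c] [] && g.all (fun f => Nat.ble 1 f && Nat.ble f M)
    && Nat.ble (k.e + 1) (g.headD 0) && Nat.ble (g.headD 0 + 1) k.d) ||
  (headsOK M k.d k.GD && headsOK M k.e k.GE &&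
    coverZ M b t₁ t₂ true k.c (k.VD.map Prod.fst) k.GD L [k.d] &&
    coverZ M b t₁ t₂ false k.c (k.VE.map Prod.fst) k.GE L [k.e] &&
    (k.VD.isEmpty || k.VE.isEmpty || (Nat.beq k.d (k.e + 1) &&
      listOK M L b J K D k.c k.VD && listOK M L b J K D k.c k.VE &&
      Nat.ble (sumH (fun _ => 1) k.VD + sumH (fun _ => 1) k.VE) D)))

/-- Every context and every pair of digits has a verified certificate. -/
def certsOK (M L : ℕ) (b : (ℕ × ℕ) × (ℕ × ℕ)) (t₁ t₂ : ℕ × ℕ) (J K D : ℕ) (C : List Cert) : Bool :=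
  (C.all (certOK M L b t₁ t₂ J K D)) && (digs M).all fun c => (digs M).all fun d =>
    (digs M).all fun e => Nat.ble d e || C.any fun k => Nat.beq k.c c && Nat.beq k.d d && Nat.beq k.e e

theorem sumH_append (H : ℕ → ℕ) (V V' : List (List ℕ × ℕ)) :
    sumH H (V ++ V') = sumH H V + sumH H V' := by simp [sumH]

theorem wt_snoc_le {m σ : ℝ} (hm : 0 ≤ m) (hm1 : m ≤ 1) (hσ : 0 ≤ σ) {w : List ℕ} {d : ℕ}
    (hw : ∀ d ∈ w, 1 ≤ d) (hd : 1 ≤ d) :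
    wt m σ (fun _ => 1) (w ++ [d]) ≤ wt m σ (fun _ => 1) w := by
  obtain ⟨h1, h2, h3, -⟩ := den_mem hm hm1 w hw
  unfold wt
  rw [den_snoc, one_mul, one_mul]
  have hd' : (1 : ℝ) ≤ d := by exact_mod_cast hd
  apply Real.rpow_le_rpow_of_nonpos (by positivity) _ (by linarith)
  simp only
  nlinarith

section

variable {M : ℕ} {b : (ℕ × ℕ) × (ℕ × ℕ)} {t₁ t₂ : ℕ × ℕ} {T : ℝ} {N : ℕ} {p : ℕ → ℕ}

/-- The futures of the members of a family. -/
def futures (M : ℕ) (t₂ : ℕ × ℕ) (T : ℝ) (N : ℕ) (p : ℕ → ℕ) : Set (ℕ → ℕ) :=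
  {x | ∃ a, Mem M t₂ T N p a ∧ x = fun k : ℕ => a (1 + k)}

theorem Pre.eq_of_pre {w : List ℕ} {x y : ℕ → ℕ} (hx : Pre w x) (hy : Pre w y) {k : ℕ}
    (hk : k < w.length) : x k = y k := by rw [hx.get k hk, hy.get k hk]

theorem covBound_futures (P : Params M b t₁ t₂) (hT : frac t₁ ≤ T) {L J K D : ℕ} (hJ : 0 < J)
    (hK : 0 < K) (hD : 0 < D) (hL : 1 ≤ L) {C : List Cert}
    (hC : certsOK M L b t₁ t₂ J K D C = true) {w₀ : List ℕ}
    (hw₀ : w₀ ≠ []) (hN : N ≤ w₀.length) (hdig : ∀ d ∈ w₀, 1 ≤ d ∧ d ≤ M) :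
    CovBound (cfv '' {x | x ∈ futures M t₂ T N p ∧ Pre w₀ x}) ((J : ℝ) / K / 2) := by
  have hb := P.base
  have hm := frac_nonneg b.1
  have hm1 := hb.le.trans hb.hi_le
  have hJK : (0 : ℝ) ≤ (J : ℝ) / K := by positivity
  refine covBound_of_tree (M := M) (L := L) (m := frac b.1) (η := 1) (h := fun _ => 1) ?_ hm hm1
    (by positivity) one_pos (fun _ => le_rfl) hw₀ (fun d hd => (hdig d hd).1) ?_
  · rintro x ⟨a, ha, rfl⟩ k
    exact (ha.bdd _).1
  rintro u - ⟨x₀, hx₀, hpx₀⟩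
  set w := w₀ ++ u with hw
  have hwne : w ≠ [] := by simp [hw, hw₀]
  have hdw : ∀ d ∈ w, 1 ≤ d ∧ d ≤ M := by
    obtain ⟨a, ha, rfl⟩ := hx₀
    exact hpx₀.forall_mem fun k => ha.bdd _
  obtain ⟨w', c, hwc⟩ : ∃ w' c, w = w' ++ [c] :=
    ⟨_, _, (List.dropLast_append_getLast hwne).symm⟩
  set n : ℤ := ((w.length : ℕ) : ℤ) with hn
  have hNn : (N : ℤ) ≤ n := by rw [hn, hw, List.length_append]; push_cast; omega
  have hn1 : n = w'.length + 1 := by rw [hn, hwc]; simp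
  have hc : ∀ a : ℤ → ℕ, (Pre w fun k : ℕ => a (1 + k)) → a n = c := by
    intro a ha
    rw [hwc, pre_append] at ha
    have h1 := ha.2.1
    simp only [zero_add] at h1
    rw [← h1, hn1]; congr 1; ring
  have hagr : ∀ a a' : ℤ → ℕ, (Pre w fun k : ℕ => a (1 + k)) → (Pre w fun k : ℕ => a' (1 + k)) →
      ∀ i : ℤ, 0 < i → i ≤ n → a' i = a i := by
    intro a a' ha ha' i h1 h2
    have := ha'.eq_of_pre ha (k := (i - 1).toNat) (by omega)
    beta_reduce at this
    rwa [show (1 : ℤ) + ((i - 1).toNat : ℤ) = i by omega] at this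
  have hfut : ∀ a : ℤ → ℕ, ∀ v, (Pre w fun k : ℕ => a (1 + k)) →
      (Pre v fun k : ℕ => a (n + 1 + k)) → Pre (w ++ v) fun k : ℕ => a (1 + k) := by
    intro a v h1 h2
    rw [pre_append]
    refine ⟨h1, ?_⟩
    convert h2 using 3
    rw [hn]; push_cast; ring
  have e2 : 2 * ((J : ℝ) / K / 2) = (J : ℝ) / K := by ring
  rw [e2]
  -- the set of next digits
  set Q : Set ℕ := {d | ∃ a, Mem M t₂ T N p a ∧ (Pre w fun k : ℕ => a (1 + k)) ∧ a (n + 1) = d}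
    with hQ
  have hQM : ∀ d ∈ Q, 1 ≤ d ∧ d ≤ M := by rintro d ⟨a, ha, -, rfl⟩; exact ha.bdd _
  obtain ⟨a₀, ha₀, rfl⟩ := hx₀
  have hQne : Q.Nonempty := ⟨_, a₀, ha₀, hpx₀, rfl⟩
  have hQfin : Q.Finite := (Set.finite_Icc 1 M).subset fun d hd => hQM d hd
  obtain ⟨d, hdQ, hdmax⟩ := hQfin.exists_maximal hQne
  obtain ⟨e, heQ, hemin⟩ := hQfin.exists_minimal hQne
  have hmax : ∀ f ∈ Q, f ≤ d := fun f hf => by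
    rcases le_total f d with h | h
    exacts [h, hdmax hf h]
  have hmin : ∀ f ∈ Q, e ≤ f := fun f hf => by
    rcases le_total e f with h | h
    exacts [h, hemin hf h]
  have hcM : 1 ≤ c ∧ c ≤ M := hdw c (by simp [hwc])
  have hLw : ∀ v : List ℕ, v = [d] → v ≠ [] ∧ v.length ≤ L ∧ ∀ e ∈ v, 1 ≤ e ∧ e ≤ M := by
    rintro v rfl
    exact ⟨by simp, by simpa using hL, by simpa using hQM d hdQ⟩
  rcases (hmin d hdQ).eq_or_lt with hed | hed
  · refine ⟨[[d]], by simpa using ⟨hL, hQM d hdQ⟩, ?_, ?_⟩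
    · rintro x ⟨a, ha, rfl⟩ hpa
      refine ⟨[d], by simp, hfut a _ hpa ⟨?_, trivial⟩⟩
      have hm1 : a (n + 1) ∈ Q := ⟨a, ha, hpa, rfl⟩
      have h1 := hmax _ hm1
      have h2 := hmin _ hm1
      simp only [Nat.cast_zero, add_zero]
      omega
    · simpa using wt_snoc_le hm hm1 hJK (fun d hd => (hdw d hd).1) (hQM d hdQ).1
  · obtain ⟨aD, haD, hpD, hdD⟩ := hdQ
    obtain ⟨aE, haE, hpE, hdE⟩ := heQ
    rw [certsOK, Bool.and_eq_true, List.all_eq_true, List.all_eq_true] at hC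
    obtain ⟨hCall, hCex⟩ := hC
    have h1 := List.all_eq_true.1 (List.all_eq_true.1 (hCex c (mem_digs.2 hcM)) d
      (mem_digs.2 (hdD ▸ haD.bdd _))) e (mem_digs.2 (hdE ▸ haE.bdd _))
    rw [Bool.or_eq_true, Nat.ble_eq] at h1
    replace h1 := h1.resolve_left (by omega)
    obtain ⟨k, hkC, hk⟩ := List.any_eq_true.1 h1
    simp only [Bool.and_eq_true, Nat.beq_eq] at hk
    obtain ⟨⟨rfl, rfl⟩, rfl⟩ := hk
    have hk := hCall k hkC
    rw [certOK, Bool.or_eq_true] at hk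
    rcases hk with hk | hk
    · exfalso
      obtain ⟨g, -, hg⟩ := List.any_eq_true.1 hk
      simp only [Bool.and_eq_true, Nat.ble_eq, List.all_eq_true] at hg
      obtain ⟨⟨⟨hg1, hg2⟩, hg3⟩, hg4⟩ := hg
      cases g with
      | nil => simp at hg3
      | cons f g =>
        rw [← hc aD hpD] at hg1
        refine haD.false_of_mid P hT haE hNn (hagr aD aE hpD hpE) hg2 ?_ ?_ hg1
        · rw [hdD]; simpa using hg4
        · rw [hdE]; simpa using hg3
    · rw [Bool.and_eq_true, Bool.and_eq_true, Bool.and_eq_true, Bool.and_eq_true] at hk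
      obtain ⟨⟨⟨⟨hGD, hGE⟩, hcD⟩, hcE⟩, hrest⟩ := hk
      have coverD : ∀ a : ℤ → ℕ, Mem M t₂ T N p a → (Pre w fun k : ℕ => a (1 + k)) →
          a (n + 1) = k.d → ∃ v ∈ k.VD.map Prod.fst, Pre v fun k : ℕ => a (n + 1 + k) := by
        intro a ha hpa had
        rw [← hc a hpa] at hcD
        exact coverZ_spec P hT ha haE hNn (hagr a aE hpa hpE) had (by rw [hdE]; exact hed) hGD L _
          hcD ⟨by simpa using had, trivial⟩
      have coverE : ∀ a : ℤ → ℕ, Mem M t₂ T N p a → (Pre w fun k : ℕ => a (1 + k)) →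
          a (n + 1) = k.e → ∃ v ∈ k.VE.map Prod.fst, Pre v fun k : ℕ => a (n + 1 + k) := by
        intro a ha hpa had
        rw [← hc a hpa] at hcE
        exact coverZ_spec P hT ha haD hNn (hagr a aD hpa hpD) had (by rw [hdD]; exact hed) hGE L _
          hcE ⟨by simpa using had, trivial⟩
      have hVD : k.VD.isEmpty = false := by
        obtain ⟨v, hv, -⟩ := coverD aD haD hpD hdD
        cases h : k.VD with
        | nil => simp [h] at hv
        | cons => rfl
      have hVE : k.VE.isEmpty = false := by
        obtain ⟨v, hv, -⟩ := coverE aE haE hpE hdE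
        cases h : k.VE with
        | nil => simp [h] at hv
        | cons => rfl
      rw [hVD, hVE, Bool.false_or, Bool.false_or, Bool.and_eq_true, Bool.and_eq_true,
        Bool.and_eq_true] at hrest
      obtain ⟨⟨⟨hde, hlD⟩, hlE⟩, hsum⟩ := hrest
      have hde := Nat.eq_of_beq_eq_true hde
      have hsum := Nat.le_of_ble_eq_true hsum
      have hlist : ∀ v ∈ k.VD ++ k.VE, v.1 ≠ [] ∧ v.1.length ≤ L ∧
          (∀ d ∈ v.1, 1 ≤ d ∧ d ≤ M) ∧ wtOK b J K D k.c v.1 v.2 = true := by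
        intro v hv
        rcases List.mem_append.1 hv with h | h
        exacts [listOK_spec hlD v h, listOK_spec hlE v h]
      refine ⟨(k.VD ++ k.VE).map Prod.fst, ?_, ?_, ?_⟩
      · intro v hv
        obtain ⟨v', hv', rfl⟩ := List.mem_map.1 hv
        exact ⟨(hlist v' hv').1, (hlist v' hv').2.1, (hlist v' hv').2.2.1⟩
      · rintro x ⟨a, ha, rfl⟩ hpa
        have hm1 : a (n + 1) ∈ Q := ⟨a, ha, hpa, rfl⟩
        have h1 := hmax _ hm1
        have h2 := hmin _ hm1
        rcases (show a (n + 1) = k.d ∨ a (n + 1) = k.e by omega) with h | h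
        · obtain ⟨v, hv, hpv⟩ := coverD a ha hpa h
          exact ⟨v, by rw [List.map_append]; exact List.mem_append_left _ hv, hfut a v hpa hpv⟩
        · obtain ⟨v, hv, hpv⟩ := coverE a ha hpa h
          exact ⟨v, by rw [List.map_append]; exact List.mem_append_right _ hv, hfut a v hpa hpv⟩
      · have := sum_wt_le hb hJ hK hD (H := fun _ => 1) (V := k.VD ++ k.VE)
          (fun v hv => ⟨(hlist v hv).1, (hlist v hv).2.2⟩) (by rw [sumH_append]; simpa using hsum)
          (w := w') (by rw [← hwc]; exact hdw)
        rw [← hwc] at this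
        simpa using this

/-- Verification of a subadditive potential `H` on the sequences of height at most `t₂`. -/
def sigOK (M : ℕ) (b : (ℕ × ℕ) × (ℕ × ℕ)) (t₂ : ℕ × ℕ) (J K D : ℕ) (H : List ℕ)
    (W : List (List ℕ)) : Bool :=
  (digs M).all fun c =>
    let V := ((digs M).filter fun f => !badZ b t₂ [] [c, f]).map
      fun f => ([f], (W.getD c []).getD f 0)
    Nat.ble (sumH (fun d => H.getD d 1) V) (D * H.getD c 1) &&
      V.all fun v => wtOK b J K D c v.1 v.2

/-- The futures of bounded sequences of height at most `t₂`. -/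
def futuresLE (M : ℕ) (t₂ : ℕ × ℕ) : Set (ℕ → ℕ) :=
  {x | ∃ a, Bdd M a ∧ (∀ i, lam a i ≤ frac t₂) ∧ x = fun k : ℕ => a (1 + k)}

theorem covBound_futuresLE (P : Params M b t₁ t₂) {J K D : ℕ} (hJ : 0 < J)
    (hK : 0 < K) (hD : 0 < D) {H : List ℕ} {W : List (List ℕ)}
    (hH : (H.all fun n => Nat.ble 1 n) = true)
    (hW : sigOK M b t₂ J K D H W = true) {w₀ : List ℕ}
    (hw₀ : w₀ ≠ []) (hdig : ∀ d ∈ w₀, 1 ≤ d ∧ d ≤ M) :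
    CovBound (cfv '' {x | x ∈ futuresLE M t₂ ∧ Pre w₀ x}) ((J : ℝ) / K / 2) := by
  have hb := P.base
  have hm := frac_nonneg b.1
  have hm1 := hb.le.trans hb.hi_le
  have hH1 : ∀ d, (1 : ℝ) ≤ (H.getD d 1 : ℕ) := by
    intro d
    rcases lt_or_ge d H.length with h | h
    · rw [List.getD_eq_getElem _ _ h]
      exact_mod_cast Nat.le_of_ble_eq_true (List.all_eq_true.1 hH _ (List.getElem_mem h))
    · rw [List.getD_eq_default _ _ h]; simp
  refine covBound_of_tree (M := M) (L := 1) (m := frac b.1) (η := 1)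
    (h := fun d => (H.getD d 1 : ℕ)) ?_ hm hm1
    (by positivity) one_pos hH1 hw₀ (fun d hd => (hdig d hd).1) ?_
  · rintro x ⟨a, ha, -, rfl⟩ k
    exact (ha _).1
  rintro u - ⟨x₀, hx₀, hpx₀⟩
  set w := w₀ ++ u with hw
  have hwne : w ≠ [] := by simp [hw, hw₀]
  have hdw : ∀ d ∈ w, 1 ≤ d ∧ d ≤ M := by
    obtain ⟨a, ha, -, rfl⟩ := hx₀
    exact hpx₀.forall_mem fun k => ha _
  obtain ⟨w', c, hwc⟩ : ∃ w' c, w = w' ++ [c] :=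
    ⟨_, _, (List.dropLast_append_getLast hwne).symm⟩
  have hcM : 1 ≤ c ∧ c ≤ M := hdw c (by simp [hwc])
  have e2 : 2 * ((J : ℝ) / K / 2) = (J : ℝ) / K := by ring
  rw [e2]
  have hWc := List.all_eq_true.1 hW c (mem_digs.2 hcM)
  simp only [Bool.and_eq_true, Nat.ble_eq] at hWc
  set V := ((digs M).filter fun f => !badZ b t₂ [] [c, f]).map
      fun f => ([f], (W.getD c []).getD f 0) with hV
  have hVw := List.all_eq_true.1 hWc.2
  have hVd : ∀ v ∈ V, ∃ f, v.1 = [f] ∧ 1 ≤ f ∧ f ≤ M := by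
    intro v hv
    obtain ⟨f, hf, rfl⟩ := List.mem_map.1 hv
    exact ⟨f, rfl, mem_digs.1 (List.mem_of_mem_filter hf)⟩
  have hVd' : ∀ v ∈ V, v.1 ≠ [] ∧ (∀ d ∈ v.1, 1 ≤ d ∧ d ≤ M) := by
    intro v hv
    obtain ⟨f, h1, h2⟩ := hVd v hv
    rw [h1]
    exact ⟨by simp, by simpa using h2⟩
  refine ⟨V.map Prod.fst, ?_, ?_, ?_⟩
  · intro v hv
    obtain ⟨v', hv', rfl⟩ := List.mem_map.1 hv
    obtain ⟨f, h1, h2⟩ := hVd v' hv'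
    rw [h1]
    exact ⟨by simp, by simp, by simpa using h2⟩
  · rintro x ⟨a, ha, hlam, rfl⟩ hpa
    have hlen : w.length = w'.length + 1 := by rw [hwc]; simp
    refine ⟨[a (1 + w.length)], ?_, ?_⟩
    · rw [List.mem_map]
      refine ⟨([a (1 + w.length)], (W.getD c []).getD (a (1 + w.length)) 0), ?_, rfl⟩
      rw [hV, List.mem_map]
      refine ⟨_, List.mem_filter.2 ⟨mem_digs.2 (ha _), ?_⟩, rfl⟩
      rw [Bool.not_eq_true', Bool.eq_false_iff]
      intro hbad
      have hat : At a (w.length : ℤ) [] [c, a (1 + w.length)] := by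
        refine ⟨trivial, ?_, ?_, trivial⟩
        · rw [hwc, pre_append] at hpa
          have := hpa.2.1
          simp only [zero_add] at this
          rw [← this, hlen]; congr 1; push_cast; ring
        · congr 1; push_cast; ring
      obtain ⟨j, hj⟩ := exists_lt_lam_of_badZ hb P.pos₂ ha hat hbad
      exact hj.not_ge (hlam j)
    · rw [pre_append]
      refine ⟨hpa, by simp, trivial⟩
  · have := sum_wt_le hb hJ hK hD (H := fun d => H.getD d 1) (V := V)
      (fun v hv => ⟨(hVd' v hv).1, (hVd' v hv).2, hVw v hv⟩) hWc.1
      (w := w') (by rw [← hwc]; exact hdw)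
    rw [← hwc] at this
    exact this

end

theorem NoExt.mono {a : ℤ → ℕ} {s s' : ℝ} {N : ℕ} (h : NoExt a s N) (hs : s' ≤ s) : NoExt a s' N :=
  fun b hb => (h b hb).imp fun _ hi => hs.trans_lt hi

theorem exists_max_digit {a : ℤ → ℕ} (ha : BiPos a) {t : ℝ} (h : ∀ i, lam a i ≤ t) :
    ∃ i, ∀ j, a j ≤ a i := by
  have hfin : (Set.range a).Finite := by
    refine (Set.finite_Iic ⌊t⌋₊).subset ?_
    rintro _ ⟨i, rfl⟩
    refine Nat.le_floor ?_
    have := h i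
    unfold lam at this
    linarith [fwd_pos ha i, bwd_pos ha i]
  obtain ⟨d, ⟨i, rfl⟩, hd⟩ := hfin.exists_maximal ⟨a 0, 0, rfl⟩
  refine ⟨i, fun j => ?_⟩
  rcases le_total (a j) (a i) with h | h
  exacts [h, hd ⟨j, rfl⟩ h]

theorem max_digit_bound {a : ℤ → ℕ} (ha : BiPos a) {i : ℤ} (hi : ∀ j, a j ≤ a i) :
    (a i : ℝ) + 2 / (a i + 1) < lam a i := by
  have h1 : (a (i + 1) : ℝ) ≤ a i := by exact_mod_cast hi _
  have h2 : (a (i - 1) : ℝ) ≤ a i := by exact_mod_cast hi _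
  have p1 : (1 : ℝ) ≤ a (i + 1) := by exact_mod_cast ha _
  have p2 : (1 : ℝ) ≤ a (i - 1) := by exact_mod_cast ha _
  have q1 := fwd_lt_one ha (i + 1)
  have q2 := bwd_lt_one ha (i - 1)
  have q3 := fwd_pos ha (i + 1)
  have q4 := bwd_pos ha (i - 1)
  have g1 : 1 / ((a i : ℝ) + 1) < fwd a i := by
    rw [fwd_rec ha]; exact one_div_lt_one_div_of_lt (by linarith) (by linarith)
  have g2 : 1 / ((a i : ℝ) + 1) < bwd a i := by
    rw [bwd_rec ha]; exact one_div_lt_one_div_of_lt (by linarith) (by linarith)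
  have : 2 / ((a i : ℝ) + 1) = 1 / ((a i : ℝ) + 1) + 1 / ((a i : ℝ) + 1) := by ring
  unfold lam
  linarith

theorem bdd_of_lam_le {a : ℤ → ℕ} (ha : BiPos a) {t : ℝ} (h : ∀ i, lam a i ≤ t) {M : ℕ}
    (hM : t ≤ M + 1 + 2 / (M + 2)) : Bdd M a := by
  obtain ⟨i, hi⟩ := exists_max_digit ha h
  refine fun j => ⟨ha j, (hi j).trans ?_⟩
  by_contra! hc
  have hc' : (M : ℝ) + 1 ≤ a i := by exact_mod_cast hc
  have h1 := max_digit_bound ha hi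
  have hM0 : (0 : ℝ) ≤ M := Nat.cast_nonneg _
  have h2 : (M : ℝ) + 1 + 2 / (M + 2) ≤ a i + 2 / (a i + 1) := by
    rw [← sub_nonneg, show (a i : ℝ) + 2 / (a i + 1) - (M + 1 + 2 / (M + 2)) =
      (a i - (M + 1)) * ((M + 2) * (a i + 1) - 2) / ((M + 2) * (a i + 1)) by field_simp; ring]
    refine div_nonneg (mul_nonneg (by linarith) ?_) (by positivity)
    nlinarith
  linarith [h i]

theorem dimH_region {M : ℕ} {b : (ℕ × ℕ) × (ℕ × ℕ)} {t₁ t₂ : ℕ × ℕ} (P : Params M b t₁ t₂)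
    (hM : frac t₂ ≤ M + 1 + 2 / (M + 2)) {L J K D J' K' D' : ℕ} (hJ : 0 < J) (hK : 0 < K)
    (hD : 0 < D) (hL : 1 ≤ L) {C : List Cert} (hC : certsOK M L b t₁ t₂ J K D C = true)
    (hJ' : 0 < J') (hK' : 0 < K') (hD' : 0 < D') {H : List ℕ} {W : List (List ℕ)}
    (hH : (H.all fun n => Nat.ble 1 n) = true) (hW : sigOK M b t₂ J' K' D' H W = true) :
    dimH ((MarkovSpectrum \ LagrangeSpectrum) ∩ Set.Ico (frac t₁) (frac t₂)) ≤
      ENNReal.ofReal ((J : ℝ) / K / 2 + (J' : ℝ) / K' / 2) := by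
  set E : ℕ × ℤ × List ℕ × List ℕ × ℕ → Set ℝ := fun q =>
    {t | ((frac t₁ ≤ (q.2.1 : ℝ) / 2 ^ q.1) ∧ q.1 ≤ q.2.2.2.1.length ∧ q.2.2.2.1 ≠ [] ∧
      (∀ d ∈ q.2.2.2.1, 1 ≤ d ∧ d ≤ M) ∧ 1 ≤ q.2.2.2.2 ∧ q.2.2.2.2 ≤ M) ∧
      t ∈ {t | ∃ x ∈ cfv '' {x | x ∈ futures M t₂ ((q.2.1 : ℝ) / 2 ^ q.1) q.1
        (fun k => q.2.2.1.getD k 0) ∧ Pre q.2.2.2.1 x},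
        ∃ y ∈ cfv '' {x | x ∈ futuresLE M t₂ ∧ Pre [q.2.2.2.2] x},
        t = (q.2.2.1.getD 0 0 : ℕ) + x + y}} with hE
  have hcov : (MarkovSpectrum \ LagrangeSpectrum) ∩ Set.Ico (frac t₁) (frac t₂) ⊆ ⋃ q, E q := by
    rintro t ⟨⟨htM, htL⟩, ht1, ht2⟩
    obtain ⟨a, ha⟩ := exists_mark_of_mem htM
    obtain ⟨ε, hε, N₀, hN₀⟩ := exists_noExt_of_not_mem_lagrange ha htL
    obtain ⟨m, hm⟩ : ∃ m : ℕ, (1 / 2 : ℝ) ^ m < ε / 5 :=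
      exists_pow_lt_of_lt_one (by positivity) (by norm_num)
    set N := max N₀ m + 1 with hN
    have hNε : (1 / 2 : ℝ) ^ N < ε / 5 :=
      (pow_le_pow_of_le_one (by norm_num) (by norm_num) (by omega)).trans_lt hm
    obtain ⟨a, ha, hno⟩ : ∃ a, Mark a t ∧ NoExt a (t + ε) N := by
      rcases hN₀ N (by omega) with h | h
      exacts [⟨a, ha, h⟩, ⟨rev a, ha.rev, h⟩]
    have hbdd : Bdd M a := bdd_of_lam_le ha.1 ha.2.1 (ht2.le.trans hM)
    set z : ℤ := ⌊t * 2 ^ N⌋ + 1 with hz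
    have h2N : (0 : ℝ) < 2 ^ N := by positivity
    have hzt : t < z / 2 ^ N := by
      rw [lt_div_iff₀ h2N, hz]; push_cast; exact Int.lt_floor_add_one _
    have hzt' : (z : ℝ) / 2 ^ N ≤ t + (1 / 2) ^ N := by
      rw [div_le_iff₀ h2N, hz, add_mul, one_div, inv_pow, inv_mul_cancel₀ h2N.ne']
      push_cast
      linarith [Int.floor_le (t * 2 ^ N)]
    rw [Set.mem_iUnion]
    refine ⟨(N, z, List.ofFn (fun i : Fin (N + 1) => a (-(i : ℕ))),
      List.ofFn (fun i : Fin N => a (1 + (i : ℕ))), a (-1)), ⟨?_, ?_, ?_, ?_, ?_⟩, ?_⟩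
    · exact ht1.trans hzt.le
    · exact List.length_ofFn.ge
    · exact List.ne_nil_of_length_pos (by rw [List.length_ofFn]; omega)
    · intro d hd
      obtain ⟨i, rfl⟩ := (List.mem_ofFn' _ _).1 hd
      exact hbdd _
    · exact hbdd _
    · refine ⟨_, ⟨fun k : ℕ => a (1 + k), ⟨⟨a, ⟨hbdd, fun i => (ha.2.1 i).trans hzt.le,
        fun i => (ha.2.1 i).trans ht2.le, hno.mono (by linarith), ?_⟩, rfl⟩,
        pre_ofFn (fun k : ℕ => a (1 + k)) N⟩, rfl⟩, _,
        ⟨fun k : ℕ => rev a (1 + k), ⟨⟨rev a, fun i => hbdd _, fun i => ?_, rfl⟩, ?_, trivial⟩, rfl⟩,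
        ?_⟩
      · intro k hk
        simp only
        rw [List.getD_eq_getElem _ _ (by simp; omega), List.getElem_ofFn]
      · rw [lam_rev]; exact (ha.2.1 _).trans ht2.le
      · simp [rev]
      · rw [← ha.2.2]
        unfold lam fwd bwd
        simp only [rev]
        congr 2
        · simp
        · funext k; congr 1; ring
  refine (dimH_mono hcov).trans ?_
  rw [dimH_iUnion]
  refine iSup_le fun q => ?_
  obtain ⟨N, z, pl, w, c⟩ := q
  by_cases hq : (frac t₁ ≤ (z : ℝ) / 2 ^ N) ∧ N ≤ w.length ∧ w ≠ [] ∧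
      (∀ d ∈ w, 1 ≤ d ∧ d ≤ M) ∧ 1 ≤ c ∧ c ≤ M
  · obtain ⟨g1, g2, g3, g4, g5⟩ := hq
    have c1 := covBound_futures (p := fun k => pl.getD k 0) P g1 hJ hK hD hL hC g3 g2 g4
    have c2 := covBound_futuresLE P hJ' hK' hD' hH hW (w₀ := [c]) (by simp) (by simpa using g5)
    refine (dimH_mono fun t ht => ht.2).trans
      ((c1.add (k := ((pl.getD 0 0 : ℕ) : ℝ)) c2 (by positivity) (by positivity)).dimH_le
        (by positivity))
  · have : E (N, z, pl, w, c) = ∅ := by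
      ext t
      simp only [hE, Set.mem_setOf_eq, Set.mem_empty_iff_false, iff_false]
      exact fun h => hq h.1
    rw [this, dimH_empty]
    exact zero_le

theorem isBase_two : IsBase 2 ((3659, 10000), (7322, 10000)) := by
  constructor <;> norm_num [frac]

theorem isBase_three : IsBase 3 ((2636, 10000), (7914, 10000)) := by
  constructor <;> norm_num [frac]

theorem isBase_four : IsBase 4 ((2070, 10000), (8286, 10000)) := by
  constructor <;> norm_num [frac]

theorem isBase_five : IsBase 5 ((1707, 10000), (8543, 10000)) := by
  constructor <;> norm_num [frac]

/-- Continuations for heights in the one region. -/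
def certs_one : List Cert := [
  ⟨1, 2, 1, [], [([2,1,1,1,1], 12200), ([2,1,1,2], 13061), ([2,2], 26527)], [[2,1,1,1,1]], [([1,1,1,1], 23204), ([1,1,2], 24918)], [[1,1,1,1]]⟩,
  ⟨2, 2, 1, [], [([2,1,1,1,1], 11987), ([2,1,1,2], 12842), ([2,2], 26203)], [[2,1,1,1,1]], [([1,1,1,1], 23476), ([1,1,2], 25131)], [[1,1,1,1]]⟩]

theorem dimH_region_one : dimH ((MarkovSpectrum \ LagrangeSpectrum) ∩ Set.Ico (133/50) (7/2)) ≤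
    ENNReal.ofReal (493 / 500) := by
  have P : Params 2 ((3659, 10000), (7322, 10000)) (266, 100) (35, 10) :=
    ⟨isBase_two, by norm_num, by norm_num, by norm_num [frac, onesI]⟩
  have h := dimH_region P (by norm_num [frac]) (L := 5) (J := 76) (K := 100) (D := 100000)
    (by norm_num) (by norm_num) (by norm_num) (by norm_num) (C := certs_one) (by decide +kernel)
    (J' := 108) (K' := 100) (D' := 100000) (by norm_num) (by norm_num) (by norm_num)
    (H := [1, 9941, 10000])
    (W := [[], [0, 59710, 39452], [0, 61128, 38627]])
    (by decide +kernel) (by decide +kernel)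
  norm_num [frac] at h
  exact h.trans (ENNReal.ofReal_le_ofReal (by norm_num))

/-- Continuations for heights in the two region. -/
def certs_two : List Cert := [
  ⟨1, 2, 1, [], [([2,2,1,2], 19073), ([2,3], 33174)], [[2,2,1,2]], [([1,1,2,1], 29113), ([1,1,3,3], 16780)], [[1,1,2,1]]⟩,
  ⟨1, 3, 1, [[2]], [], [], [], []⟩,
  ⟨1, 3, 2, [], [([3,3], 28498)], [], [([2,1,2], 30919)], [[2,1,2,2]]⟩,
  ⟨2, 2, 1, [], [([2,2,1,2], 18903), ([2,3], 32938)], [[2,2,1,2]], [([1,1,2,1], 29274), ([1,1,3,3], 16858)], [[1,1,2,1]]⟩,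
  ⟨2, 3, 1, [[2]], [], [], [], []⟩,
  ⟨2, 3, 2, [], [([3,2,1,2], 16037), ([3,3], 27826)], [[3,2,1,2]], [([2,1,2,1], 23797)], [[2,1,2,1]]⟩,
  ⟨3, 2, 1, [], [([2,2,1,2], 18825), ([2,3], 32830)], [[2,2,1,2]], [([1,1,2,1], 29360), ([1,1,3,3], 16900)], [[1,1,2,1]]⟩,
  ⟨3, 3, 1, [[2]], [], [], [], []⟩,
  ⟨3, 3, 2, [], [([3,2,1,2], 15858), ([3,3], 27526)], [[3,2,1,2]], [([2,1,2,1], 23625)], [[2,1,2,1]]⟩]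

theorem dimH_region_two : dimH ((MarkovSpectrum \ LagrangeSpectrum) ∩ Set.Ico (7/2) (39/10)) ≤
    ENNReal.ofReal (493 / 500) := by
  have P : Params 3 ((2636, 10000), (7914, 10000)) (35, 10) (39, 10) :=
    ⟨isBase_three, by norm_num, by norm_num, by norm_num [frac, onesI]⟩
  have h := dimH_region P (by norm_num [frac]) (L := 4) (J := 54) (K := 100) (D := 100000)
    (by norm_num) (by norm_num) (by norm_num) (by norm_num) (C := certs_two) (by decide +kernel)
    (J' := 143) (K' := 100) (D' := 100000) (by norm_num) (by norm_num) (by norm_num)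
    (H := [1, 10000, 9930, 9918])
    (W := [[], [0, 50651, 29323, 20065], [0, 52181, 28434, 18712], [0, 53031, 28034, 18130]])
    (by decide +kernel) (by decide +kernel)
  norm_num [frac] at h
  exact h.trans (ENNReal.ofReal_le_ofReal (by norm_num))

/-- Continuations for heights in the three region. -/
def certs_three : List Cert := [
  ⟨1, 2, 1, [], [([2,3], 36743)], [[2,3,2]], [([1,1], 62506)], [[1,1]]⟩,
  ⟨1, 3, 1, [[2]], [], [], [], []⟩,
  ⟨1, 3, 2, [], [([3,3,1], 25691)], [[3,3,1]], [([2,1], 52558)], [[2,1]]⟩,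
  ⟨2, 2, 1, [], [([2,3], 36506)], [[2,3,2]], [([1,1,3], 35768)], [[1,1,3,3]]⟩,
  ⟨2, 3, 1, [[2]], [], [], [], []⟩,
  ⟨2, 3, 2, [], [([3,3,1], 25145)], [[3,3,1,1,2]], [([2,1], 51861)], [[2,1]]⟩,
  ⟨3, 2, 1, [], [([2,3], 36396)], [[2,3,2]], [([1,1,3], 35844)], [[1,1,3,3]]⟩,
  ⟨3, 3, 1, [[2]], [], [], [], []⟩,
  ⟨3, 3, 2, [], [([3,3,1], 24901)], [[3,3,1,1,2]], [([2,1], 51545)], [[2,1]]⟩]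

theorem dimH_region_three : dimH ((MarkovSpectrum \ LagrangeSpectrum) ∩ Set.Ico (39/10) (22/5)) ≤
    ENNReal.ofReal (493 / 500) := by
  have P : Params 3 ((2636, 10000), (7914, 10000)) (39, 10) (44, 10) :=
    ⟨isBase_three, by norm_num, by norm_num, by norm_num [frac, onesI]⟩
  have h := dimH_region P (by norm_num [frac]) (L := 4) (J := 49) (K := 100) (D := 100000)
    (by norm_num) (by norm_num) (by norm_num) (by norm_num) (C := certs_three) (by decide +kernel)
    (J' := 143) (K' := 100) (D' := 100000) (by norm_num) (by norm_num) (by norm_num)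
    (H := [1, 10000, 9930, 9918])
    (W := [[], [0, 50651, 29323, 20065], [0, 52181, 28434, 18712], [0, 53031, 28034, 18130]])
    (by decide +kernel) (by decide +kernel)
  norm_num [frac] at h
  exact h.trans (ENNReal.ofReal_le_ofReal (by norm_num))

/-- Continuations for heights in the four region. -/
def certs_four : List Cert := [
  ⟨1, 2, 1, [], [([2,3,1,3,1], 20532), ([2,4], 41214)], [[2,3,1,3,1]], [([1,1,3,1], 36974)], [[1,1,3,1]]⟩,
  ⟨1, 3, 1, [[2]], [], [], [], []⟩,
  ⟨1, 3, 2, [], [([3,3,1,3,1], 18406), ([3,4], 36900)], [[3,3,1,3,1]], [([2,1,3,1], 32471)], [[2,1,3,1]]⟩,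
  ⟨1, 4, 1, [[2]], [], [], [], []⟩,
  ⟨1, 4, 2, [[3,1,1,3]], [], [], [], []⟩,
  ⟨1, 4, 3, [], [], [], [([3], 0)], []⟩,
  ⟨2, 2, 1, [], [([2,3,1,3,1], 20428), ([2,4], 41036)], [[2,3,1,3,1]], [([1,1,3,1,3], 23918)], [[1,1,3,1,3,1,1,2]]⟩,
  ⟨2, 3, 1, [[2]], [], [], [], []⟩,
  ⟨2, 3, 2, [], [([3,3,1,3,1], 18078), ([3,4], 36256)], [[3,3,1,3,1]], [([2,1,3,1], 32059)], [[2,1,3,1]]⟩,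
  ⟨2, 4, 1, [[2]], [], [], [], []⟩,
  ⟨2, 4, 2, [[3]], [], [], [], []⟩,
  ⟨2, 4, 3, [], [([4,3,1,3,1], 16474), ([4,4], 33008)], [[4,3,1,3,1]], [([3,1,3,1], 28866)], [[3,1,3,1]]⟩,
  ⟨3, 2, 1, [], [([2,3,1,3,1], 20381), ([2,4], 40955)], [[2,3,1,3,1]], [([1,1,3,1,3], 23956)], [[1,1,3,1,3]]⟩,
  ⟨3, 3, 1, [[2]], [], [], [], []⟩,
  ⟨3, 3, 2, [], [([3,3,1,3,1], 17933), ([3,4], 35972)], [[3,3,1,3,1]], [([2,1,3,1], 31876)], [[2,1,3,1]]⟩,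
  ⟨3, 4, 1, [[2]], [], [], [], []⟩,
  ⟨3, 4, 2, [[3]], [], [], [], []⟩,
  ⟨3, 4, 3, [], [([4,3,1,3,1], 16289), ([4,4], 32641)], [[4,3,1,3,1]], [([3,1,3,1], 28581)], [[3,1,3,1]]⟩,
  ⟨4, 2, 1, [], [([2], 0)], [], [], []⟩,
  ⟨4, 3, 1, [[2]], [], [], [], []⟩,
  ⟨4, 3, 2, [], [([3,3,1,3,1], 17852), ([3,4], 35813)], [[3,3,1,3,1]], [([2,1,3,1], 31772)], [[2,1,3,1]]⟩,
  ⟨4, 4, 1, [[2]], [], [], [], []⟩,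
  ⟨4, 4, 2, [[3]], [], [], [], []⟩,
  ⟨4, 4, 3, [], [([4,3,1,3,1], 16186), ([4,4], 32437)], [[4,3,1,3,1]], [([3,1,3,1], 28422)], [[3,1,3,1]]⟩]

theorem dimH_region_four : dimH ((MarkovSpectrum \ LagrangeSpectrum) ∩ Set.Ico (22/5) (19/4)) ≤
    ENNReal.ofReal (493 / 500) := by
  have P : Params 4 ((2070, 10000), (8286, 10000)) (44, 10) (475, 100) :=
    ⟨isBase_four, by norm_num, by norm_num, by norm_num [frac, onesI]⟩
  have h := dimH_region P (by norm_num [frac]) (L := 5) (J := 39) (K := 100) (D := 100000)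
    (by norm_num) (by norm_num) (by norm_num) (by norm_num) (C := certs_four) (by decide +kernel)
    (J' := 148) (K' := 100) (D' := 100000) (by norm_num) (by norm_num) (by norm_num)
    (H := [1, 9461, 10000, 9952, 4943])
    (W := [[], [0, 49540, 28175, 19099, 0], [0, 51049, 27243, 17693, 12672], [0, 51893, 26831, 17103, 12115], [0, 0, 26599, 16778, 11813]])
    (by decide +kernel) (by decide +kernel)
  norm_num [frac] at h
  exact h.trans (ENNReal.ofReal_le_ofReal (by norm_num))

/-- Continuations for heights in the five region. -/
def certs_five : List Cert := [
  ⟨1, 2, 1, [], [([2,4], 45136)], [[2,4,3]], [([1,1,3,1,3], 27627)], [[1,1,3,1,3]]⟩,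
  ⟨1, 3, 1, [[2]], [], [], [], []⟩,
  ⟨1, 3, 2, [], [([3,4,2,4,3], 12005)], [[3,4,2,4,3]], [([2,1,3,1,3], 24594)], [[2,1,3,1,3]]⟩,
  ⟨1, 4, 1, [[2]], [], [], [], []⟩,
  ⟨1, 4, 2, [[3]], [], [], [], []⟩,
  ⟨1, 4, 3, [], [([4,4], 37835)], [], [([3,1,3,1,3], 22581)], [[3,1,3,1,3]]⟩,
  ⟨2, 2, 1, [], [([2,4,2,1], 27928), ([2,4,3,4,2], 13070)], [[2,4,3,4,2]], [([1,1,3,1,3], 27698), ([1,1,4,4], 26772)], [[1,1,3,1,3]]⟩,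
  ⟨2, 3, 1, [[2]], [], [], [], []⟩,
  ⟨2, 3, 2, [], [([3,4,2,4,3], 11816)], [[3,4,2,4,3]], [([2,1,3,1,3], 24312)], [[2,1,3,1,3]]⟩,
  ⟨2, 4, 1, [[2]], [], [], [], []⟩,
  ⟨2, 4, 2, [[3]], [], [], [], []⟩,
  ⟨2, 4, 3, [], [([4,4], 36982)], [[4,4,2]], [([3,1,3,1,3], 22130)], [[3,1,3,1,3]]⟩,
  ⟨3, 2, 1, [], [([2,4], 44882)], [[2,4,3]], [([1,1,3,1,3], 27737), ([1,1,4,4], 26806)], [[1,1,3,1,3]]⟩,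
  ⟨3, 3, 1, [[2]], [], [], [], []⟩,
  ⟨3, 3, 2, [], [([3,4,2], 29203)], [[3,4,2]], [([2,1,3,1,3], 24187)], [[2,1,3,1,3]]⟩,
  ⟨3, 4, 1, [[2]], [], [], [], []⟩,
  ⟨3, 4, 2, [[3]], [], [], [], []⟩,
  ⟨3, 4, 3, [], [([4,4], 36613)], [[4,4,2]], [([3,1,3,1,3], 21934)], [[3,1,3,1,3]]⟩,
  ⟨4, 2, 1, [], [([2,4,3], 29372)], [[2,4,3]], [([1,1,3,1,3], 27761), ([1,1,4,4], 26827)], [[1,1,3,1,3]]⟩,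
  ⟨4, 3, 1, [[2]], [], [], [], []⟩,
  ⟨4, 3, 2, [], [([3,4,2], 29087)], [[3,4,2]], [([2,1,3,1,3], 24116)], [[2,1,3,1,3]]⟩,
  ⟨4, 4, 1, [[2]], [], [], [], []⟩,
  ⟨4, 4, 2, [[3]], [], [], [], []⟩,
  ⟨4, 4, 3, [], [([4,4], 36407)], [[4,4,2]], [([3,1,3,1,3], 21824)], [[3,1,3,1,3]]⟩]

theorem dimH_region_five : dimH ((MarkovSpectrum \ LagrangeSpectrum) ∩ Set.Ico (19/4) (24/5)) ≤
    ENNReal.ofReal (493 / 500) := by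
  have P : Params 4 ((2070, 10000), (8286, 10000)) (475, 100) (48, 10) :=
    ⟨isBase_four, by norm_num, by norm_num, by norm_num [frac, onesI]⟩
  have h := dimH_region P (by norm_num [frac]) (L := 5) (J := 35) (K := 100) (D := 100000)
    (by norm_num) (by norm_num) (by norm_num) (by norm_num) (C := certs_five) (by decide +kernel)
    (J' := 160) (K' := 100) (D' := 100000) (by norm_num) (by norm_num) (by norm_num)
    (H := [1, 10000, 9813, 9756, 9733])
    (W := [[], [0, 46798, 25425, 16700, 11975], [0, 48340, 24517, 15375, 10718], [0, 49205, 24116, 14821, 10209], [0, 49757, 23891, 14517, 9935]])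
    (by decide +kernel) (by decide +kernel)
  norm_num [frac] at h
  exact h.trans (ENNReal.ofReal_le_ofReal (by norm_num))

/-- Continuations for heights in the six region. -/
def certs_six : List Cert := [
  ⟨1, 2, 1, [], [([2,4,2], 30966)], [[2,4,2]], [([1,1,3,1,3], 25669), ([1,1,4], 42324)], [[1,1,3,1,3]]⟩,
  ⟨1, 3, 1, [[2]], [], [], [], []⟩,
  ⟨1, 3, 2, [], [([3,4], 38835)], [[3,4,2]], [([2,1,3,1,3], 22699)], [[2,1,3,1,3]]⟩,
  ⟨1, 4, 1, [[2]], [], [], [], []⟩,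
  ⟨1, 4, 2, [[3]], [], [], [], []⟩,
  ⟨1, 4, 3, [], [([4,4,1], 30411)], [[4,4,1,1,3]], [([3,1,3,1,3], 20740)], [[3,1,3,1,3]]⟩,
  ⟨2, 2, 1, [], [([2,4,2], 30837)], [[2,4,2,1,2]], [([1,1,3,1,3], 25739), ([1,1,4], 42424)], [[1,1,3,1,3]]⟩,
  ⟨2, 3, 1, [[2]], [], [], [], []⟩,
  ⟨2, 3, 2, [], [([3,4], 38192)], [[3,4,2]], [([2,1,3,1,3], 22425)], [[2,1,3,1,3]]⟩,
  ⟨2, 4, 1, [[2]], [], [], [], []⟩,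
  ⟨2, 4, 2, [[3]], [], [], [], []⟩,
  ⟨2, 4, 3, [], [([4,4,1,1], 24700)], [[4,4,1,1,3]], [([3,1,3,1,3], 20303)], [[3,1,3,1,3]]⟩,
  ⟨3, 2, 1, [], [([2,4], 42873)], [[2,4,3]], [([1,1,4], 42478)], [[1,1,4,4,2]]⟩,
  ⟨3, 3, 1, [[2]], [], [], [], []⟩,
  ⟨3, 3, 2, [], [([3,4], 37909)], [[3,4,2]], [([2,1,3,1,3], 22303)], [[2,1,3,1,3]]⟩,
  ⟨3, 4, 1, [[2]], [], [], [], []⟩,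
  ⟨3, 4, 2, [[3]], [], [], [], []⟩,
  ⟨3, 4, 3, [], [([4,4,1,1], 24440)], [[4,4,1,1,3]], [([3,1,3,1,3], 20112)], [[3,1,3,1,3]]⟩,
  ⟨4, 2, 1, [], [([2,4], 42827)], [[2,4,3]], [([1,1,4,3], 27175), ([1,1,4,4,4], 14587)], [[1,1,4,4,4,1,1,3]]⟩,
  ⟨4, 3, 1, [[2]], [], [], [], []⟩,
  ⟨4, 3, 2, [], [([3,4], 37749)], [[3,4,2]], [([2,1,3,1,3], 22233), ([2,1,4,4,1], 18240)], [[2,1,3,1,3]]⟩,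
  ⟨4, 4, 1, [[2]], [], [], [], []⟩,
  ⟨4, 4, 2, [[3]], [], [], [], []⟩,
  ⟨4, 4, 3, [], [([4,4,1,1], 24295)], [[4,4,1,1,3]], [([3,1,3,1,3], 20006)], [[3,1,3,1,3]]⟩]

theorem dimH_region_six : dimH ((MarkovSpectrum \ LagrangeSpectrum) ∩ Set.Ico (24/5) (49/10)) ≤
    ENNReal.ofReal (493 / 500) := by
  have P : Params 4 ((2070, 10000), (8286, 10000)) (48, 10) (49, 10) :=
    ⟨isBase_four, by norm_num, by norm_num, by norm_num [frac, onesI]⟩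
  have h := dimH_region P (by norm_num [frac]) (L := 5) (J := 37) (K := 100) (D := 100000)
    (by norm_num) (by norm_num) (by norm_num) (by norm_num) (C := certs_six) (by decide +kernel)
    (J' := 160) (K' := 100) (D' := 100000) (by norm_num) (by norm_num) (by norm_num)
    (H := [1, 10000, 9813, 9756, 9733])
    (W := [[], [0, 46798, 25425, 16700, 11975], [0, 48340, 24517, 15375, 10718], [0, 49205, 24116, 14821, 10209], [0, 49757, 23891, 14517, 9935]])
    (by decide +kernel) (by decide +kernel)
  norm_num [frac] at h
  exact h.trans (ENNReal.ofReal_le_ofReal (by norm_num))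

/-- Continuations for heights in the seven region. -/
def certs_seven : List Cert := [
  ⟨1, 2, 1, [], [([2,4], 45136)], [[2,4,2]], [([1,1,4], 44338)], [[1,1,4,4]]⟩,
  ⟨1, 3, 1, [[2]], [], [], [], []⟩,
  ⟨1, 3, 2, [], [([3,4,1], 35040)], [[3,4,1,1,1,1,1,1]], [([2,1], 63218)], [[2,1]]⟩,
  ⟨1, 4, 1, [[2]], [], [], [], []⟩,
  ⟨1, 4, 2, [[3]], [], [], [], []⟩,
  ⟨1, 4, 3, [], [([4,4,1], 32432)], [[4,4,1]], [([3,1], 57889)], [[3,1]]⟩,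
  ⟨2, 2, 1, [], [([2,4], 44961)], [[2,4,2]], [([1,1,4], 44436)], [[1,1,4,3]]⟩,
  ⟨2, 3, 1, [[2]], [], [], [], []⟩,
  ⟨2, 3, 2, [], [([3,4,1], 34493)], [[3,4,1,1,2]], [([2,1], 62585)], [[2,1]]⟩,
  ⟨2, 4, 1, [[2]], [], [], [], []⟩,
  ⟨2, 4, 2, [[3]], [], [], [], []⟩,
  ⟨2, 4, 3, [], [([4,4,1], 31702)], [[4,4,1]], [([3,1], 56781)], [[3,1]]⟩,
  ⟨3, 2, 1, [], [([2,4], 44882)], [[2,4,2]], [([1,1,4], 44490)], [[1,1,4,3]]⟩,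
  ⟨3, 3, 1, [[2]], [], [], [], []⟩,
  ⟨3, 3, 2, [], [([3,4,1], 34252)], [[3,4,1,1,2]], [([2,1], 62301)], [[2,1]]⟩,
  ⟨3, 4, 1, [[2]], [], [], [], []⟩,
  ⟨3, 4, 2, [[3]], [], [], [], []⟩,
  ⟨3, 4, 3, [], [([4,4,1], 31386)], [[4,4,1]], [([3,1], 56298)], [[3,1]]⟩,
  ⟨4, 2, 1, [], [([2,4], 44836)], [[2,4,2]], [([1,1,4], 44523)], [[1,1,4,3]]⟩,
  ⟨4, 3, 1, [[2]], [], [], [], []⟩,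
  ⟨4, 3, 2, [], [([3,4,1], 34117)], [[3,4,1,1,2]], [([2,1], 62140)], [[2,1]]⟩,
  ⟨4, 4, 1, [[2]], [], [], [], []⟩,
  ⟨4, 4, 2, [[3]], [], [], [], []⟩,
  ⟨4, 4, 3, [], [([4,4,1], 31210)], [[4,4,1]], [([3,1], 56027)], [[3,1]]⟩]

theorem dimH_region_seven : dimH ((MarkovSpectrum \ LagrangeSpectrum) ∩ Set.Ico (49/10) (533/100)) ≤
    ENNReal.ofReal (493 / 500) := by
  have P : Params 4 ((2070, 10000), (8286, 10000)) (49, 10) (533, 100) :=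
    ⟨isBase_four, by norm_num, by norm_num, by norm_num [frac, onesI]⟩
  have h := dimH_region P (by norm_num [frac]) (L := 3) (J := 35) (K := 100) (D := 100000)
    (by norm_num) (by norm_num) (by norm_num) (by norm_num) (C := certs_seven) (by decide +kernel)
    (J' := 160) (K' := 100) (D' := 100000) (by norm_num) (by norm_num) (by norm_num)
    (H := [1, 10000, 9813, 9756, 9733])
    (W := [[], [0, 46798, 25425, 16700, 11975], [0, 48340, 24517, 15375, 10718], [0, 49205, 24116, 14821, 10209], [0, 49757, 23891, 14517, 9935]])
    (by decide +kernel) (by decide +kernel)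
  norm_num [frac] at h
  exact h.trans (ENNReal.ofReal_le_ofReal (by norm_num))

/-- Continuations for heights in the eight region. -/
def certs_eight : List Cert := [
  ⟨1, 2, 1, [], [([2,4,1,4], 25316)], [[2,4,1,4,2]], [([1,1,4,1], 39110)], [[1,1,4,1]]⟩,
  ⟨1, 3, 1, [[2]], [], [], [], []⟩,
  ⟨1, 3, 2, [], [([3,4,1,4], 22996), ([3,5], 39334)], [[3,4,1,4,2]], [([2,1,4,1], 35012)], [[2,1,4,1,1,2]]⟩,
  ⟨1, 4, 1, [[2]], [], [], [], []⟩,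
  ⟨1, 4, 2, [[3]], [], [], [], []⟩,
  ⟨1, 4, 3, [], [([4,4,1,4], 21338), ([4,5], 36483)], [[4,4,1,4,2]], [([3,1,4], 37424)], [[3,1,4,2]]⟩,
  ⟨1, 5, 1, [[2]], [], [], [], []⟩,
  ⟨1, 5, 2, [[3]], [], [], [], []⟩,
  ⟨1, 5, 3, [[4,2]], [], [], [], []⟩,
  ⟨1, 5, 4, [], [], [], [([4], 0)], []⟩,
  ⟨2, 2, 1, [], [([2,4,1,4], 25223)], [[2,4,1,4,2]], [([1,1,4,1], 39190)], [[1,1,4,1]]⟩,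
  ⟨2, 3, 1, [[2]], [], [], [], []⟩,
  ⟨2, 3, 2, [], [([3,4,1,4], 22636), ([3,5], 38727)], [[3,4,1,4,2]], [([2,1,4,1], 34596)], [[2,1,4,1]]⟩,
  ⟨2, 4, 1, [[2]], [], [], [], []⟩,
  ⟨2, 4, 2, [[3]], [], [], [], []⟩,
  ⟨2, 4, 3, [], [([4,4,1,4], 20855), ([4,5], 35661)], [[4,4,1,4,2]], [([3,1,4,1], 31607)], [[3,1,4,1,1,4]]⟩,
  ⟨2, 5, 1, [[2]], [], [], [], []⟩,
  ⟨2, 5, 2, [[3]], [], [], [], []⟩,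
  ⟨2, 5, 3, [[4]], [], [], [], []⟩,
  ⟨2, 5, 4, [], [], [], [([4], 0)], []⟩,
  ⟨3, 2, 1, [], [([2,4,1,4], 25181)], [[2,4,1,4,2]], [([1,1,4,1], 39234)], [[1,1,4,1]]⟩,
  ⟨3, 3, 1, [[2]], [], [], [], []⟩,
  ⟨3, 3, 2, [], [([3,4,1,4], 22479), ([3,5,5], 21961)], [[3,4,1,4,2]], [([2,1,4,1], 34413)], [[2,1,4,1]]⟩,
  ⟨3, 4, 1, [[2]], [], [], [], []⟩,
  ⟨3, 4, 2, [[3]], [], [], [], []⟩,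
  ⟨3, 4, 3, [], [([4,4,1,4], 20648), ([4,5], 35311)], [[4,4,1,4,2]], [([3,1,4,1], 31325)], [[3,1,4,1,1,3]]⟩,
  ⟨3, 5, 1, [[2]], [], [], [], []⟩,
  ⟨3, 5, 2, [[3]], [], [], [], []⟩,
  ⟨3, 5, 3, [[4]], [], [], [], []⟩,
  ⟨3, 5, 4, [], [([5,4,1,4], 19293), ([5,5], 32980)], [[5,4,1,4,2]], [([4,1,4], 33757)], [[4,1,4,2]]⟩,
  ⟨4, 2, 1, [], [([2,4,1,4], 25158)], [[2,4,1,4,2]], [([1,1,4,1], 39261)], [[1,1,4,1]]⟩,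
  ⟨4, 3, 1, [[2]], [], [], [], []⟩,
  ⟨4, 3, 2, [], [([3,4,1,4], 22391), ([3,5,5], 21876)], [[3,4,1,4,2]], [([2,1,4,1], 34310)], [[2,1,4,1]]⟩,
  ⟨4, 4, 1, [[2]], [], [], [], []⟩,
  ⟨4, 4, 2, [[3]], [], [], [], []⟩,
  ⟨4, 4, 3, [], [([4,4,1,4], 20534), ([4,5], 35116)], [[4,4,1,4,2]], [([3,1,4,1], 31168)], [[3,1,4,1,1,3]]⟩,
  ⟨4, 5, 1, [[2]], [], [], [], []⟩,
  ⟨4, 5, 2, [[3]], [], [], [], []⟩,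
  ⟨4, 5, 3, [[4]], [], [], [], []⟩,
  ⟨4, 5, 4, [], [([5,4,1,4], 19166), ([5,5], 32764)], [[5,4,1,4,2]], [([4,1,4], 33547)], [[4,1,4,2]]⟩,
  ⟨5, 2, 1, [], [], [], [([1], 0)], []⟩,
  ⟨5, 3, 1, [[2]], [], [], [], []⟩,
  ⟨5, 3, 2, [], [([3], 0)], [], [], []⟩,
  ⟨5, 4, 1, [[2]], [], [], [], []⟩,
  ⟨5, 4, 2, [[3]], [], [], [], []⟩,
  ⟨5, 4, 3, [], [([4,4,1,4], 20461), ([4,5], 34992)], [[4,4,1,4,2]], [([3,1,4,1], 31068)], [[3,1,4,1,1,3]]⟩,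
  ⟨5, 5, 1, [[2]], [], [], [], []⟩,
  ⟨5, 5, 2, [[3]], [], [], [], []⟩,
  ⟨5, 5, 3, [[4]], [], [], [], []⟩,
  ⟨5, 5, 4, [], [([5,4,1,4], 19085), ([5,5], 32627)], [[5,4,1,4,2]], [([4,1,4], 33413)], [[4,1,4,2]]⟩]

theorem dimH_region_eight : dimH ((MarkovSpectrum \ LagrangeSpectrum) ∩ Set.Ico (533/100) (11/2)) ≤
    ENNReal.ofReal (493 / 500) := by
  have P : Params 5 ((1707, 10000), (8543, 10000)) (533, 100) (55, 10) :=
    ⟨isBase_five, by norm_num, by norm_num, by norm_num [frac, onesI]⟩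
  have h := dimH_region P (by norm_num [frac]) (L := 4) (J := 34) (K := 100) (D := 100000)
    (by norm_num) (by norm_num) (by norm_num) (by norm_num) (C := certs_eight) (by decide +kernel)
    (J' := 161) (K' := 100) (D' := 100000) (by norm_num) (by norm_num) (by norm_num)
    (H := [1, 10000, 9794, 9922, 9890, 2546])
    (W := [[], [0, 46631, 25263, 16597, 11898, 0], [0, 48149, 24323, 15225, 10596, 0], [0, 49004, 23913, 14660, 10078, 7438], [0, 49552, 23684, 14352, 9800, 7201], [0, 0, 0, 14158, 9627, 7054]])
    (by decide +kernel) (by decide +kernel)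
  norm_num [frac] at h
  exact h.trans (ENNReal.ofReal_le_ofReal (by norm_num))

/-- Continuations for heights in the nine region. -/
def certs_nine : List Cert := [
  ⟨1, 2, 1, [], [([2,4,1,4,1], 24962), ([2,5], 46651)], [[2,4,1,4,1]], [([1,1,4,1,4], 28153)], [[1,1,4,1,4]]⟩,
  ⟨1, 3, 1, [[2]], [], [], [], []⟩,
  ⟨1, 3, 2, [], [([3,5], 42710)], [[3,5,4]], [([2,1,4,1], 38409)], [[2,1,4,1]]⟩,
  ⟨1, 4, 1, [[2]], [], [], [], []⟩,
  ⟨1, 4, 2, [[3]], [], [], [], []⟩,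
  ⟨1, 4, 3, [], [([4,5], 39877)], [[4,5,3]], [([3,1,4,1], 35650)], [[3,1,4,1]]⟩,
  ⟨1, 5, 1, [[2]], [], [], [], []⟩,
  ⟨1, 5, 2, [[3]], [], [], [], []⟩,
  ⟨1, 5, 3, [[4]], [], [], [], []⟩,
  ⟨1, 5, 4, [], [], [], [([4], 0)], []⟩,
  ⟨2, 2, 1, [], [([2,4,1,4,1], 24879), ([2,5], 46513)], [[2,4,1,4,1]], [([1,1,4,1,4], 28204)], [[1,1,4,1,4]]⟩,
  ⟨2, 3, 1, [[2]], [], [], [], []⟩,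
  ⟨2, 3, 2, [], [([3,5], 42108)], [[3,5,5,3]], [([2,1,4,1], 37993)], [[2,1,4,1]]⟩,
  ⟨2, 4, 1, [[2]], [], [], [], []⟩,
  ⟨2, 4, 2, [[3]], [], [], [], []⟩,
  ⟨2, 4, 3, [], [([4,5], 39058)], [[4,5,3,1,2]], [([3,1,4,1], 34988)], [[3,1,4,1]]⟩,
  ⟨2, 5, 1, [[2]], [], [], [], []⟩,
  ⟨2, 5, 2, [[3]], [], [], [], []⟩,
  ⟨2, 5, 3, [[4]], [], [], [], []⟩,
  ⟨2, 5, 4, [], [([5,5], 36766)], [[5,5,3]], [([4,1,4,1], 32785)], [[4,1,4,1]]⟩,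
  ⟨3, 2, 1, [], [([2,4,1,4,1], 24842), ([2,5], 46451)], [[2,4,1,4,1]], [([1,1,4,1,4], 28232)], [[1,1,4,1,4]]⟩,
  ⟨3, 3, 1, [[2]], [], [], [], []⟩,
  ⟨3, 3, 2, [], [([3,5], 41846)], [[3,5,5,3]], [([2,1,4,1], 37809)], [[2,1,4,1]]⟩,
  ⟨3, 4, 1, [[2]], [], [], [], []⟩,
  ⟨3, 4, 2, [[3]], [], [], [], []⟩,
  ⟨3, 4, 3, [], [([4,5], 38707)], [[4,5,3,1,3]], [([3,1,4,1], 34703)], [[3,1,4,1]]⟩,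
  ⟨3, 5, 1, [[2]], [], [], [], []⟩,
  ⟨3, 5, 2, [[3]], [], [], [], []⟩,
  ⟨3, 5, 3, [[4]], [], [], [], []⟩,
  ⟨3, 5, 4, [], [([5,5], 36372)], [[5,5,3]], [([4,1,4,1], 32451)], [[4,1,4,1]]⟩,
  ⟨4, 2, 1, [], [([2,4,1,4,1], 24820), ([2,5], 46416)], [[2,4,1,4,1]], [([1,1,4,1,4], 28250)], [[1,1,4,1,4]]⟩,
  ⟨4, 3, 1, [[2]], [], [], [], []⟩,
  ⟨4, 3, 2, [], [([3,4,1,4,1], 22319), ([3,5], 41699)], [[3,4,1,4,1]], [([2,1,4,1,4], 24988)], [[2,1,4,1,4,4]]⟩,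
  ⟨4, 4, 1, [[2]], [], [], [], []⟩,
  ⟨4, 4, 2, [[3]], [], [], [], []⟩,
  ⟨4, 4, 3, [], [([4,5], 38513)], [[4,5,3,1,4]], [([3,1,4,1], 34544)], [[3,1,4,1]]⟩,
  ⟨4, 5, 1, [[2]], [], [], [], []⟩,
  ⟨4, 5, 2, [[3]], [], [], [], []⟩,
  ⟨4, 5, 3, [[4]], [], [], [], []⟩,
  ⟨4, 5, 4, [], [([5,5], 36154)], [[5,5,3]], [([4,1,4,1], 32267)], [[4,1,4,1]]⟩,
  ⟨5, 2, 1, [], [([2], 0)], [], [], []⟩,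
  ⟨5, 3, 1, [[2]], [], [], [], []⟩,
  ⟨5, 3, 2, [], [([3,4,1,4,1], 22268), ([3,5], 41605)], [[3,4,1,4,1]], [([2,1,4,1,4], 24944)], [[2,1,4,1,4,3]]⟩,
  ⟨5, 4, 1, [[2]], [], [], [], []⟩,
  ⟨5, 4, 2, [[3]], [], [], [], []⟩,
  ⟨5, 4, 3, [], [([4,5], 38389)], [[4,5,4]], [([3,1,4,1], 34443)], [[3,1,4,1]]⟩,
  ⟨5, 5, 1, [[2]], [], [], [], []⟩,
  ⟨5, 5, 2, [[3]], [], [], [], []⟩,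
  ⟨5, 5, 3, [[4]], [], [], [], []⟩,
  ⟨5, 5, 4, [], [([5,5], 36016)], [[5,5,3]], [([4,1,4,1], 32150)], [[4,1,4,1]]⟩]

theorem dimH_region_nine : dimH ((MarkovSpectrum \ LagrangeSpectrum) ∩ Set.Ico (11/2) (1141/200)) ≤
    ENNReal.ofReal (493 / 500) := by
  have P : Params 5 ((1707, 10000), (8543, 10000)) (55, 10) (5705, 1000) :=
    ⟨isBase_five, by norm_num, by norm_num, by norm_num [frac, onesI]⟩
  have h := dimH_region P (by norm_num [frac]) (L := 5) (J := 31) (K := 100) (D := 100000)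
    (by norm_num) (by norm_num) (by norm_num) (by norm_num) (C := certs_nine) (by decide +kernel)
    (J' := 163) (K' := 100) (D' := 100000) (by norm_num) (by norm_num) (by norm_num)
    (H := [1, 9825, 10000, 9916, 9878, 4970])
    (W := [[], [0, 46191, 24835, 16231, 11588, 0], [0, 47714, 23899, 14873, 10305, 7639], [0, 48572, 23492, 14314, 9795, 7202], [0, 49122, 23264, 14010, 9521, 6969], [0, 0, 23119, 13818, 9351, 6825]])
    (by decide +kernel) (by decide +kernel)
  norm_num [frac] at h
  exact h.trans (ENNReal.ofReal_le_ofReal (by norm_num))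

theorem mob_sub_mob (w : List ℕ) (hw : ∀ d ∈ w, 1 ≤ d) {x y : ℝ} (hx : 0 ≤ x) (hy : 0 ≤ y) :
    mob w x - mob w y = (-1) ^ w.length * (x - y) /
      (((den 0 w).1 + (den 0 w).2 * x) * ((den 0 w).1 + (den 0 w).2 * y)) := by
  induction w using List.reverseRecOn generalizing x y with
  | nil => simp [mob, den]
  | append_singleton w d ih =>
    have hd : (1 : ℝ) ≤ d := by exact_mod_cast hw d (by simp)
    have hw' : ∀ d ∈ w, 1 ≤ d := fun e he => hw e (by simp [he])
    obtain ⟨h1, h2, h3, -⟩ := den_mem le_rfl zero_le_one w hw'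
    have hx' : 0 < (d : ℝ) + x := by linarith
    have hy' : 0 < (d : ℝ) + y := by linarith
    rw [mob_append, mob_append]
    simp only [mob]
    rw [ih hw' (by positivity) (by positivity), den_snoc, List.length_append,
      List.length_singleton, pow_succ]
    simp only
    set q := (den 0 w).1
    set r := (den 0 w).2
    have e1 : q + r * (1 / (d + x)) = (d * q + r + q * x) / (d + x) := by field_simp; ring
    have e2 : q + r * (1 / (d + y)) = (d * q + r + q * y) / (d + y) := by field_simp; ring
    have g1 : d * q + r + q * x ≠ 0 := by positivity
    have g2 : d * q + r + q * y ≠ 0 := by positivity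
    rw [e1, e2]
    field_simp
    ring

/-- The minimum of the continued fractions with digits at most `4`. -/
noncomputable def minFour : ℝ := (√2 - 1) / 2

/-- The maximum of the continued fractions with digits at most `4`. -/
noncomputable def maxFour : ℝ := 2 * (√2 - 1)

theorem minFour_bounds : 2071 / 10000 ≤ minFour ∧ minFour ≤ 20711 / 100000 := by
  have h : 1.41421 ≤ √2 := Real.le_sqrt_of_sq_le (by norm_num)
  have h' : √2 ≤ 1.41422 := Real.sqrt_le_iff.2 ⟨by norm_num, by norm_num⟩
  unfold minFour
  constructor <;> linarith

theorem maxFour_eq : maxFour = 4 * minFour := by unfold maxFour minFour; ring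

theorem one_div_four_add : 1 / (4 + maxFour) = minFour := by
  have h := Real.sq_sqrt (show (0 : ℝ) ≤ 2 by norm_num)
  have h0 := Real.sqrt_nonneg 2
  unfold maxFour minFour
  rw [div_eq_iff (by linarith)]
  nlinarith

theorem one_div_one_add : 1 / (1 + minFour) = maxFour := by
  have h := Real.sq_sqrt (show (0 : ℝ) ≤ 2 by norm_num)
  have h0 := Real.sqrt_nonneg 2
  unfold maxFour minFour
  rw [div_eq_iff (by linarith)]
  nlinarith

/-- Intervals spanned by the continued fractions with digits at most `4` that start with `w`
followed by a digit at least `j`. -/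
def Bridge (p q : ℝ) : Prop :=
  p ≤ q ∧ ∃ (w : List ℕ) (j : ℕ), (∀ d ∈ w, 1 ≤ d ∧ d ≤ 4) ∧ 1 ≤ j ∧ j ≤ 3 ∧
    ((p = mob w minFour ∧ q = mob w (1 / (j + minFour))) ∨
      (q = mob w minFour ∧ p = mob w (1 / (j + minFour))))

theorem four_points {q r A B C D : ℝ} (hq : 0 < q) (hr : 0 ≤ r) (hrq : r ≤ q) (hA : 0 ≤ A)
    (hAB : A ≤ B) (hBC : B ≤ C) (hCD : C ≤ D) (h1 : 4 * (C - B) ≤ D - A)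
    (h2 : 4 * (C - B) * (A + D) ≤ (D - A) * (B + C)) (h3 : 4 * (C - B) * (A * D) ≤ (D - A) * (B * C))
    (h4 : D - A ≤ 4 * (B - A)) (h5 : D - A ≤ 4 * (D - C))
    (h6 : (D - A) * (1 + C) ≤ 4 * (D - C) * (1 + A)) :
    (C - B) / ((q + r * C) * (q + r * B)) ≤ (D - A) / ((q + r * D) * (q + r * A)) / 4 ∧
    (D - A) / ((q + r * D) * (q + r * A)) / 4 ≤ (B - A) / ((q + r * B) * (q + r * A)) ∧
    (D - A) / ((q + r * D) * (q + r * A)) / 4 ≤ (D - C) / ((q + r * D) * (q + r * C)) := by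
  have a1 : 0 ≤ r * A := mul_nonneg hr hA
  have b1 : r * A ≤ r * B := mul_le_mul_of_nonneg_left hAB hr
  have c1 : r * B ≤ r * C := mul_le_mul_of_nonneg_left hBC hr
  have d1 : r * C ≤ r * D := mul_le_mul_of_nonneg_left hCD hr
  have pA : 0 < q + r * A := by linarith
  have pB : 0 < q + r * B := by linarith
  have pC : 0 < q + r * C := by linarith
  have pD : 0 < q + r * D := by linarith
  refine ⟨?_, ?_, ?_⟩
  · rw [div_div, div_le_div_iff₀ (by positivity) (by positivity)]
    nlinarith [mul_le_mul_of_nonneg_left h1 (mul_nonneg hq.le hq.le),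
      mul_le_mul_of_nonneg_left h2 (mul_nonneg hq.le hr),
      mul_le_mul_of_nonneg_left h3 (mul_nonneg hr hr)]
  · rw [div_div, div_le_div_iff₀ (by positivity) (by positivity)]
    have : (D - A) * (q + r * B) ≤ 4 * (B - A) * (q + r * D) :=
      mul_le_mul h4 (by linarith) pB.le (by linarith)
    nlinarith [mul_le_mul_of_nonneg_right this pA.le]
  · rw [div_div, div_le_div_iff₀ (by positivity) (by positivity)]
    have : (D - A) * (q + r * C) ≤ 4 * (D - C) * (q + r * A) := by
      nlinarith [mul_le_mul_of_nonneg_left h5 (sub_nonneg.2 hrq),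
        mul_le_mul_of_nonneg_left h6 hr]
    nlinarith [mul_le_mul_of_nonneg_right this pD.le]

theorem Bridge.of_endpoints {w : List ℕ} {j : ℕ} (hw : ∀ d ∈ w, 1 ≤ d ∧ d ≤ 4) (hj : 1 ≤ j)
    (hj' : j ≤ 4) {p q : ℝ} (hpq : p ≤ q)
    (h : (p = mob w minFour ∧ q = mob w (1 / (j + minFour))) ∨
      (q = mob w minFour ∧ p = mob w (1 / (j + minFour)))) : Bridge p q := by
  refine ⟨hpq, ?_⟩
  rcases hj'.lt_or_eq with h4 | rfl
  · exact ⟨w, j, hw, hj, by omega, h⟩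
  · refine ⟨w ++ [4], 1, ?_, le_rfl, by norm_num, ?_⟩
    · intro d hd
      rcases List.mem_append.1 hd with h | h
      · exact hw d h
      · simp at h; omega
    · rw [mob_append, mob_append]
      simp only [mob]
      push_cast at h ⊢
      rw [one_div_one_add, one_div_four_add]
      tauto

theorem bridge_cons {w : List ℕ} {j : ℕ} (hw : ∀ d ∈ w, 1 ≤ d ∧ d ≤ 4) (hj : 1 ≤ j)
    (hj' : j ≤ 4) {p q : ℝ} (hpq : p ≤ q)
    (h : (p = mob w (1 / (j + minFour)) ∧ q = mob w (1 / (j + maxFour))) ∨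
      (q = mob w (1 / (j + minFour)) ∧ p = mob w (1 / (j + maxFour)))) : Bridge p q := by
  refine ⟨hpq, w ++ [j], 1, ?_, le_rfl, by norm_num, ?_⟩
  · intro d hd
    rcases List.mem_append.1 hd with h | h
    · exact hw d h
    · simp at h; omega
  · rw [mob_append, mob_append]
    simp only [mob]
    rw [Nat.cast_one, one_div_one_add]
    tauto

/-- The conditions on four points under which the middle gap stays short relative to the outer
intervals under projective maps. -/
def Balanced (A B C D : ℝ) : Prop :=
  A < B ∧ B < C ∧ C < D ∧ 4 * (C - B) ≤ D - A ∧
    4 * (C - B) * (A + D) ≤ (D - A) * (B + C) ∧ 4 * (C - B) * (A * D) ≤ (D - A) * (B * C) ∧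
    D - A ≤ 4 * (B - A) ∧ D - A ≤ 4 * (D - C) ∧ (D - A) * (1 + C) ≤ 4 * (D - C) * (1 + A)

theorem balanced_of_bounds {A B C D a₀ a₁ b₀ b₁ c₀ c₁ d₀ d₁ : ℝ} (ha₀ : a₀ ≤ A) (ha₁ : A ≤ a₁)
    (hb₀ : b₀ ≤ B) (hb₁ : B ≤ b₁) (hc₀ : c₀ ≤ C) (hc₁ : C ≤ c₁) (hd₀ : d₀ ≤ D) (hd₁ : D ≤ d₁)
    (n₀ : 0 < a₀ ∧ a₁ < b₀ ∧ b₁ < c₀ ∧ c₁ < d₀) (n₁ : 4 * (c₁ - b₀) ≤ d₀ - a₁)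
    (n₂ : 4 * (c₁ - b₀) * (a₁ + d₁) ≤ (d₀ - a₁) * (b₀ + c₀))
    (n₃ : 4 * (c₁ - b₀) * (a₁ * d₁) ≤ (d₀ - a₁) * (b₀ * c₀)) (n₄ : d₁ - a₀ ≤ 4 * (b₀ - a₁))
    (n₅ : d₁ - a₀ ≤ 4 * (d₀ - c₁)) (n₆ : (d₁ - a₀) * (1 + c₁) ≤ 4 * (d₀ - c₁) * (1 + a₀)) :
    Balanced A B C D := by
  obtain ⟨z1, z2, z3, z4⟩ := n₀
  have e0 : 0 ≤ A := by linarith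
  have e1 : 0 ≤ B := by linarith
  have e2 : 0 ≤ C := by linarith
  have e3 : 0 ≤ D := by linarith
  have f1 : C - B ≤ c₁ - b₀ := by linarith
  have f2 : d₀ - a₁ ≤ D - A := by linarith
  have f3 : D - A ≤ d₁ - a₀ := by linarith
  have f4 : d₀ - c₁ ≤ D - C := by linarith
  refine ⟨by linarith, by linarith, by linarith, by linarith, ?_, ?_, by linarith, by linarith, ?_⟩
  · refine (mul_le_mul (by linarith) (by linarith) (by linarith) (by linarith)).trans
      (n₂.trans (mul_le_mul f2 (by linarith) (by linarith) (by linarith)))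
  · have h1 : A * D ≤ a₁ * d₁ := mul_le_mul ha₁ hd₁ e3 (by linarith)
    have h2 : b₀ * c₀ ≤ B * C := mul_le_mul hb₀ hc₀ (by linarith) e1
    refine (mul_le_mul (by linarith) h1 (by positivity) (by linarith)).trans
      (n₃.trans (mul_le_mul f2 h2 (mul_nonneg (by linarith) (by linarith)) (by linarith)))
  · refine (mul_le_mul f3 (by linarith) (by linarith) (by linarith)).trans
      (n₆.trans (mul_le_mul (by linarith) (by linarith) (by linarith) (by linarith)))

theorem Bridge.split {p q : ℝ} (h : Bridge p q) : ∃ p' q', Bridge p p' ∧ Bridge q' q ∧ p' ≤ q' ∧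
    q' - p' ≤ (q - p) / 4 ∧ (q - p) / 4 ≤ p' - p ∧ (q - p) / 4 ≤ q - q' := by
  obtain ⟨hpq, w, j, hw, hj1, hj3, h⟩ := h
  obtain ⟨m1, m2⟩ := minFour_bounds
  have hw1 : ∀ d ∈ w, 1 ≤ d := fun d hd => (hw d hd).1
  obtain ⟨q1, q2, q3, -⟩ := den_mem le_rfl zero_le_one w hw1
  have hM := maxFour_eq
  have key : Balanced minFour (1 / ((j + 1 : ℕ) + minFour)) (1 / (j + maxFour))
      (1 / (j + minFour)) := by
    have bnd : ∀ {u lo hi : ℝ}, 0 < u → 0 < lo → 0 < hi → lo * u ≤ 1 → 1 ≤ hi * u →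
        lo ≤ 1 / u ∧ 1 / u ≤ hi := fun h0 h1 h2 h3 h4 =>
      ⟨by rwa [le_div_iff₀ h0], by rwa [div_le_iff₀ h0]⟩
    have hj : j = 1 ∨ j = 2 ∨ j = 3 := by omega
    rcases hj with rfl | rfl | rfl <;> simp only [Nat.cast_add, Nat.cast_ofNat, Nat.cast_one]
    · obtain ⟨b0, b1⟩ := bnd (u := 1 + 1 + minFour) (lo := 0.453) (hi := 0.4532)
        (by linarith) (by norm_num) (by norm_num) (by linarith) (by linarith)
      obtain ⟨c0, c1⟩ := bnd (u := 1 + maxFour) (lo := 0.5469) (hi := 0.547)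
        (by linarith) (by norm_num) (by norm_num) (by linarith) (by linarith)
      obtain ⟨d0, d1⟩ := bnd (u := 1 + minFour) (lo := 0.8284) (hi := 0.8285)
        (by linarith) (by norm_num) (by norm_num) (by linarith) (by linarith)
      exact balanced_of_bounds m1 m2 b0 b1 c0 c1 d0 d1 (by norm_num) (by norm_num) (by norm_num)
        (by norm_num) (by norm_num) (by norm_num) (by norm_num)
    · obtain ⟨b0, b1⟩ := bnd (u := 2 + 1 + minFour) (lo := 0.3118) (hi := 0.3119)
        (by linarith) (by norm_num) (by norm_num) (by linarith) (by linarith)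
      obtain ⟨c0, c1⟩ := bnd (u := 2 + maxFour) (lo := 0.3535) (hi := 0.3536)
        (by linarith) (by norm_num) (by norm_num) (by linarith) (by linarith)
      obtain ⟨d0, d1⟩ := bnd (u := 2 + minFour) (lo := 0.453) (hi := 0.4532)
        (by linarith) (by norm_num) (by norm_num) (by linarith) (by linarith)
      exact balanced_of_bounds m1 m2 b0 b1 c0 c1 d0 d1 (by norm_num) (by norm_num) (by norm_num)
        (by norm_num) (by norm_num) (by norm_num) (by norm_num)
    · obtain ⟨b0, b1⟩ := bnd (u := 3 + 1 + minFour) (lo := 0.23769) (hi := 0.2377)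
        (by linarith) (by norm_num) (by norm_num) (by linarith) (by linarith)
      obtain ⟨c0, c1⟩ := bnd (u := 3 + maxFour) (lo := 0.2612) (hi := 0.26122)
        (by linarith) (by norm_num) (by norm_num) (by linarith) (by linarith)
      obtain ⟨d0, d1⟩ := bnd (u := 3 + minFour) (lo := 0.3118) (hi := 0.31182)
        (by linarith) (by norm_num) (by norm_num) (by linarith) (by linarith)
      exact balanced_of_bounds m1 m2 b0 b1 c0 c1 d0 d1 (by norm_num) (by norm_num) (by norm_num)
        (by norm_num) (by norm_num) (by norm_num) (by norm_num)
  obtain ⟨k1, k2, k3, k4, k5, k6, k7, k8, k9⟩ := key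
  have kA : 0 ≤ minFour := by linarith
  have kB := kA.trans k1.le
  have kC := kB.trans k2.le
  have kD := kC.trans k3.le
  obtain ⟨g1, g2, g3⟩ := four_points (by linarith) q2 q3 kA k1.le k2.le k3.le k4 k5 k6 k7 k8 k9
  have dif := fun {x y : ℝ} => mob_sub_mob w hw1 (x := x) (y := y)
  have pos : 0 < (1 / (j + minFour) - minFour) / (((den 0 w).1 + (den 0 w).2 * (1 / (j + minFour))) *
      ((den 0 w).1 + (den 0 w).2 * minFour)) := by
    apply div_pos (by linarith)
    have := mul_nonneg q2 kA
    have := mul_nonneg q2 kD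
    positivity
  have eDA := dif kD kA
  have eCB := dif kC kB
  have eBA := dif kB kA
  have eDC := dif kD kC
  have pos' : 0 ≤ (1 / (j + maxFour) - 1 / ((j + 1 : ℕ) + minFour)) /
      (((den 0 w).1 + (den 0 w).2 * (1 / (j + maxFour))) *
      ((den 0 w).1 + (den 0 w).2 * (1 / ((j + 1 : ℕ) + minFour)))) := by
    apply div_nonneg (by linarith)
    have := mul_nonneg q2 kB
    have := mul_nonneg q2 kC
    positivity
  rcases Nat.even_or_odd w.length with hl | hl
  · simp only [hl.neg_one_pow, one_mul] at eDA eCB eBA eDC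
    rcases h with ⟨rfl, rfl⟩ | ⟨rfl, rfl⟩
    · refine ⟨_, _, Bridge.of_endpoints hw (j := j + 1) (by omega) (by omega) ?_ (Or.inl ⟨rfl, rfl⟩),
        bridge_cons hw hj1 (by omega) ?_ (Or.inr ⟨rfl, rfl⟩), ?_, ?_, ?_, ?_⟩ <;> linarith
    · linarith
  · simp only [hl.neg_one_pow, neg_mul, one_mul, neg_div] at eDA eCB eBA eDC
    rcases h with ⟨rfl, rfl⟩ | ⟨rfl, rfl⟩
    · linarith
    · refine ⟨_, _, bridge_cons hw hj1 (by omega) ?_ (Or.inl ⟨rfl, rfl⟩),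
        Bridge.of_endpoints hw (j := j + 1) (by omega) (by omega) ?_ (Or.inr ⟨rfl, rfl⟩),
        ?_, ?_, ?_, ?_⟩ <;> linarith

theorem bridge_init : Bridge minFour maxFour := by
  obtain ⟨m1, m2⟩ := minFour_bounds
  refine ⟨by rw [maxFour_eq]; linarith, [], 1, by simp, le_rfl, by norm_num, Or.inl ⟨rfl, ?_⟩⟩
  rw [Nat.cast_one, one_div_one_add]
  rfl

theorem exists_bridges {s : ℝ} (h1 : minFour + minFour ≤ s) (h2 : s ≤ maxFour + maxFour) (n : ℕ) :
    ∃ p q p' q', Bridge p q ∧ Bridge p' q' ∧ p + p' ≤ s ∧ s ≤ q + q' ∧ (q - p) ≤ 4 * (q' - p') ∧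
      (q' - p') ≤ 4 * (q - p) ∧ (q - p) * (q' - p') ≤ (3 / 4) ^ n := by
  induction n with
  | zero =>
    obtain ⟨m1, m2⟩ := minFour_bounds
    have := maxFour_eq
    refine ⟨_, _, _, _, bridge_init, bridge_init, h1, h2, by linarith, by linarith, ?_⟩
    rw [pow_zero]; nlinarith
  | succ n ih =>
    have main : ∃ p q p' q', Bridge p q ∧ Bridge p' q' ∧ p + p' ≤ s ∧ s ≤ q + q' ∧
        (q - p) ≤ 4 * (q' - p') ∧ (q' - p') ≤ q - p ∧ (q - p) * (q' - p') ≤ (3 / 4) ^ n := by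
      obtain ⟨p, q, p', q', hp, hp', h3, h4, h5, h6, h7⟩ := ih
      rcases le_total (q' - p') (q - p) with h | h
      · exact ⟨p, q, p', q', hp, hp', h3, h4, h5, h, h7⟩
      · exact ⟨p', q', p, q, hp', hp, by linarith, by linarith, h6, h, by linarith⟩
    obtain ⟨p, q, p', q', hp, hp', h3, h4, h5, h6, h7⟩ := main
    obtain ⟨u, v, hu, hv, g0, g1, g2, g3⟩ := hp.split
    have g4 := hp'.1
    have g5 := hu.1
    have g6 := hv.1
    rw [pow_succ]
    rcases le_total s (u + q') with h | h
    · refine ⟨p, u, p', q', hu, hp', h3, h, by linarith, by linarith, ?_⟩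
      have : (u - p) * (q' - p') ≤ (q - p) * (3 / 4) * (q' - p') :=
        mul_le_mul_of_nonneg_right (by linarith) (by linarith)
      linarith
    · refine ⟨v, q, p', q', hv, hp', by linarith, h4, by linarith, by linarith, ?_⟩
      have : (q - v) * (q' - p') ≤ (q - p) * (3 / 4) * (q' - p') :=
        mul_le_mul_of_nonneg_right (by linarith) (by linarith)
      linarith

theorem mob_mem_of_mem {w : List ℕ} (hw : ∀ d ∈ w, 1 ≤ d) {x y z : ℝ} (hx : 0 ≤ x) (hxz : x ≤ z)
    (hzy : z ≤ y) : min (mob w x) (mob w y) ≤ mob w z ∧ mob w z ≤ max (mob w x) (mob w y) := by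
  have hz := hx.trans hxz
  obtain ⟨q1, q2, q3, -⟩ := den_mem le_rfl zero_le_one w hw
  have key : ∀ u v : ℝ, 0 ≤ u → u ≤ v → 0 ≤ (v - u) / (((den 0 w).1 + (den 0 w).2 * v) *
      ((den 0 w).1 + (den 0 w).2 * u)) := fun u v hu huv => by
    have := mul_nonneg q2 hu
    have := mul_nonneg q2 (hu.trans huv)
    exact div_nonneg (by linarith) (by positivity)
  have k1 := key x z hx hxz
  have k2 := key z y hz hzy
  have d1 := mob_sub_mob w hw hz hx
  have d2 := mob_sub_mob w hw (hz.trans hzy) hz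
  rcases Nat.even_or_odd w.length with hl | hl
  · simp only [hl.neg_one_pow, one_mul] at d1 d2
    exact ⟨(min_le_left _ _).trans (by linarith), le_trans (by linarith) (le_max_right _ _)⟩
  · simp only [hl.neg_one_pow, neg_mul, one_mul, neg_div] at d1 d2
    exact ⟨(min_le_right _ _).trans (by linarith), le_trans (by linarith) (le_max_left _ _)⟩

theorem Bridge.exists_mem {p q : ℝ} (h : Bridge p q) : ∃ w : List ℕ, (∀ d ∈ w, 1 ≤ d ∧ d ≤ 4) ∧
    ∀ x : ℕ → ℕ, (∀ k, 1 ≤ x k) → Pre w x → (∀ k, w.length ≤ k → x k = 1) →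
      p ≤ cfv x ∧ cfv x ≤ q := by
  obtain ⟨hpq, w, j, hw, hj1, hj3, h⟩ := h
  refine ⟨w ++ [4], ?_, fun x hx hpre hone => ?_⟩
  · intro d hd
    rcases List.mem_append.1 hd with h | h
    · exact hw d h
    · simp at h; omega
  · rw [cfv_eq_mob hx hpre, mob_append]
    obtain ⟨g1, g2⟩ := cfv_ones_mem (x := fun k => x (k + (w ++ [4]).length))
      fun k => hone _ (by omega)
    set z := cfv fun k => x (k + (w ++ [4]).length)
    simp only [frac, onesI] at g1 g2
    norm_num at g1 g2
    obtain ⟨m1, m2⟩ := minFour_bounds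
    have hM := maxFour_eq
    have hj : (1 : ℝ) ≤ j ∧ (j : ℝ) ≤ 3 := by exact_mod_cast And.intro hj1 hj3
    have h1 : minFour ≤ mob [4] z := by
      rw [← one_div_four_add]
      simp only [mob]; push_cast
      exact one_div_le_one_div_of_le (by linarith) (by linarith)
    have h2 : mob [4] z ≤ 1 / (j + minFour) := by
      simp only [mob]; push_cast
      exact one_div_le_one_div_of_le (by linarith) (by linarith)
    obtain ⟨k1, k2⟩ := mob_mem_of_mem (fun d hd => (hw d hd).1) (by linarith) h1 h2
    rcases h with ⟨rfl, rfl⟩ | ⟨rfl, rfl⟩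
    · rw [min_eq_left hpq] at k1; rw [max_eq_right hpq] at k2; exact ⟨k1, k2⟩
    · rw [min_eq_right hpq] at k1; rw [max_eq_left hpq] at k2; exact ⟨k1, k2⟩

theorem pre_getD (w : List ℕ) : Pre w fun k => w.getD k 1 := by
  induction w with
  | nil => trivial
  | cons d w ih => exact ⟨by simp, by simpa using ih⟩

theorem getD_bounds {w : List ℕ} (hw : ∀ d ∈ w, 1 ≤ d ∧ d ≤ 4) (k : ℕ) :
    1 ≤ w.getD k 1 ∧ w.getD k 1 ≤ 4 := by
  rcases lt_or_ge k w.length with h | h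
  · rw [List.getD_eq_getElem _ _ h]; exact hw _ (List.getElem_mem h)
  · rw [List.getD_eq_default _ _ h]; norm_num

theorem lam_lt_of_pos {c : ℤ → ℕ} (hc : BiPos c) (h4 : ∀ i, i ≠ 0 → c i ≤ 4) {i : ℤ} (hi : 0 < i) :
    lam c i < 29 / 5 + 1 / 20 ∧ (c 0 ≤ 5 → lam c i < 57 / 10) := by
  have cast4 : ∀ j, j ≠ 0 → (c j : ℝ) ≤ 4 := fun j hj => by exact_mod_cast h4 j hj
  have one : ∀ j, (1 : ℝ) ≤ c j := fun j => by exact_mod_cast hc j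
  have f1 : fwd c i ≤ 5 / 6 := by
    have g : 1 / 5 ≤ fwd c (i + 1) := by
      rw [fwd_rec hc]
      have := cast4 (i + 1 + 1) (by omega)
      have := fwd_lt_one hc (i + 1 + 1)
      have := fwd_pos hc (i + 1 + 1)
      exact one_div_le_one_div_of_le (by linarith [one (i + 1 + 1)]) (by linarith)
    rw [fwd_rec hc, div_le_div_iff₀ (by linarith [one (i + 1)]) (by norm_num)]
    linarith [one (i + 1)]
  have b1 := bwd_lt_one hc i
  refine ⟨by unfold lam; linarith [cast4 i hi.ne'], fun h0 => ?_⟩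
  have h5 : ∀ j, (c j : ℝ) ≤ 5 := fun j => by
    by_cases hj : j = 0
    · subst hj; exact_mod_cast h0
    · linarith [cast4 j hj]
  have b2 : bwd c i ≤ 6 / 7 := by
    have g : 1 / 6 ≤ bwd c (i - 1) := by
      rw [bwd_rec hc]
      have := h5 (i - 1 - 1)
      have := bwd_lt_one hc (i - 1 - 1)
      have := bwd_pos hc (i - 1 - 1)
      exact one_div_le_one_div_of_le (by linarith [one (i - 1 - 1)]) (by linarith)
    rw [bwd_rec hc, div_le_div_iff₀ (by linarith [one (i - 1)]) (by norm_num)]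
    linarith [one (i - 1)]
  unfold lam
  linarith [cast4 i hi.ne']

/-- Hall's ray. -/
theorem mem_lagrange_of_ge {t : ℝ} (ht : 57 / 10 ≤ t) : t ∈ LagrangeSpectrum := by
  refine mem_lagrange_of_approx (by linarith) fun ε hε => ?_
  obtain ⟨m1, m2⟩ := minFour_bounds
  have hM := maxFour_eq
  obtain ⟨n, hn1, hn2⟩ : ∃ n : ℕ, (n : ℝ) + 4143 / 10000 ≤ t ∧ t < n + 1 + 4143 / 10000 := by
    refine ⟨⌊t - 4143 / 10000⌋₊, ?_, ?_⟩
    · linarith [Nat.floor_le (show 0 ≤ t - 4143 / 10000 by linarith)]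
    · linarith [Nat.lt_floor_add_one (t - 4143 / 10000)]
  have hn5 : 5 ≤ n := by
    by_contra! h
    have : (n : ℝ) ≤ 4 := by exact_mod_cast Nat.le_of_lt_succ h
    linarith
  obtain ⟨k, hk⟩ := exists_pow_lt_of_lt_one (show 0 < ε ^ 2 / 16 by positivity)
    (show (3 / 4 : ℝ) < 1 by norm_num)
  obtain ⟨p, q, p', q', hp, hp', h1, h2, h3, h4, h5⟩ := exists_bridges (s := t - n)
    (by linarith) (by linarith) k
  have hsmall : (q - p) + (q' - p') ≤ ε := by
    have g1 := hp.1
    have g2 := hp'.1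
    by_contra! hc
    have k1 : (q - p + (q' - p')) ≤ 5 * (q - p) := by linarith
    have k2 : (q - p + (q' - p')) ≤ 5 * (q' - p') := by linarith
    nlinarith [mul_le_mul k1 k2 (by linarith) (by linarith)]
  obtain ⟨w, hw, hwx⟩ := hp.exists_mem
  obtain ⟨v, hv, hvx⟩ := hp'.exists_mem
  let c : ℤ → ℕ := fun i => if 0 < i then w.getD (i - 1).toNat 1 else
    if i < 0 then v.getD (-i - 1).toNat 1 else n
  have c0 : c 0 = n := by simp [c]
  have cpos : ∀ i, 0 < i → c i = w.getD (i - 1).toNat 1 := fun i hi => by simp [c, hi]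
  have cneg : ∀ i, i < 0 → c i = v.getD (-i - 1).toNat 1 := fun i hi => by
    simp [c, hi, hi.le, not_lt.2 hi.le]
  have h4 : ∀ i, i ≠ 0 → 1 ≤ c i ∧ c i ≤ 4 := fun i hi => by
    rcases lt_or_gt_of_ne hi with h | h
    · rw [cneg i h]; exact getD_bounds hv _
    · rw [cpos i h]; exact getD_bounds hw _
  have hc : BiPos c := fun i => by
    by_cases hi : i = 0
    · rw [hi, c0]; omega
    · exact (h4 i hi).1
  have e1 : (fun k : ℕ => c (0 + 1 + k)) = fun k => w.getD k 1 := by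
    funext k; rw [cpos _ (by omega)]; congr 1; omega
  have e2 : (fun k : ℕ => c (0 - 1 - k)) = fun k => v.getD k 1 := by
    funext k; rw [cneg _ (by omega)]; congr 1; omega
  have x1 := hwx (fun k => w.getD k 1) (fun k => (getD_bounds hw k).1) (pre_getD w)
    fun k hk => List.getD_eq_default _ _ hk
  have x2 := hvx (fun k => v.getD k 1) (fun k => (getD_bounds hv k).1) (pre_getD v)
    fun k hk => List.getD_eq_default _ _ hk
  have hl0 : lam c 0 = n + cfv (fun k => w.getD k 1) + cfv (fun k => v.getD k 1) := by
    unfold lam fwd bwd; rw [c0, e1, e2]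
  have hpos : ∀ c : ℤ → ℕ, BiPos c → (∀ i, i ≠ 0 → c i ≤ 4) → c 0 = n → ∀ i, 0 < i →
      lam c i ≤ t := by
    intro c hc h4 h0 i hi
    obtain ⟨g1, g2⟩ := lam_lt_of_pos hc h4 hi
    rcases hn5.eq_or_lt with h | h
    · linarith [g2 (by omega)]
    · have : (6 : ℝ) ≤ n := by exact_mod_cast h
      linarith
  refine ⟨c, hc, ⟨w.length + v.length + 1, fun i hi => ?_⟩, fun i => ?_, by linarith⟩
  · push_cast at hi
    rcases lt_trichotomy i 0 with h | h | h
    · rw [cneg i h]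
      rw [abs_of_neg h] at hi
      exact List.getD_eq_default _ _ (by omega)
    · rw [h, abs_zero] at hi; omega
    · rw [cpos i h]
      rw [abs_of_pos h] at hi
      exact List.getD_eq_default _ _ (by omega)
  · rcases lt_trichotomy i 0 with h | h | h
    · have := hpos (rev c) hc.rev (fun i hi => (h4 _ (by omega)).2) (by simp [rev, c0]) (-i)
        (by omega)
      rw [lam_rev, neg_neg] at this
      linarith
    · rw [h]; linarith
    · linarith [hpos c hc (fun i hi => (h4 i hi).2) c0 i h]

theorem eq_of_mark_of_lt {a b : ℤ → ℕ} {s t : ℝ} (ha : Mark a s) (hb : Mark b t)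
    (hs : s < 8 / 3) (ht : t < 8 / 3) : s = t := by
  have one : ∀ {a : ℤ → ℕ} {s : ℝ}, Mark a s → s < 8 / 3 → ∀ i, a i = 1 := fun {a s} ha hs i => by
    have := bdd_of_lam_le ha.1 ha.2.1 (M := 1) (by norm_num; linarith) i
    omega
  have : a = b := funext fun i => (one ha hs i).trans (one hb ht i).symm
  rw [← ha.2.2, ← hb.2.2, this]

theorem dimH_markov_diff_lagrange_lt :
    dimH (MarkovSpectrum \ LagrangeSpectrum) < ENNReal.ofReal 0.987 := by
  have hlow : dimH (MarkovSpectrum ∩ Set.Iio (8 / 3)) = 0 := by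
    apply Set.Subsingleton.dimH_zero
    rintro s ⟨hs, hs'⟩ t ⟨ht, ht'⟩
    obtain ⟨a, ha⟩ := exists_mark_of_mem hs
    obtain ⟨b, hb⟩ := exists_mark_of_mem ht
    exact eq_of_mark_of_lt ha hb hs' ht'
  set E := MarkovSpectrum \ LagrangeSpectrum
  have hsub : E ⊆ (MarkovSpectrum ∩ Set.Iio (8 / 3)) ∪ (E ∩ Set.Ico (133 / 50) (7 / 2)) ∪
      (E ∩ Set.Ico (7 / 2) (39 / 10)) ∪ (E ∩ Set.Ico (39 / 10) (22 / 5)) ∪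
      (E ∩ Set.Ico (22 / 5) (19 / 4)) ∪ (E ∩ Set.Ico (19 / 4) (24 / 5)) ∪
      (E ∩ Set.Ico (24 / 5) (49 / 10)) ∪ (E ∩ Set.Ico (49 / 10) (533 / 100)) ∪
      (E ∩ Set.Ico (533 / 100) (11 / 2)) ∪ (E ∩ Set.Ico (11 / 2) (1141 / 200)) := by
    intro t ht
    have h9 : t < 1141 / 200 := by
      by_contra! h
      exact ht.2 (mem_lagrange_of_ge (by linarith))
    simp only [Set.mem_union, Set.mem_inter_iff, Set.mem_Ico, Set.mem_Iio, ht, ht.1, true_and]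
    by_contra! hc
    obtain ⟨⟨⟨⟨⟨⟨⟨⟨⟨h0, h1⟩, h2⟩, h3⟩, h4⟩, h5⟩, h6⟩, h7⟩, h8⟩, h10⟩ := hc
    have h1' := h1 (by linarith)
    have h2' := h2 h1'
    have h3' := h3 h2'
    have h4' := h4 h3'
    have h5' := h5 h4'
    have h6' := h6 h5'
    have h7' := h7 h6'
    have h8' := h8 h7'
    linarith [h10 h8']
  have hle : dimH E ≤ ENNReal.ofReal (493 / 500) := by
    refine (dimH_mono hsub).trans ?_
    simp only [dimH_union, max_le_iff, hlow]
    exact ⟨⟨⟨⟨⟨⟨⟨⟨⟨zero_le, dimH_region_one⟩, dimH_region_two⟩, dimH_region_three⟩,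
      dimH_region_four⟩, dimH_region_five⟩, dimH_region_six⟩, dimH_region_seven⟩,
      dimH_region_eight⟩, dimH_region_nine⟩
  refine hle.trans_lt ((ENNReal.ofReal_lt_ofReal_iff (by norm_num)).2 (by norm_num))

/-- The word `r` with left context `l` contains a digit `3` of height provably above `t`. -/
def bad3 (b : (ℕ × ℕ) × (ℕ × ℕ)) (t : ℕ × ℕ) : List ℕ → List ℕ → Bool
  | _, [] => false
  | l, d :: r => (Nat.beq d 3 && sumGT d (mobI b r).1 (mobI b l).1 t) || bad3 b t (d :: l) r

theorem exists_lt_lam_of_bad3 {M : ℕ} {b : (ℕ × ℕ) × (ℕ × ℕ)} (hb : IsBase M b) {t : ℕ × ℕ}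
    (ht : 0 < t.2) {a : ℤ → ℕ} (ha : Bdd M a) {i : ℤ} {l r : List ℕ} (h : At a i l r)
    (hbad : bad3 b t l r = true) : ∃ j, i ≤ j ∧ j < i + r.length ∧ frac t < lam a j := by
  induction r generalizing l i with
  | nil => simp [bad3] at hbad
  | cons d r ih =>
    rw [bad3, Bool.or_eq_true, Bool.and_eq_true] at hbad
    rcases hbad with ⟨-, hbad⟩ | hbad
    · have h1 := hb.cfv_mem_mobI (fun k => ha _) h.tail
      have h2 := hb.cfv_mem_mobI (fun k => ha _) h.1
      have h3 := lt_of_sumGT h1.1 h2.1 ht hbad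
      refine ⟨i, le_rfl, by simp, ?_⟩
      unfold lam fwd bwd
      rw [h.head]
      linarith [h1.2.2.1, h2.2.2.1]
    · obtain ⟨j, h1, h2, h3⟩ := ih h.step hbad
      exact ⟨j, by omega, by simp; omega, h3⟩

theorem At.unstep {a : ℤ → ℕ} {i : ℤ} {l r : List ℕ} {d : ℕ} (h : At a i (d :: l) r) :
    At a (i - 1) l (d :: r) := by
  refine ⟨?_, ?_, ?_⟩
  · convert h.1.2 using 3
    push_cast; ring
  · simpa using h.1.1
  · convert h.2 using 3
    push_cast; ring

theorem At.unzip {a : ℤ → ℕ} {i : ℤ} {l r : List ℕ} (h : At a i l r) :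
    At a (i - l.length) [] (l.reverse ++ r) := by
  induction l generalizing i r with
  | nil => simpa using h
  | cons d l ih =>
    have := ih h.unstep
    simp only [List.reverse_cons, List.append_assoc, List.singleton_append, List.length_cons]
    convert this using 1
    push_cast; ring

/-- The digit at the head of `r`, with left context `l`, has height provably at most `t`. -/
def lowZ (b : (ℕ × ℕ) × (ℕ × ℕ)) (t : ℕ × ℕ) (l : List ℕ) : List ℕ → Bool
  | [] => false
  | d :: r => sumLE d (mobI b r).2 (mobI b l).2 t

theorem lam_le_of_lowZ {M : ℕ} {b : (ℕ × ℕ) × (ℕ × ℕ)} (hb : IsBase M b) {t : ℕ × ℕ}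
    (ht : 0 < t.2) {a : ℤ → ℕ} (ha : Bdd M a) {i : ℤ} {l r : List ℕ} (h : At a i l r)
    (hlow : lowZ b t l r = true) : lam a i ≤ frac t := by
  match r with
  | [] => simp [lowZ] at hlow
  | d :: r =>
    have h1 := hb.cfv_mem_mobI (fun k => ha _) h.tail
    have h2 := hb.cfv_mem_mobI (fun k => ha _) h.1
    have h3 := le_of_sumLE h1.2.1 h2.2.1 ht hlow
    unfold lam fwd bwd
    rw [h.head]
    linarith [h1.2.2.2, h2.2.2.2]

/-- Exhaustive search over extensions (to the right for `true`, to the left for `false`) by digits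
in `{1, 2, 3}`: every branch is accepted, has a digit of height above `hi`, or has its centre of
height at most `lo`. -/
def search (b : (ℕ × ℕ) × (ℕ × ℕ)) (hi lo : ℕ × ℕ) (acc : List ℕ → List ℕ → Bool) :
    List Bool → List ℕ → List ℕ → Bool
  | [], l, r => acc l r || lowZ b lo l r || bad3 b hi [] (l.reverse ++ r)
  | e :: s, l, r => acc l r || lowZ b lo l r || bad3 b hi [] (l.reverse ++ r) ||
    [1, 2, 3].all fun d => bif e then search b hi lo acc s l (r ++ [d])
      else search b hi lo acc s (l ++ [d]) r

theorem search_sound {b : (ℕ × ℕ) × (ℕ × ℕ)} (hb : IsBase 3 b) {hi lo : ℕ × ℕ}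
    (hhi : 0 < hi.2) (hlo : 0 < lo.2) {acc : List ℕ → List ℕ → Bool} {a : ℤ → ℕ} (ha : Bdd 3 a)
    {i : ℤ} {N : ℕ} (hle : ∀ j, i - N ≤ j → j ≤ i + N → lam a j ≤ frac hi)
    (hlt : frac lo < lam a i) (s : List Bool) (l r : List ℕ) (h : At a i l r)
    (hl : l.length + s.length ≤ N) (hr : r.length + s.length ≤ N)
    (hs : search b hi lo acc s l r = true) : ∃ l' r', At a i l' r' ∧ acc l' r' = true := by
  have main : ∀ l r, At a i l r → l.length ≤ N → r.length ≤ N →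
      (acc l r || lowZ b lo l r || bad3 b hi [] (l.reverse ++ r)) = true →
      ∃ l' r', At a i l' r' ∧ acc l' r' = true := by
    intro l r h hl hr hs
    simp only [Bool.or_eq_true] at hs
    rcases hs with (hs | hs) | hs
    · exact ⟨l, r, h, hs⟩
    · exact absurd (lam_le_of_lowZ hb hlo ha h hs) (not_le.2 hlt)
    · obtain ⟨j, h1, h2, h3⟩ := exists_lt_lam_of_bad3 hb hhi ha h.unzip hs
      simp at h2
      exact absurd (hle j (by omega) (by omega)) (not_le.2 h3)
  induction s generalizing l r with
  | nil => exact main l r h (by simpa using hl) (by simpa using hr) hs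
  | cons e s ih =>
    rw [List.length_cons] at hl hr
    rw [search, Bool.or_eq_true] at hs
    rcases hs with hs | hs
    · exact main l r h (by omega) (by omega) hs
    have hd : ∀ j, a j ∈ [1, 2, 3] := fun j => by
      have := ha j
      simp; omega
    cases e with
    | true =>
      refine ih l (r ++ [a (i + r.length)]) ⟨h.1, pre_append.2 ⟨h.2, ?_⟩⟩ (by omega)
        (by simp; omega) ?_
      · simp [Pre]
      · simpa using List.all_eq_true.1 hs _ (hd (i + r.length))
    | false =>
      refine ih (l ++ [a (i - 1 - l.length)]) r ⟨pre_append.2 ⟨h.1, ?_⟩, h.2⟩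
        (by simp; omega) (by omega) ?_
      · simp [Pre]
      · simpa using List.all_eq_true.1 hs _ (hd (i - 1 - l.length))

/-- The left context of an exceptional centre. -/
def leftCtx : List ℕ := [2, 2, 2, 1, 2, 3, 3, 2, 2, 2, 1, 2, 2, 1, 2, 1]

/-- The periodic word carried by the right-hand side of an exceptional centre. -/
def period : List ℕ := [3, 3, 2, 1, 2, 2, 2]

/-- A lower bound for the heights of the constructed family. -/
def loV : ℕ × ℕ := (37096998597502, 10000000000000)

/-- An upper bound for the heights of the constructed family. -/
def hiV : ℕ × ℕ := (37096998597506, 10000000000000)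

/-- The digits to the right of an exceptional centre. -/
def rightCtx : List ℕ := period ++ period ++ [3, 3, 2, 1, 2, 2]

theorem search_centre : search ((2636, 10000), (7914, 10000)) hiV loV
    (fun l r => (leftCtx.isPrefixOf l && rightCtx.isPrefixOf r) ||
      ((3 :: leftCtx).isPrefixOf r && rightCtx.tail.isPrefixOf l))
    (List.replicate 19 [false, true]).flatten [] [3] = true := by decide +kernel

theorem search_period : search ((2636, 10000), (7914, 10000)) hiV (0, 1)
    (fun _ r => rightCtx.isPrefixOf r) (List.replicate 7 true)
    [2, 2, 2, 1, 2, 3, 3, 2, 2, 2, 1, 2, 3, 3, 2, 2] (rightCtx.take 13) = true := by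
  decide +kernel

theorem Pre.congr {w : List ℕ} {x y : ℕ → ℕ} (h : Pre w x) (hxy : ∀ k < w.length, y k = x k) :
    Pre w y := by
  induction w generalizing x y with
  | nil => trivial
  | cons d w ih =>
    exact ⟨(hxy 0 (by simp)).trans h.1, ih h.2 fun k hk => hxy (k + 1) (by simpa using hk)⟩

theorem At.congr {a c : ℤ → ℕ} {i : ℤ} {l r : List ℕ} (h : At c i l r)
    (hac : ∀ j, i - l.length ≤ j → j < i + r.length → a j = c j) : At a i l r :=
  ⟨h.1.congr fun k hk => hac _ (by omega) (by omega),
    h.2.congr fun k hk => hac _ (by omega) (by omega)⟩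

theorem At.agree {a c : ℤ → ℕ} {i : ℤ} {l r : List ℕ} (h : At a i l r) (h' : At c i l r) {j : ℤ}
    (h1 : i - l.length ≤ j) (h2 : j < i + r.length) : a j = c j := by
  rcases lt_or_ge j i with hj | hj
  · obtain ⟨k, hk⟩ := Int.eq_ofNat_of_zero_le (a := i - 1 - j) (by omega)
    have e : j = i - 1 - (k : ℤ) := by omega
    have := h.1.get k (by omega)
    have := h'.1.get k (by omega)
    subst e
    simp_all
  · obtain ⟨k, hk⟩ := Int.eq_ofNat_of_zero_le (a := j - i) (by omega)
    have e : j = i + (k : ℤ) := by omega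
    have := h.2.get k (by omega)
    have := h'.2.get k (by omega)
    subst e
    simp_all

theorem At.mono {a : ℤ → ℕ} {i : ℤ} {l r l' r' : List ℕ} (h : At a i l r) (hl : l' <+: l)
    (hr : r' <+: r) : At a i l' r' := by
  obtain ⟨u, rfl⟩ := hl
  obtain ⟨v, rfl⟩ := hr
  exact ⟨(pre_append.1 h.1).1, (pre_append.1 h.2).1⟩

/-- The periodic sequence with period `period`. -/
def perD (j : ℤ) : ℕ := period.getD (j % 7).toNat 0

theorem perD_add (m j : ℤ) : perD (7 * m + j) = perD j := by
  unfold perD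
  rw [show (7 * m + j) % 7 = j % 7 by omega]

theorem At.perD_add {l r : List ℕ} (h : At perD 0 l r) (m : ℤ) : At perD (7 * m) l r := by
  refine ⟨h.1.congr fun k _ => ?_, h.2.congr fun k _ => ?_⟩
  · rw [show 7 * m - 1 - (k : ℤ) = 7 * m + (0 - 1 - k) by ring, MarkovLagrange.perD_add]
  · rw [show 7 * m + (k : ℤ) = 7 * m + (0 + k) by ring, MarkovLagrange.perD_add]

theorem at_perD : At perD 0 [2, 2, 2, 1, 2, 3, 3, 2, 2, 2, 1, 2, 3, 3, 2, 2] rightCtx := by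
  simp [At, Pre, rightCtx, period, perD]

theorem eq_perD {a : ℤ → ℕ} (ha : Bdd 3 a) (h : At a 0 leftCtx rightCtx) {J : ℤ}
    (hJ : ∀ j, -40 ≤ j → j ≤ J → lam a j ≤ frac hiV) {j : ℤ} (h0 : 0 ≤ j) (hj : j ≤ J - 60) :
    a j = perD j := by
  have key : ∀ k : ℕ, 7 * (k : ℤ) ≤ J - 40 → ∀ j : ℤ, -9 ≤ j → j ≤ 7 * k + 19 → a j = perD j := by
    intro k
    induction k with
    | zero =>
      intro _ j h1 h2
      exact (h.mono (l' := [2, 2, 2, 1, 2, 3, 3, 2, 2]) (by decide) List.prefix_rfl).agree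
        (at_perD.mono (by decide) List.prefix_rfl) (by simpa using h1)
        (by simp [rightCtx, period]; push_cast at h2; omega)
    | succ k ih =>
      intro hk j h1 h2
      push_cast at hk h2
      have ih := ih (by omega)
      have hp := at_perD.perD_add (k + 1)
      have hAt : At a (7 * (k + 1)) [2, 2, 2, 1, 2, 3, 3, 2, 2, 2, 1, 2, 3, 3, 2, 2]
          (rightCtx.take 13) := by
        refine (hp.mono List.prefix_rfl (List.take_prefix _ _)).congr fun j h1 h2 => ih j ?_ ?_
        · simp at h1; omega
        · simp [rightCtx, period] at h2; omega
      obtain ⟨l, r, hlr, hacc⟩ := search_sound isBase_three (by norm_num [hiV]) (by norm_num)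
        ha (N := 26) (fun j h1 h2 => hJ j (by push_cast at h1; omega) (by push_cast at h2; omega))
        (by
          have := fwd_pos ha.biPos (7 * ((k : ℤ) + 1))
          have := bwd_pos ha.biPos (7 * ((k : ℤ) + 1))
          have : (0 : ℝ) ≤ a (7 * ((k : ℤ) + 1)) := Nat.cast_nonneg _
          rw [show frac (0, 1) = 0 by simp [frac]]
          unfold lam
          linarith)
        _ _ _ hAt (by decide) (by decide) search_period
      rw [List.isPrefixOf_iff_prefix] at hacc
      have hAt' : At a (7 * (k + 1)) [] rightCtx := hlr.mono List.nil_prefix hacc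
      rcases lt_or_ge j (7 * k + 7) with hj | hj
      · exact ih j h1 (by omega)
      · exact hAt'.agree (hp.mono List.nil_prefix List.prefix_rfl) (by simp; omega)
          (by simp [rightCtx, period]; omega)
  rcases lt_or_ge j 20 with h | h
  · exact key 0 (by push_cast; omega) j (by omega) (by push_cast; omega)
  · obtain ⟨k, hk⟩ := Int.eq_ofNat_of_zero_le (a := (j - 12) / 7) (by omega)
    exact key k (by omega) j (by omega) (by omega)

theorem at_or_at_of_lt_lam {a : ℤ → ℕ} (ha : Bdd 3 a) {i : ℤ}
    (hle : ∀ j, i - 40 ≤ j → j ≤ i + 40 → lam a j ≤ frac hiV) (hlt : frac loV < lam a i) :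
    At (fun j => a (i + j)) 0 leftCtx rightCtx ∨ At (fun j => a (i - j)) 0 leftCtx rightCtx := by
  have h3 : a i = 3 := by
    have h1 := fwd_lt_one ha.biPos i
    have h2 := bwd_lt_one ha.biPos i
    have h4 := (ha i).2
    by_contra hne
    have h5 : a i = 1 ∨ a i = 2 := by have := (ha i).1; omega
    have h7 := (isBase_three.cfv_mem (x := fun k : ℕ => a (i + 1 + k)) fun k => ha _).2
    have h8 := (isBase_three.cfv_mem (x := fun k : ℕ => a (i - 1 - k)) fun k => ha _).2
    have h6 : (a i : ℝ) ≤ 2 := by exact_mod_cast (by omega : a i ≤ 2)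
    unfold lam fwd bwd at hlt
    norm_num [frac, loV] at hlt h7 h8
    linarith
  obtain ⟨l, r, hlr, hacc⟩ := search_sound isBase_three (by norm_num [hiV]) (by norm_num [loV])
    ha (N := 40) (i := i) (fun j h1 h2 => hle j (by push_cast at h1; omega) (by push_cast at h2; omega))
    hlt _ [] [3] ⟨trivial, by simpa [Pre] using h3⟩ (by decide) (by decide) search_centre
  simp only [Bool.or_eq_true, Bool.and_eq_true, List.isPrefixOf_iff_prefix] at hacc
  rcases hacc with ⟨h1, h2⟩ | ⟨h1, h2⟩
  · left
    have := hlr.mono h1 h2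
    refine ⟨this.1.congr fun k _ => ?_, this.2.congr fun k _ => ?_⟩
    · exact congrArg a (by ring)
    · exact congrArg a (by ring)
  · right
    have := hlr.mono h2 h1
    refine ⟨this.tail.congr fun k _ => congrArg a (by ring), ?_⟩
    have e : rightCtx = 3 :: rightCtx.tail := rfl
    rw [e]
    refine ⟨?_, this.1.congr fun k _ => congrArg a (by push_cast; ring)⟩
    have := this.head
    simpa using this

theorem perD_eq_one {j : ℤ} (h : perD j = 1) : j % 7 = 3 := by
  unfold perD at h
  have h1 := Int.emod_nonneg j (by norm_num : (7 : ℤ) ≠ 0)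
  have h2 := Int.emod_lt_of_pos j (by norm_num : (0 : ℤ) < 7)
  generalize j % 7 = m at *
  interval_cases m <;> simp [period] at h ⊢

theorem exists_ones {a : ℤ → ℕ} {i : ℤ} (h : At (fun j => a (i + j)) 0 leftCtx rightCtx ∨
    At (fun j => a (i - j)) 0 leftCtx rightCtx) :
    ∃ j, i - 20 ≤ j ∧ j ≤ i + 20 ∧ a j = 1 ∧ a (j + 3) = 1 := by
  rcases h with h | h
  · have h1 := h.1.get 10 (by decide)
    have h2 := h.1.get 13 (by decide)
    refine ⟨i - 14, by omega, by omega, ?_, ?_⟩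
    · exact (congrArg a (by norm_num; ring)).trans h2
    · exact (congrArg a (by norm_num; ring)).trans h1
  · have h1 := h.1.get 10 (by decide)
    have h2 := h.1.get 13 (by decide)
    refine ⟨i + 11, by omega, by omega, ?_, ?_⟩
    · exact (congrArg a (by norm_num)).trans h1
    · exact (congrArg a (by norm_num; ring)).trans h2

theorem false_of_three_centres {c : ℤ → ℕ} (hc : Bdd 3 c) {K : ℤ}
    (hle : ∀ j, K ≤ j → lam c j ≤ frac hiV) {m n k : ℤ} (hm : K + 200 ≤ m) (hmn : m + 100 ≤ n)
    (hnk : n + 100 ≤ k) (h1 : frac loV < lam c m) (h2 : frac loV < lam c n)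
    (h3 : frac loV < lam c k) : False := by
  have H1 := at_or_at_of_lt_lam hc (fun j _ _ => hle j (by omega)) h1
  have H3 := at_or_at_of_lt_lam hc (fun j _ _ => hle j (by omega)) h3
  rcases at_or_at_of_lt_lam hc (fun j _ _ => hle j (by omega)) h2 with H | H
  · obtain ⟨j, g1, g2, g3, g4⟩ := exists_ones H3
    have key : ∀ j, n ≤ j → c j = perD (j - n) := fun j hj => by
      have hl : ∀ i, lam (fun j => c (n + j)) i = lam c (n + i) := fun i => by
        rw [show (fun j => c (n + j)) = shift c n from funext fun j => congrArg c (by ring),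
          lam_shift, add_comm]
      have := eq_perD (a := fun j => c (n + j)) (fun i => hc _) H (J := j - n + 60)
        (fun i h1 _ => by rw [hl]; exact hle _ (by omega)) (j := j - n) (by omega) (by omega)
      rw [← this]; exact congrArg c (by ring)
    rw [key _ (by omega)] at g3 g4
    have := perD_eq_one g3
    have := perD_eq_one g4
    omega
  · obtain ⟨j, g1, g2, g3, g4⟩ := exists_ones H1
    have key : ∀ j, j ≤ n → K + 100 ≤ j → c j = perD (n - j) := fun j hj hK => by
      have hl : ∀ i, lam (fun j => c (n - j)) i = lam c (n - i) := fun i => by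
        rw [show (fun j => c (n - j)) = rev (shift c n) from
          funext fun j => congrArg c (by ring), lam_rev, lam_shift]
        congr 1; ring
      have := eq_perD (a := fun j => c (n - j)) (fun i => hc _) H (J := n - K)
        (fun i h1 _ => by rw [hl]; exact hle _ (by omega)) (j := n - j) (by omega) (by omega)
      rw [← this]; exact congrArg c (by ring)
    rw [key _ (by omega) (by omega)] at g3 g4
    have := perD_eq_one g3
    have := perD_eq_one g4
    omega

theorem notMem_lagrange {t : ℝ} (h1 : frac loV < t) (h2 : t < frac hiV) :
    t ∉ LagrangeSpectrum := by
  intro ht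
  obtain ⟨b, hb, hval⟩ := exists_seq_of_mem_lagrange ht
  have hlo : 2 ≤ frac loV := by norm_num [frac, loV]
  have hhi : frac hiV < 4 := by norm_num [frac, hiV]
  set δ := min (t - frac loV) (frac hiV - t) / 2 with hδ
  have hδ0 : 0 < δ := half_pos (lt_min (by linarith) (by linarith))
  have hδ1 : 2 * δ ≤ t - frac loV := by rw [hδ]; linarith [min_le_left (t - frac loV) (frac hiV - t)]
  have hδ2 : 2 * δ ≤ frac hiV - t := by
    rw [hδ]; linarith [min_le_right (t - frac loV) (frac hiV - t)]
  obtain ⟨N, hN⟩ := eventually_atTop.1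
    (eventually_lam_lt_of_lagrangeVal hb hval (τ := t + δ) (by linarith) (by linarith))
  have hfreq := frequently_lt_lam_of_lagrangeVal hb hval (τ := t - δ) (by linarith) (by linarith)
  obtain ⟨K, hK⟩ := (tendsto_two_mul_half_pow.eventually (gt_mem_nhds hδ0)).exists
  set c : ℤ → ℕ := fun j => if j < N then 1 else b j with hc
  have hcb : ∀ j : ℤ, N ≤ j → c j = b j := fun j hj => if_neg (not_lt.2 hj)
  have hcpos : BiPos c := fun j => by
    rw [hc]; dsimp only; split_ifs
    exacts [le_rfl, hb j]
  have hc3 : Bdd 3 c := fun j => by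
    refine ⟨hcpos j, ?_⟩
    rcases lt_or_ge j N with hj | hj
    · simp [hc, hj]
    · rw [hcb j hj]
      obtain ⟨n, rfl⟩ := Int.eq_ofNat_of_zero_le (a := j) (by omega)
      have := hN n (by omega)
      unfold lam at this
      have h3 := fwd_pos hb n
      have h4 := bwd_pos hb n
      have : (b n : ℝ) < 4 := by linarith
      have : b n < 4 := by exact_mod_cast this
      omega
  have herr : ∀ j : ℤ, N + K ≤ j → |lam c j - lam b j| < δ := fun j hj => by
    have e1 : fwd c j = fwd b j := fwd_congr fun i hi => hcb i (by omega)
    have e2 := abs_bwd_sub_le hcpos hb (i := j) K fun i h3 h4 => hcb i (by omega)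
    unfold lam
    rw [e1, hcb j (by omega)]
    calc _ = |bwd c j - bwd b j| := by congr 1; ring
      _ < δ := e2.trans_lt hK
  have hle : ∀ j : ℤ, N + K ≤ j → lam c j ≤ frac hiV := fun j hj => by
    obtain ⟨n, rfl⟩ := Int.eq_ofNat_of_zero_le (a := j) (by omega)
    have := hN n (by omega)
    have := (abs_lt.1 (herr n hj)).2
    linarith
  have hex : ∀ L : ℤ, ∃ m, L ≤ m ∧ N + K ≤ m ∧ frac loV < lam c m := fun L => by
    obtain ⟨n, hn, hn'⟩ := frequently_atTop.1 hfreq (max L.toNat (N + K))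
    have h3 : L ≤ n := by have := le_trans (le_max_left _ _) hn; omega
    have h4 : N + K ≤ n := le_trans (le_max_right _ _) hn
    refine ⟨n, h3, by exact_mod_cast h4, ?_⟩
    have := (abs_lt.1 (herr n (by exact_mod_cast h4))).1
    linarith
  obtain ⟨m, hm, -, hm'⟩ := hex (N + K + 200)
  obtain ⟨n, hn, -, hn'⟩ := hex (m + 100)
  obtain ⟨k, hk, -, hk'⟩ := hex (n + 100)
  exact false_of_three_centres hc3 hle hm hn hk hm' hn' hk'

/-- The fixed part of the left-hand side of the constructed family. -/
def leftWord : List ℕ := leftCtx ++ [2]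

/-- The constructed family: periodic to the right, `leftWord` followed by `g` to the left. -/
def fam (g : ℕ → ℕ) (j : ℤ) : ℕ :=
  if 0 ≤ j then perD j else
    if -17 ≤ j then leftWord.getD (-1 - j).toNat 0 else g (-18 - j).toNat

theorem perD_mem (j : ℤ) : 1 ≤ perD j ∧ perD j ≤ 3 := by
  unfold perD
  have h1 := Int.emod_nonneg j (by norm_num : (7 : ℤ) ≠ 0)
  have h2 := Int.emod_lt_of_pos j (by norm_num : (0 : ℤ) < 7)
  generalize j % 7 = m at *
  interval_cases m <;> simp [period]

theorem fam_bdd {g : ℕ → ℕ} (hg : ∀ k, 1 ≤ g k ∧ g k ≤ 2) : Bdd 3 (fam g) := by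
  intro j
  unfold fam
  split_ifs with h1 h2
  · exact perD_mem j
  · have : j < 0 := not_le.1 h1
    interval_cases j <;> simp [leftWord, leftCtx]
  · have := hg (-18 - j).toNat
    omega

theorem fam_le_two {g : ℕ → ℕ} (hg : ∀ k, 1 ≤ g k ∧ g k ≤ 2) {j : ℤ}
    (hj : 0 ≤ j → j % 7 ≠ 0 ∧ j % 7 ≠ 1) (h6 : j ≠ -6) (h7 : j ≠ -7) : fam g j ≤ 2 := by
  unfold fam
  split_ifs with h1 h2
  · obtain ⟨h3, h4⟩ := hj h1
    unfold perD
    have h5 := Int.emod_nonneg j (by norm_num : (7 : ℤ) ≠ 0)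
    have h8 := Int.emod_lt_of_pos j (by norm_num : (0 : ℤ) < 7)
    generalize j % 7 = m at *
    interval_cases m <;> simp_all [period]
  · have : j < 0 := not_le.1 h1
    interval_cases j <;> simp_all [leftWord, leftCtx]
  · exact (hg _).2

theorem fam_at (g : ℕ → ℕ) : At (fam g) 0 leftWord rightCtx := by
  refine ⟨?_, at_perD.2.congr fun k _ => if_pos (by omega)⟩
  simp [Pre, fam, leftWord, leftCtx]

theorem fam_at_perD (g : ℕ → ℕ) (m : ℕ) :
    At (fam g) (7 * (m + 1)) [2, 2, 2, 1, 2, 3, 3, 2, 2, 2, 1, 2, 3, 3, 2, 2] rightCtx := by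
  refine (at_perD.perD_add (m + 1)).congr fun j h1 _ => ?_
  simp at h1
  rcases le_or_gt 0 j with h | h
  · exact if_pos h
  · refine ((fam_at g).mono (l' := [2, 2, 2, 1, 2, 3, 3, 2, 2]) (by decide)
      List.nil_prefix).agree (at_perD.mono (by decide) List.nil_prefix) (by simp; omega) (by simpa using h)

theorem bwd_fam (g : ℕ → ℕ) (hg : ∀ k, 1 ≤ g k) (hg' : BiPos (fam g)) :
    bwd (fam g) 0 = mob leftWord (cfv g) := by
  unfold bwd
  rw [cfv_eq_mob (fun _ => hg' _) (fam_at g).1]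
  congr 2
  funext k
  have : leftWord.length = 17 := rfl
  rw [this, fam, if_neg (by push_cast; omega), if_neg (by push_cast; omega)]
  congr 1
  push_cast; omega

theorem lam_fam_le {g : ℕ → ℕ} (hg : ∀ k, 1 ≤ g k ∧ g k ≤ 2) {j : ℤ} (hj : j ≠ 0) :
    lam (fam g) j ≤ frac loV := by
  have hb := fam_bdd hg
  have hlo : 0 < loV.2 := by norm_num [loV]
  by_cases hd : fam g j ≤ 2
  · have h7 := (isBase_three.cfv_mem (x := fun k : ℕ => fam g (j + 1 + k)) fun k => hb _).2
    have h8 := (isBase_three.cfv_mem (x := fun k : ℕ => fam g (j - 1 - k)) fun k => hb _).2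
    have h6 : (fam g j : ℝ) ≤ 2 := by exact_mod_cast hd
    unfold lam fwd bwd
    norm_num [frac, loV] at h7 h8 ⊢
    linarith
  have hcase : j = -6 ∨ j = -7 ∨ j = 1 ∨ (∃ m : ℕ, j = 7 * (m + 1)) ∨
      ∃ m : ℕ, j = 7 * (m + 1) + 1 := by
    by_contra hne
    push Not at hne
    obtain ⟨n1, n2, n3, n4, n5⟩ := hne
    refine hd (fam_le_two hg (fun h0 => ⟨fun h => ?_, fun h => ?_⟩) n1 n2)
    · exact n4 ((j - 7) / 7).toNat (by omega)
    · exact n5 ((j - 7) / 7).toNat (by omega)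
  have h0 := fam_at g
  have hm6 : At (fam g) (0 - 1 - 1 - 1 - 1 - 1 - 1) _ _ := h0.unstep.unstep.unstep.unstep.unstep.unstep
  rcases hcase with rfl | rfl | rfl | ⟨m, rfl⟩ | ⟨m, rfl⟩
  · exact lam_le_of_lowZ isBase_three hlo hb hm6 (by decide +kernel)
  · exact lam_le_of_lowZ isBase_three hlo hb hm6.unstep (by decide +kernel)
  · exact lam_le_of_lowZ isBase_three hlo hb h0.step (by decide +kernel)
  · exact lam_le_of_lowZ isBase_three hlo hb (fam_at_perD g m) (by decide +kernel)
  · exact lam_le_of_lowZ isBase_three hlo hb (fam_at_perD g m).step (by decide +kernel)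

theorem lam_fam_mem {g : ℕ → ℕ} (hg : ∀ k, 1 ≤ g k ∧ g k ≤ 2) :
    frac loV < lam (fam g) 0 ∧ lam (fam g) 0 < frac hiV := by
  have hb := fam_bdd hg
  have h0 := fam_at g
  have hh : (fam g 0) = 3 := rfl
  have h1 := isBase_three.cfv_mem_mobI (x := fun k : ℕ => fam g (0 + 1 + k)) (fun k => hb _)
    (h0.tail (r := rightCtx.tail))
  obtain ⟨q1, q2, q3⟩ := mobI_spec isBase_two.pos₁ isBase_two.pos₂ (w := leftWord) (by decide)
    (isBase_two.cfv_mem hg)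
  have hbw := bwd_fam g (fun k => (hg k).1) hb.biPos
  have k1 := lt_of_sumGT (d := 3) (t := loV) h1.1 q1 (by decide) (by decide +kernel)
  have k2 := le_of_sumLE (d := 3) (t := (370969985975058, 100000000000000)) h1.2.1 q2 (by decide)
    (by decide +kernel)
  have k3 : frac (370969985975058, 100000000000000) < frac hiV := by norm_num [frac, hiV]
  unfold lam
  rw [hbw, hh]
  unfold fwd
  constructor <;> simp only [Nat.cast_ofNat] at k1 k2 ⊢ <;> linarith [h1.2.2.1, h1.2.2.2, q3.1, q3.2]

theorem lam_fam_mem_diff {g : ℕ → ℕ} (hg : ∀ k, 1 ≤ g k ∧ g k ≤ 2) :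
    lam (fam g) 0 ∈ MarkovSpectrum \ LagrangeSpectrum := by
  obtain ⟨h1, h2⟩ := lam_fam_mem hg
  refine ⟨markovSpectrum_of_mark ⟨(fam_bdd hg).biPos, fun i => ?_, rfl⟩, notMem_lagrange h1 h2⟩
  by_cases hi : i = 0
  · rw [hi]
  · exact (lam_fam_le hg hi).trans h1.le

theorem lam_fam {g : ℕ → ℕ} (hg : ∀ k, 1 ≤ g k ∧ g k ≤ 2) :
    lam (fam g) 0 = 3 + cfv (fun k : ℕ => perD (1 + k)) + mob leftWord (cfv g) := by
  have h : fam g 0 = 3 := rfl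
  unfold lam
  rw [bwd_fam g (fun k => (hg k).1) (fam_bdd hg).biPos, h]
  unfold fwd
  congr 3

/-- Words (read backwards) in the digits `1` and `2`. -/
def OneTwo (w : List ℕ) : Prop := ∀ d ∈ w, d = 1 ∨ d = 2

/-- The mass of a cylinder (given by the reversed word) when unit mass is distributed
proportionally to `Φ`. -/
noncomputable def mass (Φ : List ℕ → ℝ) : List ℕ → ℝ
  | [] => 1
  | d :: w => mass Φ w * (Φ (d :: w) / (Φ (1 :: w) + Φ (2 :: w)))

/-- The cylinder of level `n` containing the point `y` of `[0, 1]`, and the position in it. -/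
noncomputable def cyl (Φ : List ℕ → ℝ) (y : ℝ) : ℕ → List ℕ × ℝ
  | 0 => ([], y)
  | n + 1 => let p := cyl Φ y n
    if p.2 ≤ mass Φ (1 :: p.1) then (1 :: p.1, p.2) else (2 :: p.1, p.2 - mass Φ (1 :: p.1))

/-- The digits of the point `y` of `[0, 1]`. -/
noncomputable def cylDigit (Φ : List ℕ → ℝ) (y : ℝ) (n : ℕ) : ℕ :=
  if (cyl Φ y n).2 ≤ mass Φ (1 :: (cyl Φ y n).1) then 1 else 2

theorem cylDigit_mem (Φ : List ℕ → ℝ) (y : ℝ) (n : ℕ) : cylDigit Φ y n = 1 ∨ cylDigit Φ y n = 2 := by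
  unfold cylDigit; split_ifs <;> simp

theorem cyl_succ_fst (Φ : List ℕ → ℝ) (y : ℝ) (n : ℕ) :
    (cyl Φ y (n + 1)).1 = cylDigit Φ y n :: (cyl Φ y n).1 := by
  rw [cyl, cylDigit]; split_ifs <;> rfl

theorem cyl_succ_snd (Φ : List ℕ → ℝ) (y : ℝ) (n : ℕ) :
    (cyl Φ y (n + 1)).2 =
      (cyl Φ y n).2 - if cylDigit Φ y n = 1 then 0 else mass Φ (1 :: (cyl Φ y n).1) := by
  rw [cyl, cylDigit]; split_ifs <;> simp_all

theorem length_cyl (Φ : List ℕ → ℝ) (y : ℝ) (n : ℕ) : (cyl Φ y n).1.length = n := by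
  induction n with
  | zero => rfl
  | succ n ih => rw [cyl_succ_fst, List.length_cons, ih]

theorem oneTwo_cyl (Φ : List ℕ → ℝ) (y : ℝ) (n : ℕ) : OneTwo (cyl Φ y n).1 := by
  induction n with
  | zero => simp [cyl, OneTwo]
  | succ n ih =>
    rw [cyl_succ_fst]
    intro d hd
    rcases List.mem_cons.1 hd with rfl | hd
    exacts [cylDigit_mem _ _ _, ih d hd]

theorem pre_cyl (Φ : List ℕ → ℝ) (y : ℝ) (n : ℕ) : Pre (cyl Φ y n).1.reverse (cylDigit Φ y) := by
  induction n with
  | zero => trivial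
  | succ n ih =>
    rw [cyl_succ_fst, List.reverse_cons, pre_append]
    refine ⟨ih, ?_, trivial⟩
    simp [length_cyl]

theorem cyl_agree (Φ : List ℕ → ℝ) {y y' : ℝ} {n : ℕ}
    (h : ∀ k < n, cylDigit Φ y k = cylDigit Φ y' k) :
    (cyl Φ y n).1 = (cyl Φ y' n).1 ∧ (cyl Φ y n).2 - (cyl Φ y' n).2 = y - y' := by
  induction n with
  | zero => exact ⟨rfl, rfl⟩
  | succ n ih =>
    obtain ⟨h1, h2⟩ := ih fun k hk => h k (by omega)
    have h3 := h n (by omega)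
    rw [cyl_succ_fst, cyl_succ_fst, cyl_succ_snd, cyl_succ_snd, h3, h1]
    exact ⟨rfl, by linarith⟩

section

variable {Φ : List ℕ → ℝ}

theorem mass_add (hpos : ∀ w, OneTwo w → 0 < Φ w) {w : List ℕ}
    (hw : OneTwo w) : mass Φ (1 :: w) + mass Φ (2 :: w) = mass Φ w := by
  have h1 := hpos (1 :: w) (by simpa [OneTwo] using hw)
  have h2 := hpos (2 :: w) (by simpa [OneTwo] using hw)
  simp only [mass]
  field_simp

theorem mass_le (hpos : ∀ w, OneTwo w → 0 < Φ w)
    (hsup : ∀ w, OneTwo w → Φ w ≤ Φ (1 :: w) + Φ (2 :: w)) {w : List ℕ}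
    (hw : OneTwo w) : mass Φ w ≤ Φ w / Φ [] := by
  induction w with
  | nil => rw [div_self (hpos [] hw).ne', mass]
  | cons d w ih =>
    have hw' : OneTwo w := fun e he => hw e (by simp [he])
    have h1 := hpos (1 :: w) (by simpa [OneTwo] using hw')
    have h2 := hpos (2 :: w) (by simpa [OneTwo] using hw')
    have h3 := hpos _ hw
    have h0 := hpos [] (by simp [OneTwo])
    rw [mass]
    calc mass Φ w * (Φ (d :: w) / (Φ (1 :: w) + Φ (2 :: w)))
        ≤ (Φ (1 :: w) + Φ (2 :: w)) / Φ [] * (Φ (d :: w) / (Φ (1 :: w) + Φ (2 :: w))) := by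
          gcongr
          exact (ih hw').trans (by gcongr; exact hsup w hw')
      _ = _ := by field_simp

theorem cyl_snd_mem (hpos : ∀ w, OneTwo w → 0 < Φ w)
    {y : ℝ} (hy : y ∈ Set.Icc (0 : ℝ) 1) (n : ℕ) :
    (cyl Φ y n).2 ∈ Set.Icc 0 (mass Φ (cyl Φ y n).1) := by
  induction n with
  | zero => exact hy
  | succ n ih =>
    obtain ⟨h1, h2⟩ := ih
    have h3 := mass_add hpos (oneTwo_cyl Φ y n)
    rw [cyl]
    split_ifs with h
    · exact ⟨h1, h⟩
    · exact ⟨by dsimp only; linarith, by dsimp only; linarith⟩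

theorem exists_split (hpos : ∀ w, OneTwo w → 0 < Φ w)
    (hsup : ∀ w, OneTwo w → Φ w ≤ Φ (1 :: w) + Φ (2 :: w))
    (hlim : ∀ ε > 0, ∃ N : ℕ, ∀ w, OneTwo w → N ≤ w.length → Φ w < ε) {y y' : ℝ}
    (hy : y ∈ Set.Icc (0 : ℝ) 1) (hy' : y' ∈ Set.Icc (0 : ℝ) 1) (hne : y ≠ y') :
    ∃ w, OneTwo w ∧ Pre w.reverse (cylDigit Φ y) ∧ Pre w.reverse (cylDigit Φ y') ∧
      |y - y'| ≤ Φ w / Φ [] ∧ cylDigit Φ y w.length ≠ cylDigit Φ y' w.length := by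
  have h0 := hpos [] (by simp [OneTwo])
  have key : ∀ n, (∀ k < n, cylDigit Φ y k = cylDigit Φ y' k) →
      (cyl Φ y n).1 = (cyl Φ y' n).1 ∧ |y - y'| ≤ Φ (cyl Φ y n).1 / Φ [] := by
    intro n hn
    obtain ⟨h1, h2⟩ := cyl_agree Φ hn
    refine ⟨h1, ?_⟩
    have h3 := cyl_snd_mem hpos hy n
    have h4 := cyl_snd_mem hpos hy' n
    rw [← h1] at h4
    refine le_trans ?_ (mass_le hpos hsup (oneTwo_cyl Φ y n))
    rw [← h2, abs_le]
    constructor <;> linarith [h3.1, h3.2, h4.1, h4.2]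
  have hex : ∃ n, cylDigit Φ y n ≠ cylDigit Φ y' n := by
    by_contra hc
    push Not at hc
    obtain ⟨N, hN⟩ := hlim (|y - y'| * Φ []) (mul_pos (abs_pos.2 (sub_ne_zero.2 hne)) h0)
    have h1 := (key N fun k _ => hc k).2
    rw [le_div_iff₀ h0] at h1
    exact absurd (hN _ (oneTwo_cyl Φ y N) (length_cyl Φ y N).ge) (not_lt.2 h1)
  classical
  have hmin : ∀ k < Nat.find hex, cylDigit Φ y k = cylDigit Φ y' k := fun k hk =>
    not_not.1 (Nat.find_min hex hk)
  obtain ⟨h1, h2⟩ := key _ hmin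
  refine ⟨(cyl Φ y (Nat.find hex)).1, oneTwo_cyl _ _ _, pre_cyl _ _ _, ?_, h2, ?_⟩
  · rw [h1]; exact pre_cyl _ _ _
  · rw [length_cyl]; exact Nat.find_spec hex

end

/-- An interval containing the continued fractions with digits `1` and `2`. -/
def baseTwo : (ℕ × ℕ) × (ℕ × ℕ) := ((3659, 10000), (7322, 10000))

/-- The position of a word of length `4` in the digits `1`, `2` in lexicographic order. -/
def ctxIdx (c : List ℕ) : ℕ := c.foldl (fun i d => 2 * i + (d - 1)) 0

/-- An approximate eigenvector of the transfer operator on contexts of four digits. -/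
def eigen (c : List ℕ) : ℕ :=
  [992393, 992087, 993501, 993366, 990343, 990200, 990847, 990790, 999422, 999259, 1000000, 999926,
    998354, 998281, 998603, 998573].getD (ctxIdx c) 0

/-- Lower bounds, in millionths, for the contraction obtained by appending a digit `1` or `2`. -/
def contr (c : List ℕ) : ℕ × ℕ :=
  [(599729, 397665), (598953, 398130), (602013, 396755), (601658, 396972), (594024, 400388),
    (593649, 400618), (595073, 399960), (594915, 400060), (615071, 391145), (614697, 391353),
    (616191, 390730), (616015, 390830), (612403, 392315), (612234, 392409), (612880, 392138),
    (612808, 392179)].getD (ctxIdx c) (0, 0)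

/-- Decides `n ^ K * (2 * (d + p) + 1) ^ J ≤ D ^ K * (2 + p) ^ J`. -/
def contrOK (J K D n d : ℕ) (p : ℕ × ℕ) : Bool :=
  Nat.ble (n ^ K * (2 * (d * p.2 + p.1) + p.2) ^ J) (D ^ K * (2 * p.2 + p.1) ^ J)

/-- The verification that `eigen` is superharmonic at the context `c`. -/
def ctxOK (c : List ℕ) : Bool :=
  contrOK 137 129 1000000 (contr c).1 1 (mobI baseTwo c).1 && contrOK 137 129 1000000 (contr c).1 1 (mobI baseTwo c).2 &&
    contrOK 137 129 1000000 (contr c).2 2 (mobI baseTwo c).1 && contrOK 137 129 1000000 (contr c).2 2 (mobI baseTwo c).2 &&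
    Nat.ble (eigen c * 1000000)
      (eigen ((1 :: c).take 4) * (contr c).1 + eigen ((2 :: c).take 4) * (contr c).2) &&
    Nat.blt 0 (eigen c) && Nat.ble (eigen c) 1000000

theorem ctxOK_all : ∀ a ∈ [1, 2], ∀ b ∈ [1, 2], ∀ c ∈ [1, 2], ∀ d ∈ [1, 2],
    ctxOK [a, b, c, d] = true := by decide +kernel

theorem ctxOK_take {R : List ℕ} (hR : OneTwo R) (hl : 4 ≤ R.length) : ctxOK (R.take 4) = true := by
  match R, hl with
  | a :: b :: c :: d :: R, _ =>
    exact ctxOK_all a (by simpa using hR a (by simp)) b (by simpa using hR b (by simp))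
      c (by simpa using hR c (by simp)) d (by simpa using hR d (by simp))

/-- The denominator pair of the reversal of `R`. -/
noncomputable def denR (R : List ℕ) : ℝ × ℝ := den (frac baseTwo.1) R.reverse

theorem denR_cons (d : ℕ) (R : List ℕ) :
    denR (d :: R) = (d * (denR R).1 + (denR R).2, (denR R).1) := by
  unfold denR; rw [List.reverse_cons, den_snoc]

theorem OneTwo.bounds {R : List ℕ} (hR : OneTwo R) : ∀ d ∈ R, 1 ≤ d ∧ d ≤ 2 := fun d hd => by
  rcases hR d hd with rfl | rfl <;> norm_num

theorem denR_spec {R : List ℕ} (hR : OneTwo R) :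
    1 ≤ (denR R).1 ∧ 0 ≤ (denR R).2 ∧ (R.length : ℝ) ≤ (denR R).1 ∧
      (denR R).2 / (denR R).1 ∈ Set.Icc (frac baseTwo.1) (frac baseTwo.2) := by
  have hb : ∀ d ∈ R.reverse, 1 ≤ d ∧ d ≤ 2 := fun d hd => hR.bounds d (List.mem_reverse.1 hd)
  have hm1 := isBase_two.le.trans isBase_two.hi_le
  obtain ⟨h1, h2, -⟩ := den_mem (frac_nonneg _) hm1 R.reverse fun d hd => (hb d hd).1
  have h3 := den_ge_length (frac_nonneg _) hm1 R.reverse fun d hd => (hb d hd).1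
  obtain ⟨h4, h5⟩ := isBase_two.den_ratio hb
  rw [List.length_reverse] at h3
  refine ⟨h1, h2, h3, ?_⟩
  have h6 : 0 < (denR R).1 := zero_lt_one.trans_le h1
  exact ⟨(le_div_iff₀ h6).2 h4, (div_le_iff₀ h6).2 h5⟩

theorem denR_ratio (c R : List ℕ) (hR : OneTwo (c ++ R)) :
    (denR (c ++ R)).2 / (denR (c ++ R)).1 = mob c ((denR R).2 / (denR R).1) := by
  induction c with
  | nil => rfl
  | cons d c ih =>
    have h' : OneTwo (c ++ R) := fun e he => hR e (by simp_all)
    rw [mob, ← ih h', List.cons_append, denR_cons]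
    have := (denR_spec h').1
    simp only
    field_simp

theorem denR_ratio_mem {R : List ℕ} (hR : OneTwo R) :
    0 < (mobI baseTwo (R.take 4)).1.2 ∧ 0 < (mobI baseTwo (R.take 4)).2.2 ∧
    (denR R).2 / (denR R).1 ∈
      Set.Icc (frac (mobI baseTwo (R.take 4)).1) (frac (mobI baseTwo (R.take 4)).2) := by
  have h1 : OneTwo (R.drop 4) := fun d hd => hR d (List.mem_of_mem_drop hd)
  have h2 := mobI_spec (b := baseTwo) isBase_two.pos₁ isBase_two.pos₂ (w := R.take 4)
    (fun d hd => (hR.bounds d (List.mem_of_mem_take hd)).1) (denR_spec h1).2.2.2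
  rw [← denR_ratio _ _ (by rwa [List.take_append_drop]), List.take_append_drop] at h2
  exact h2

theorem contr_le {J K D n d : ℕ} (hJ : 0 < J) (hK : 0 < K) {p q : ℕ × ℕ} (hp : 0 < p.2)
    (hq : 0 < q.2) (h1 : contrOK J K D n d p = true) (h2 : contrOK J K D n d q = true) {A B : ℝ}
    (hA : 0 < A) (hB : 0 ≤ B) (h : B / A ∈ Set.Icc (frac p) (frac q)) :
    (n : ℝ) * (2 * A + B) ^ (-(J / K : ℝ)) ≤ D * (2 * (d * A + B) + A) ^ (-(J / K : ℝ)) := by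
  set δ := (D : ℝ) ^ (K / J : ℝ) with hδ
  set ν := (n : ℝ) ^ (K / J : ℝ) with hν
  have hJ' : (0 : ℝ) < J := by exact_mod_cast hJ
  have hK' : (0 : ℝ) < K := by exact_mod_cast hK
  have lin : ∀ p : ℕ × ℕ, 0 < p.2 → contrOK J K D n d p = true →
      ν * (2 * (d + frac p) + 1) ≤ δ * (2 + frac p) := by
    intro p hp hc
    have hc' : (n : ℝ) ^ K * (2 * (d * p.2 + p.1) + p.2) ^ J ≤
        D ^ K * (2 * p.2 + p.1) ^ J := by
      have := Nat.le_of_ble_eq_true hc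
      exact_mod_cast this
    have := rpow_le_of_pow_le hJ (by positivity) (by positivity) (by positivity)
      (by positivity) hc'
    rw [← hδ, ← hν] at this
    have hp' : (0 : ℝ) < p.2 := by exact_mod_cast hp
    refine le_of_mul_le_mul_left ?_ hp'
    have e : (p.1 : ℝ) = p.2 * frac p := by unfold frac; field_simp
    rw [e] at this
    linarith
  have l1 := lin _ hp h1
  have l2 := lin _ hq h2
  have hXY : ν * (2 * (d + B / A) + 1) ≤ δ * (2 + B / A) := by
    rcases le_total (2 * ν) δ with hle | hle
    · have := mul_nonneg (sub_nonneg.2 hle) (sub_nonneg.2 h.1)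
      linarith
    · have := mul_nonneg (sub_nonneg.2 hle) (sub_nonneg.2 h.2)
      linarith
  have e : A * (B / A) = B := by field_simp
  have hXY' : ν * (2 * (d * A + B) + A) ≤ δ * (2 * A + B) := by
    have := mul_le_mul_of_nonneg_left hXY hA.le
    have k1 : A * (ν * (2 * (d + B / A) + 1)) = ν * (2 * (d * A + A * (B / A)) + A) := by ring
    have k2 : A * (δ * (2 + B / A)) = δ * (2 * A + A * (B / A)) := by ring
    rwa [k1, k2, e] at this
  have hX : 0 < 2 * (d * A + B) + A := by positivity
  have hY : 0 < 2 * A + B := by positivity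
  have hn : ∀ z : ℝ, 0 ≤ z → (z ^ (K / J : ℝ)) ^ (J / K : ℝ) = z := fun z hz => by
    rw [← Real.rpow_mul hz, div_mul_div_cancel₀ hJ'.ne', div_self hK'.ne', Real.rpow_one]
  have h3 := Real.rpow_le_rpow (by positivity) hXY' (by positivity : (0 : ℝ) ≤ J / K)
  rw [Real.mul_rpow (by positivity) hX.le, Real.mul_rpow (by positivity) hY.le, hδ, hν,
    hn _ (by positivity), hn _ (by positivity)] at h3
  rw [Real.rpow_neg hX.le, Real.rpow_neg hY.le, ← div_eq_mul_inv, ← div_eq_mul_inv,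
    div_le_div_iff₀ (by positivity) (by positivity)]
  exact h3

/-- The word `1111` followed by the reversal of `u`, written backwards. -/
def pad (u : List ℕ) : List ℕ := u ++ [1, 1, 1, 1]

theorem oneTwo_pad {u : List ℕ} (hu : OneTwo u) : OneTwo (pad u) := by
  intro d hd
  rcases List.mem_append.1 hd with h | h
  · exact hu d h
  · left; simpa using h

theorem length_pad (u : List ℕ) : (pad u).length = u.length + 4 := by simp [pad]

/-- A potential on reversed words that is comparable to a power of the size of the cylinder and
subadditive under splitting. -/
noncomputable def pot (u : List ℕ) : ℝ :=
  eigen ((pad u).take 4) * (2 * (denR (pad u)).1 + (denR (pad u)).2) ^ (-(137 / 129 : ℝ))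

theorem pot_spec {u : List ℕ} (hu : OneTwo u) :
    0 < pot u ∧ pot u ≤ pot (1 :: u) + pot (2 :: u) ∧
      pot u ≤ 1000000 * (denR (pad u)).1 ^ (-(137 / 129 : ℝ)) := by
  have hp := oneTwo_pad hu
  obtain ⟨h1, h2, -⟩ := denR_spec hp
  obtain ⟨p1, p2, h3⟩ := denR_ratio_mem hp
  have hc := ctxOK_take hp (by rw [length_pad]; omega)
  simp only [ctxOK, Bool.and_eq_true, Nat.ble_eq, Nat.blt_eq] at hc
  obtain ⟨⟨⟨⟨⟨⟨c1, c2⟩, c3⟩, c4⟩, c5⟩, c6⟩, c7⟩ := hc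
  have hA : 0 < (denR (pad u)).1 := by linarith
  have k1 := contr_le (by norm_num) (by norm_num) p1 p2 c1 c2 hA h2 h3
  have k2 := contr_le (by norm_num) (by norm_num) p1 p2 c3 c4 hA h2 h3
  have e : ∀ d, pad (d :: u) = d :: pad u := fun d => rfl
  have t : ∀ d, (d :: (pad u).take 4).take 4 = (d :: pad u).take 4 := fun d => by
    simp [List.take_take]
  rw [t, t] at c5
  have c5' : (eigen ((pad u).take 4) : ℝ) * 1000000 ≤
      eigen ((1 :: pad u).take 4) * (contr ((pad u).take 4)).1 +
        eigen ((2 :: pad u).take 4) * (contr ((pad u).take 4)).2 := by exact_mod_cast c5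
  have c6' : (0 : ℝ) < eigen ((pad u).take 4) := by exact_mod_cast c6
  have c7' : (eigen ((pad u).take 4) : ℝ) ≤ 1000000 := by exact_mod_cast c7
  have hY : (0 : ℝ) < (2 * (denR (pad u)).1 + (denR (pad u)).2) ^ (-(137 / 129 : ℝ)) := by positivity
  refine ⟨by unfold pot; positivity, ?_, ?_⟩
  · unfold pot
    rw [e, e, denR_cons, denR_cons]
    simp only [Nat.cast_one, Nat.cast_ofNat] at k1 k2 ⊢
    clear c1 c2 c3 c4
    set Y := (2 * (denR (pad u)).1 + (denR (pad u)).2) ^ (-(137 / 129 : ℝ))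
    have q1 := mul_le_mul_of_nonneg_left k1 (Nat.cast_nonneg (α := ℝ) (eigen ((1 :: pad u).take 4)))
    have q2 := mul_le_mul_of_nonneg_left k2 (Nat.cast_nonneg (α := ℝ) (eigen ((2 :: pad u).take 4)))
    have q3 := mul_le_mul_of_nonneg_right c5' hY.le
    linarith
  · unfold pot
    gcongr ?_ * ?_
    exact Real.rpow_le_rpow_of_nonpos hA (by linarith) (by norm_num)

theorem abs_mob_sub_ge {w : List ℕ} (hw : ∀ d ∈ w, 1 ≤ d) {x y : ℝ} (hx : x ∈ Set.Icc (0 : ℝ) 1)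
    (hy : y ∈ Set.Icc (0 : ℝ) 1) :
    |x - y| / (4 * (den 0 w).1 ^ 2) ≤ |mob w x - mob w y| := by
  obtain ⟨h1, h2, h3, -⟩ := den_mem le_rfl zero_le_one w hw
  have k1 := mul_nonneg h2 hx.1
  have k2 := mul_nonneg h2 hy.1
  rw [mob_sub_mob w hw hx.1 hy.1, abs_div, abs_mul, abs_pow, abs_neg, abs_one, one_pow, one_mul,
    abs_of_pos (a := (_ + _) * _) (by positivity)]
  have k3 : (den 0 w).1 + (den 0 w).2 * x ≤ 2 * (den 0 w).1 := by
    nlinarith [mul_le_mul h3 hx.2 hx.1 (by linarith)]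
  have k4 : (den 0 w).1 + (den 0 w).2 * y ≤ 2 * (den 0 w).1 := by
    nlinarith [mul_le_mul h3 hy.2 hy.1 (by linarith)]
  apply div_le_div_of_nonneg_left (abs_nonneg _) (by positivity)
  calc _ ≤ 2 * (den 0 w).1 * (2 * (den 0 w).1) := by gcongr
    _ = _ := by ring

theorem den_zero_le {m : ℝ} (hm : 0 ≤ m) (w : List ℕ) :
    (den 0 w).1 ≤ (den m w).1 ∧ (den 0 w).2 ≤ (den m w).2 := by
  induction w using List.reverseRecOn with
  | nil => simpa [den] using hm
  | append_singleton w d ih =>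
    rw [den_snoc, den_snoc]
    exact ⟨add_le_add (mul_le_mul_of_nonneg_left ih.1 (Nat.cast_nonneg d)) ih.2, ih.1⟩

theorem abs_cfv_sub_ge {x y : ℕ → ℕ} (hx : ∀ k, x k = 1 ∨ x k = 2) (hy : ∀ k, y k = 1 ∨ y k = 2)
    (h : x 0 ≠ y 0) : 7 / 50 ≤ |cfv x - cfv y| := by
  have bd : ∀ {x : ℕ → ℕ}, (∀ k, x k = 1 ∨ x k = 2) → ∀ k, 1 ≤ x k ∧ x k ≤ 2 := fun hx k => by
    rcases hx k with h | h <;> omega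
  wlog h1 : x 0 = 1 generalizing x y
  · rw [abs_sub_comm]
    exact this hy hx h.symm ((hy 0).resolve_right fun h2 => h (((hx 0).resolve_left h1).trans h2.symm))
  have h2 : y 0 = 2 := (hy 0).resolve_left fun h2 => h (h1.trans h2.symm)
  have e1 := isBase_two.cfv_mem (x := fun k => x (k + 1)) fun k => bd hx _
  have e2 := isBase_two.cfv_mem (x := fun k => y (k + 1)) fun k => bd hy _
  rw [cfv_rec x fun k => (bd hx k).1, cfv_rec y fun k => (bd hy k).1, h1, h2]
  norm_num [frac] at e1 e2
  have f1 : (57 / 100 : ℝ) ≤ 1 / ((1 : ℕ) + cfv fun k => x (k + 1)) := by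
    rw [le_div_iff₀ (by norm_num; linarith)]; norm_num; linarith
  have f2 : 1 / ((2 : ℕ) + cfv fun k => y (k + 1)) ≤ (43 / 100 : ℝ) := by
    rw [div_le_iff₀ (by norm_num; linarith)]; norm_num; linarith
  exact le_trans (by linarith) (le_abs_self _)

/-- The digits of `y`, preceded by `1111`. -/
noncomputable def digitSeq (y : ℝ) (k : ℕ) : ℕ := if k < 4 then 1 else cylDigit pot y (k - 4)

theorem digitSeq_mem (y : ℝ) (k : ℕ) : digitSeq y k = 1 ∨ digitSeq y k = 2 := by
  unfold digitSeq
  split_ifs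
  exacts [Or.inl rfl, cylDigit_mem _ _ _]

theorem digitSeq_bounds (y : ℝ) (k : ℕ) : 1 ≤ digitSeq y k ∧ digitSeq y k ≤ 2 := by
  rcases digitSeq_mem y k with h | h <;> omega

theorem pre_digitSeq {y : ℝ} {u : List ℕ} (h : Pre u.reverse (cylDigit pot y)) :
    Pre (pad u).reverse (digitSeq y) := by
  have e : (pad u).reverse = [1, 1, 1, 1] ++ u.reverse := by simp [pad]
  rw [e, pre_append]
  refine ⟨by simp [Pre, digitSeq], ?_⟩
  simpa [digitSeq] using h

theorem pot_lim : ∀ ε > 0, ∃ N : ℕ, ∀ w, OneTwo w → N ≤ w.length → pot w < ε := by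
  intro ε hε
  have h1 : Tendsto (fun n : ℕ => 1000000 * (n : ℝ) ^ (-(137 / 129 : ℝ))) atTop (𝓝 0) := by
    have := ((tendsto_rpow_neg_atTop (y := 137 / 129) (by norm_num)).comp
      tendsto_natCast_atTop_atTop).const_mul (1000000 : ℝ)
    simpa using this
  obtain ⟨N, hN⟩ := eventually_atTop.1 (h1.eventually (gt_mem_nhds hε))
  refine ⟨N + 1, fun w hw hl => (pot_spec hw).2.2.trans_lt (lt_of_le_of_lt ?_ (hN w.length (by omega)))⟩
  have h2 := (denR_spec (oneTwo_pad hw)).2.2.1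
  have h3 : (0 : ℝ) < w.length := by exact_mod_cast (by omega : 0 < w.length)
  have h4 : (w.length : ℝ) ≤ (denR (pad w)).1 := by
    rw [length_pad] at h2; push_cast at h2; linarith
  gcongr 1000000 * ?_
  exact Real.rpow_le_rpow_of_nonpos h3 h4 (by norm_num)

/-- The height of the member of the family with digits given by `y`. -/
noncomputable def height (y : ℝ) : ℝ := lam (fam (digitSeq y)) 0

theorem exists_height_bound : ∃ C : ℝ, 0 ≤ C ∧ ∀ y ∈ Set.Icc (0 : ℝ) 1, ∀ y' ∈ Set.Icc (0 : ℝ) 1,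
    |y - y'| ≤ C * |height y - height y'| ^ (137 / 258 : ℝ) := by
  have hlw : ∀ d ∈ leftWord, 1 ≤ d := by decide
  obtain ⟨q1, -⟩ := den_mem le_rfl zero_le_one leftWord hlw
  set q := (den 0 leftWord).1
  have hq : 0 < q := by linarith
  have p0 : 0 < pot [] := (pot_spec (by simp [OneTwo])).1
  set κ : ℝ := 7 / 50 / (16 * q ^ 2) with hκ
  have hκ0 : 0 < κ := by positivity
  refine ⟨1000000 / pot [] * (κ ^ (137 / 258 : ℝ))⁻¹, by positivity, fun y hy y' hy' => ?_⟩
  by_cases hne : y = y'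
  · rw [hne, sub_self, abs_zero]; positivity
  obtain ⟨w, hw, h1, h2, h3, h4⟩ := exists_split (fun w hw => (pot_spec hw).1)
    (fun w hw => (pot_spec hw).2.1) pot_lim hy hy' hne
  have hp := oneTwo_pad hw
  obtain ⟨a1, -⟩ := denR_spec hp
  set A := (denR (pad w)).1 with hA
  have hA0 : 0 < A := by linarith
  have hr : ∀ d ∈ (pad w).reverse, 1 ≤ d := fun d hd => (hp.bounds d (List.mem_reverse.1 hd)).1
  have c1 := cfv_eq_mob (fun k => (digitSeq_bounds y k).1) (pre_digitSeq h1)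
  have c2 := cfv_eq_mob (fun k => (digitSeq_bounds y' k).1) (pre_digitSeq h2)
  have hl : (pad w).reverse.length = w.length + 4 := by rw [List.length_reverse, length_pad]
  rw [hl] at c1 c2
  have g1 := abs_cfv_sub_ge (x := fun k => digitSeq y (k + (w.length + 4)))
    (y := fun k => digitSeq y' (k + (w.length + 4))) (fun k => digitSeq_mem _ _)
    (fun k => digitSeq_mem _ _) (by simpa [digitSeq] using h4)
  have g2 := abs_mob_sub_ge hr (cfv_mem _ fun k => (digitSeq_bounds y (k + (w.length + 4))).1)
    (cfv_mem _ fun k => (digitSeq_bounds y' (k + (w.length + 4))).1)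
  rw [← c1, ← c2] at g2
  have g3 := abs_mob_sub_ge hlw (cfv_mem _ fun k => (digitSeq_bounds y k).1)
    (cfv_mem _ fun k => (digitSeq_bounds y' k).1)
  have e : height y - height y' = mob leftWord (cfv (digitSeq y)) - mob leftWord (cfv (digitSeq y')) := by
    unfold height
    rw [lam_fam (digitSeq_bounds y), lam_fam (digitSeq_bounds y')]; ring
  have hd := (den_zero_le (frac_nonneg baseTwo.1) (pad w).reverse).1
  have hd0 := (den_mem le_rfl zero_le_one _ hr).1
  have g4 : κ / A ^ 2 ≤ |height y - height y'| := by
    rw [e]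
    refine le_trans ?_ g3
    calc κ / A ^ 2 = 7 / 50 / (4 * A ^ 2) / (4 * q ^ 2) := by rw [hκ]; field_simp; norm_num
      _ ≤ _ := by
        gcongr
        refine le_trans ?_ g2
        gcongr
        exact hd
  have g5 := Real.rpow_le_rpow (by positivity) g4 (by norm_num : (0 : ℝ) ≤ 137 / 258)
  have e2 : (A ^ 2) ^ (137 / 258 : ℝ) = (A ^ (-(137 / 129 : ℝ)))⁻¹ := by
    rw [← Real.rpow_neg hA0.le, neg_neg, ← Real.rpow_natCast, ← Real.rpow_mul hA0.le]
    norm_num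
  rw [Real.div_rpow hκ0.le (by positivity), e2, div_inv_eq_mul] at g5
  calc |y - y'| ≤ pot w / pot [] := h3
    _ ≤ 1000000 * A ^ (-(137 / 129 : ℝ)) / pot [] := by gcongr; exact (pot_spec hw).2.2
    _ = 1000000 / pot [] * (κ ^ (137 / 258 : ℝ))⁻¹ *
        (κ ^ (137 / 258 : ℝ) * A ^ (-(137 / 129 : ℝ))) := by
      have := Real.rpow_pos_of_pos hκ0 (137 / 258)
      field_simp
    _ ≤ _ := by gcongr

theorem le_dimH_markov_diff_lagrange :
    ENNReal.ofReal (137 / 258) ≤ dimH (MarkovSpectrum \ LagrangeSpectrum) := by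
  obtain ⟨C, hC, h⟩ := exists_height_bound
  have hinj : Set.InjOn height (Set.Icc (0 : ℝ) 1) := fun y hy y' hy' he => by
    have := h y hy y' hy'
    rw [he, sub_self, abs_zero, Real.zero_rpow (by norm_num), mul_zero] at this
    exact sub_eq_zero.1 (abs_nonpos_iff.1 this)
  have hinv := hinj.leftInvOn_invFunOn
  set f := Function.invFunOn height (Set.Icc (0 : ℝ) 1)
  have hf : HolderOnWith C.toNNReal (137 / 258) f (height '' Set.Icc (0 : ℝ) 1) := by
    rintro _ ⟨y, hy, rfl⟩ _ ⟨y', hy', rfl⟩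
    rw [hinv hy, hinv hy', edist_dist, edist_dist, Real.dist_eq, Real.dist_eq]
    have e : ((C.toNNReal : NNReal) : ℝ≥0∞) = ENNReal.ofReal C := rfl
    rw [e, ENNReal.ofReal_rpow_of_nonneg (abs_nonneg _) (by positivity), ← ENNReal.ofReal_mul hC]
    refine ENNReal.ofReal_le_ofReal ?_
    simpa using h y hy y' hy'
  have h1 := hf.dimH_image_le (by norm_num)
  have h2 : f '' (height '' Set.Icc (0 : ℝ) 1) = Set.Icc (0 : ℝ) 1 := hinv.image_image
  rw [h2, Real.dimH_of_nonempty_interior (by rw [interior_Icc]; simp)] at h1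
  have h3 : height '' Set.Icc (0 : ℝ) 1 ⊆ MarkovSpectrum \ LagrangeSpectrum := by
    rintro _ ⟨y, -, rfl⟩
    exact lam_fam_mem_diff (digitSeq_bounds y)
  have h4 : (((137 / 258 : NNReal)) : ℝ≥0∞) = ENNReal.ofReal (137 / 258) := by
    rw [ENNReal.ofReal, Real.toNNReal_div (by norm_num)]
    norm_num
  rw [ENNReal.le_div_iff_mul_le (Or.inl (by simp)) (Or.inl ENNReal.coe_ne_top), h4] at h1
  refine le_trans ?_ (dimH_mono h3)
  simpa using h1

theorem lt_dimH_markov_diff_lagrange :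
    ENNReal.ofReal 0.531 < dimH (MarkovSpectrum \ LagrangeSpectrum) :=
  lt_of_lt_of_le ((ENNReal.ofReal_lt_ofReal_iff (by norm_num)).2 (by norm_num))
    le_dimH_markov_diff_lagrange

end MarkovLagrange

/-- `0.531 < dimH(M ∖ L) < 0.987`. -/
theorem dimH_M_diff_L_bounds :
    ENNReal.ofReal 0.531 < dimH (MarkovSpectrum \ LagrangeSpectrum) ∧
    dimH (MarkovSpectrum \ LagrangeSpectrum) < ENNReal.ofReal 0.987 := by
  exact ⟨MarkovLagrange.lt_dimH_markov_diff_lagrange, MarkovLagrange.dimH_markov_diff_lagrange_lt⟩
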